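/- Channel skewness of Cover–Thomas symmetric channels in the SMD regime: Let P_{Y|X} be a Cover–Thomas symmetric channel with dispersion V > 0 under the uniform input distribution P*, and let ε_n be an SMD sequence satisfying Q^{-1}(ε_n) = O(n^{1/6}). Then ζ(n,ε_n) = (1/2)·log n + S·Q^{-1}(ε_n)² + O(1), where S = Sk_u(P*)·√V/6 + 1/2 is the channel skewness. -/

import Mathlib

open Filter MeasureTheory Finset
open scoped Classical

noncomputable section

def gaussQ (x : ℝ) : ℝ := ∫ t in Set.Ioi x, (Real.sqrt (2 * Real.pi))⁻¹ * Real.exp (-t ^ 2 / 2)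

def gaussQinv : ℝ → ℝ := Function.invFun gaussQ

def IsSMD (ε : ℕ → ℝ) : Prop :=
  (∀ n, ε n ∈ Set.Ioo (0 : ℝ) 1) ∧
  Tendsto (fun n : ℕ => Real.log (1 / ε n) / (n : ℝ)) atTop (nhds 0) ∧
  Tendsto (fun n : ℕ => Real.log (1 / (1 - ε n)) / (n : ℝ)) atTop (nhds 0)

variable {𝓧 𝓨 : Type*} [Fintype 𝓧] [Fintype 𝓨]

def IsKernel (W : 𝓧 → 𝓨 → ℝ) : Prop :=
  (∀ x y, 0 ≤ W x y) ∧ ∀ x, ∑ y, W x y = 1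

def IsDist (p : 𝓧 → ℝ) : Prop := (∀ x, 0 ≤ p x) ∧ ∑ x, p x = 1

/-- Cover–Thomas symmetric channel: every row of the transition matrix is a permutation of
every other row, and every column is a permutation of every other column. -/
def CoverThomasSymmetric (W : 𝓧 → 𝓨 → ℝ) : Prop :=
  (∀ x x' : 𝓧, ∃ σ : 𝓨 ≃ 𝓨, ∀ y, W x' y = W x (σ y)) ∧
  (∀ y y' : 𝓨, ∃ σ : 𝓧 ≃ 𝓧, ∀ x, W x y' = W (σ x) y)

def avgErr (W : 𝓧 → 𝓨 → ℝ) (n M : ℕ) (f : Fin M → Fin n → 𝓧)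
    (g : (Fin n → 𝓨) → Fin M) : ℝ :=
  1 - (M : ℝ)⁻¹ * ∑ m : Fin M, ∑ y : Fin n → 𝓨,
    (if g y = m then ∏ i, W (f m i) (y i) else 0)

def ExistsCode (W : 𝓧 → 𝓨 → ℝ) (n M : ℕ) (e : ℝ) : Prop :=
  ∃ f : Fin M → Fin n → 𝓧, ∃ g : (Fin n → 𝓨) → Fin M, avgErr W n M f g ≤ e

def Mstar (W : 𝓧 → 𝓨 → ℝ) (n : ℕ) (e : ℝ) : ℕ := sSup {M | ExistsCode W n M e}

def outDist (W : 𝓧 → 𝓨 → ℝ) (p : 𝓧 → ℝ) (y : 𝓨) : ℝ := ∑ x, p x * W x y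

def iDen (W : 𝓧 → 𝓨 → ℝ) (p : 𝓧 → ℝ) (x : 𝓧) (y : 𝓨) : ℝ :=
  Real.log (W x y / outDist W p y)

def mutInfo (W : 𝓧 → 𝓨 → ℝ) (p : 𝓧 → ℝ) : ℝ :=
  ∑ x, ∑ y, p x * W x y * iDen W p x y

def capacity (W : 𝓧 → 𝓨 → ℝ) : ℝ := sSup (mutInfo W '' {p | IsDist p})

/-- The uniform input distribution. -/
def unifDist (𝓧 : Type*) [Fintype 𝓧] : 𝓧 → ℝ := fun _ => (Fintype.card 𝓧 : ℝ)⁻¹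

/-- `μ_k = E[(ı(X;Y) − C)^k]`, the k-th central moment of the information density under the
uniform input distribution. -/
def ctMoment (W : 𝓧 → 𝓨 → ℝ) (k : ℕ) : ℝ :=
  ∑ x, ∑ y, unifDist 𝓧 x * W x y * (iDen W (unifDist 𝓧) x y - capacity W) ^ k

/-- The dispersion `V` of a Cover–Thomas symmetric channel (under the uniform input). -/
def ctV (W : 𝓧 → 𝓨 → ℝ) : ℝ := ctMoment W 2

/-- The channel skewness `S = Sk_u(P*)·√V/6 + 1/2` of a Cover–Thomas symmetric channel. -/
def ctS (W : 𝓧 → 𝓨 → ℝ) : ℝ :=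
  (ctMoment W 3 / ctV W ^ ((3 : ℝ) / 2)) * Real.sqrt (ctV W) / 6 + 1 / 2

/-- Non-Gaussianity of a Cover–Thomas symmetric channel. -/
def ctZeta (W : 𝓧 → 𝓨 → ℝ) (n : ℕ) (e : ℝ) : ℝ :=
  Real.log (Mstar W n e) - ((n : ℝ) * capacity W - Real.sqrt ((n : ℝ) * ctV W) * gaussQinv e)

section

open scoped NNReal
open ProbabilityTheory

/-- Expectation of `f (ζ a₁ + ⋯ + ζ aₙ)` for `n` independent samples `aᵢ` with weights `p`. -/
def iidExp {α : Type*} [Fintype α] (p ζ : α → ℝ) (n : ℕ) (f : ℝ → ℝ) : ℝ :=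
  ∑ a : Fin n → α, (∏ i, p (a i)) * f (∑ i, ζ (a i))

section iidExp

variable {α : Type*} [Fintype α] {p ζ : α → ℝ} {n : ℕ}

lemma iidExp_zero (f : ℝ → ℝ) : iidExp p ζ 0 f = f 0 := by
  simp [iidExp]

lemma iidExp_succ (f : ℝ → ℝ) :
    iidExp p ζ (n + 1) f = iidExp p ζ n (fun s => ∑ a, p a * f (s + ζ a)) := by
  unfold iidExp
  rw [← (Fin.snocEquiv (fun _ : Fin (n + 1) => α)).sum_comp, Fintype.sum_prod_type, Finset.sum_comm]
  refine Finset.sum_congr rfl fun a _ => ?_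
  rw [Finset.mul_sum]
  refine Finset.sum_congr rfl fun b _ => ?_
  simp [Fin.snocEquiv, Fin.prod_univ_castSucc, Fin.sum_univ_castSucc]
  ring

lemma iidExp_sub (f g : ℝ → ℝ) :
    iidExp p ζ n (fun s => f s - g s) = iidExp p ζ n f - iidExp p ζ n g := by
  simp [iidExp, mul_sub, Finset.sum_sub_distrib]

lemma iidExp_const_mul (c : ℝ) (f : ℝ → ℝ) :
    iidExp p ζ n (fun s => c * f s) = c * iidExp p ζ n f := by
  simp only [iidExp, Finset.mul_sum]
  exact Finset.sum_congr rfl fun a _ => by ring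

lemma iidExp_const (hp1 : ∑ a, p a = 1) (c : ℝ) : iidExp p ζ n (fun _ => c) = c := by
  unfold iidExp
  rw [← Finset.sum_mul, ← Fintype.sum_pow, hp1]
  simp

lemma iidExp_mono (hp : ∀ a, 0 ≤ p a) {f g : ℝ → ℝ} (h : ∀ s, f s ≤ g s) :
    iidExp p ζ n f ≤ iidExp p ζ n g :=
  Finset.sum_le_sum fun _ _ => mul_le_mul_of_nonneg_left (h _) (Finset.prod_nonneg fun _ _ => hp _)

lemma iidExp_nonneg (hp : ∀ a, 0 ≤ p a) {f : ℝ → ℝ} (h : ∀ s, 0 ≤ f s) :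
    0 ≤ iidExp p ζ n f :=
  Finset.sum_nonneg fun _ _ => mul_nonneg (Finset.prod_nonneg fun _ _ => hp _) (h _)

lemma iidExp_congr {f g : ℝ → ℝ} (h : ∀ s, f s = g s) : iidExp p ζ n f = iidExp p ζ n g := by
  rw [funext h]

lemma iidExp_integral {f : ℝ → ℝ → ℝ} (h : ∀ s, Integrable (f s)) :
    iidExp p ζ n (fun s => ∫ v, f s v) = ∫ v, iidExp p ζ n (fun s => f s v) := by
  unfold iidExp
  rw [integral_finsetSum _ fun a _ => (h _).const_mul _]
  exact Finset.sum_congr rfl fun a _ => by rw [integral_const_mul]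

/-- Affine change of the summands. -/
lemma iidExp_affine (c b : ℝ) (f : ℝ → ℝ) :
    iidExp p (fun a => c * ζ a + b) n f = iidExp p ζ n (fun s => f (c * s + n * b)) := by
  unfold iidExp
  refine Finset.sum_congr rfl fun a _ => ?_
  simp [Finset.sum_add_distrib, Finset.mul_sum]

/-- Exponential change of measure. -/
lemma iidExp_tilt {m θ : ℝ} (hm : m ≠ 0) (f : ℝ → ℝ) :
    iidExp p ζ n f =
      m ^ n * iidExp (fun a => p a * Real.exp (θ * ζ a) / m) ζ n
        (fun s => Real.exp (-(θ * s)) * f s) := by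
  unfold iidExp
  rw [Finset.mul_sum]
  refine Finset.sum_congr rfl fun a _ => ?_
  rw [Finset.prod_div_distrib, Finset.prod_mul_distrib, Finset.prod_const, ← Real.exp_sum,
    ← Finset.mul_sum]
  simp only [Finset.card_univ, Fintype.card_fin, Real.exp_neg]
  field_simp

end iidExp

end

section

open scoped NNReal
open ProbabilityTheory

/-- Distribution function of the centred Gaussian law of variance `v`. -/
def gcdf (v : ℝ≥0) (x : ℝ) : ℝ := (gaussianReal 0 v).real (Set.Iic x)

lemma gcdf_nonneg (v : ℝ≥0) (x : ℝ) : 0 ≤ gcdf v x := measureReal_nonneg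

lemma gcdf_le_one (v : ℝ≥0) (x : ℝ) : gcdf v x ≤ 1 := measureReal_le_one

lemma gcdf_mono (v : ℝ≥0) : Monotone (gcdf v) := fun _ _ h =>
  measureReal_mono (Set.Iic_subset_Iic.2 h)

lemma gcdf_eq_integral {v : ℝ≥0} (hv : v ≠ 0) (x : ℝ) :
    gcdf v x = ∫ y in Set.Iic x, gaussianPDFReal 0 v y := by
  rw [gcdf, measureReal_def, gaussianReal_apply_eq_integral _ hv, ENNReal.toReal_ofReal]
  exact integral_nonneg fun _ => gaussianPDFReal_nonneg _ _ _

lemma gcdf_conv (k : ℝ≥0) {s : ℝ≥0} (hs : s ≠ 0) (x : ℝ) :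
    ∫ v, gcdf k (x - v) * gaussianPDFReal 0 s v = gcdf (k + s) x := by
  have h := gaussianReal_conv_gaussianReal (m₁ := 0) (m₂ := 0) (v₁ := s) (v₂ := k)
  have h2 : gcdf (k + s) x = ((gaussianReal 0 s).conv (gaussianReal 0 k)).real (Set.Iic x) := by
    rw [h, add_zero, add_comm s k]; rfl
  rw [h2, measureReal_def, Measure.conv, Measure.map_apply (by fun_prop) measurableSet_Iic,
    Measure.prod_apply (by measurability)]
  have h3 : ∀ y, Prod.mk y ⁻¹' ((fun x : ℝ × ℝ => x.1 + x.2) ⁻¹' Set.Iic x) = Set.Iic (x - y) := by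
    intro y; ext z; simp [le_sub_iff_add_le']
  simp only [h3]
  rw [← integral_toReal]
  · rw [integral_gaussianReal_eq_integral_smul hs]
    refine integral_congr_ae (ae_of_all _ fun v => ?_)
    simp [gcdf, measureReal_def, mul_comm]
  · have : Antitone fun y => (gaussianReal 0 k) (Set.Iic (x - y)) := fun a b hab =>
      measure_mono (Set.Iic_subset_Iic.2 (by linarith))
    exact this.measurable.aemeasurable
  · exact ae_of_all _ fun y => measure_lt_top _ _

lemma gaussianPDFReal_le {v : ℝ≥0} (hv : v ≠ 0) (x : ℝ) :
    gaussianPDFReal 0 v x ≤ 1 / √(v : ℝ) := by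
  have hv' : (0 : ℝ) < v := by positivity
  rw [gaussianPDFReal, one_div]
  have h1 : √(v : ℝ) ≤ √(2 * Real.pi * v) :=
    Real.sqrt_le_sqrt (by nlinarith [Real.pi_gt_three])
  have h2 : Real.exp (-(x - 0) ^ 2 / (2 * v)) ≤ 1 := by
    rw [Real.exp_le_one_iff]
    exact div_nonpos_of_nonpos_of_nonneg (by nlinarith [sq_nonneg (x - 0)]) (by positivity)
  calc _ ≤ (√(2 * Real.pi * v))⁻¹ * 1 := by gcongr
    _ ≤ (√(v : ℝ))⁻¹ := by rw [mul_one]; gcongr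

lemma gcdf_lipschitz {v : ℝ≥0} (hv : v ≠ 0) (x y : ℝ) :
    |gcdf v x - gcdf v y| ≤ 1 / √(v : ℝ) * |x - y| := by
  have hi := integrable_gaussianPDFReal 0 v
  have : gcdf v x - gcdf v y = ∫ t in y..x, gaussianPDFReal 0 v t := by
    rw [gcdf_eq_integral hv, gcdf_eq_integral hv,
      intervalIntegral.integral_Iic_sub_Iic hi.integrableOn hi.integrableOn]
  rw [this, ← Real.norm_eq_abs]
  refine intervalIntegral.norm_integral_le_of_norm_le_const (C := 1 / √(v : ℝ)) fun t _ => ?_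
  rw [Real.norm_of_nonneg (gaussianPDFReal_nonneg _ _ _)]
  exact gaussianPDFReal_le hv t

lemma integrable_sq_mul_gaussianPDFReal (v : ℝ≥0) :
    Integrable fun x => x ^ 2 * gaussianPDFReal 0 v x := by
  by_cases hv : v = 0
  · simp [hv]
  have h := (memLp_id_gaussianReal (μ := 0) (v := v) 2).integrable_sq
  rw [gaussianReal_of_var_ne_zero _ hv] at h
  have h' := (integrable_withDensity_iff (measurable_gaussianPDF 0 v)
    (ae_of_all _ fun _ => gaussianPDF_lt_top)).1 h
  simpa [toReal_gaussianPDF] using h'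

lemma integral_sq_mul_gaussianPDFReal {v : ℝ≥0} (hv : v ≠ 0) :
    ∫ x, x ^ 2 * gaussianPDFReal 0 v x = v := by
  have h := variance_fun_id_gaussianReal (μ := 0) (v := v)
  rw [variance_eq_integral (by fun_prop), integral_id_gaussianReal,
    integral_gaussianReal_eq_integral_smul hv] at h
  simpa [mul_comm] using h

lemma gcdf_scale {c : ℝ} (hc : 0 < c) (x : ℝ) :
    gcdf (.mk (c ^ 2) (sq_nonneg _)) (c * x) = gcdf 1 x := by
  have h := gaussianReal_map_const_mul (μ := 0) (v := 1) c
  rw [mul_zero, mul_one] at h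
  rw [gcdf, gcdf, measureReal_def, measureReal_def, ← h,
    Measure.map_apply (by fun_prop) measurableSet_Iic]
  congr 2
  ext y
  simp [mul_le_mul_iff_right₀ hc]

lemma gcdf_neg {v : ℝ≥0} (hv : v ≠ 0) (x : ℝ) : gcdf v (-x) = 1 - gcdf v x := by
  have h := gaussianReal_map_neg (μ := 0) (v := v)
  have := nullSingletonClass_gaussianReal (μ := 0) hv
  rw [neg_zero] at h
  rw [gcdf, gcdf, ← probReal_compl_eq_one_sub measurableSet_Iic, measureReal_def, measureReal_def]
  nth_rw 1 [← h]
  rw [Measure.map_apply (by fun_prop) measurableSet_Iic]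
  have : (fun x : ℝ => -x) ⁻¹' Set.Iic (-x) = Set.Ici x := by ext y; simp
  rw [this, Set.compl_Iic, measure_congr Ioi_ae_eq_Ici]

end

section

open scoped NNReal
open ProbabilityTheory

lemma abs_exp_sub_taylor_one_le (u : ℝ) : |Real.exp u - (1 + u)| ≤ u ^ 2 * Real.exp |u| := by
  have h := Complex.norm_exp_sub_sum_le_norm_mul_exp (u : ℂ) 2
  simp only [Finset.sum_range_succ, Finset.sum_range_zero] at h
  rw [← Complex.ofReal_exp] at h
  have e : (Real.exp u : ℂ) - (0 + (u : ℂ) ^ 0 / (Nat.factorial 0 : ℕ)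
      + (u : ℂ) ^ 1 / (Nat.factorial 1 : ℕ)) = ((Real.exp u - (1 + u) : ℝ) : ℂ) := by
    push_cast; simp
  rw [e, Complex.norm_real, Complex.norm_real, Real.norm_eq_abs, Real.norm_eq_abs, sq_abs] at h
  exact h

lemma abs_exp_sub_taylor_two_le (u : ℝ) :
    |Real.exp u - (1 + u + u ^ 2 / 2)| ≤ |u| ^ 3 * Real.exp |u| := by
  have h := Complex.norm_exp_sub_sum_le_norm_mul_exp (u : ℂ) 3
  simp only [Finset.sum_range_succ, Finset.sum_range_zero] at h
  rw [← Complex.ofReal_exp] at h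
  have e : (Real.exp u : ℂ) - (0 + (u : ℂ) ^ 0 / (Nat.factorial 0 : ℕ)
      + (u : ℂ) ^ 1 / (Nat.factorial 1 : ℕ) + (u : ℂ) ^ 2 / (Nat.factorial 2 : ℕ)) =
      ((Real.exp u - (1 + u + u ^ 2 / 2) : ℝ) : ℂ) := by
    push_cast; simp
  rw [e, Complex.norm_real, Complex.norm_real, Real.norm_eq_abs, Real.norm_eq_abs] at h
  exact h

/-- Second order expansion of the Gaussian kernel in a shift of its argument. -/
lemma exists_gaussian_shift_bound : ∃ C : ℝ, 0 < C ∧ ∀ h y : ℝ, |h| ≤ 1 →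
    |Real.exp (-(y - h) ^ 2 / 2) - Real.exp (-y ^ 2 / 2) * (1 + h * y + h ^ 2 * (y ^ 2 - 1) / 2)|
      ≤ C * |h| ^ 3 * Real.exp (-y ^ 2 / 8) := by
  refine ⟨7 * Real.exp 5, by positivity, fun h y hh => ?_⟩
  set u := h * y - h ^ 2 / 2 with hu
  have h0 : 0 ≤ |h| := abs_nonneg h
  have hy0 : 0 ≤ |y| := abs_nonneg y
  have e1 : Real.exp (-(y - h) ^ 2 / 2) = Real.exp (-y ^ 2 / 2) * Real.exp u := by
    rw [← Real.exp_add]; congr 1; rw [hu]; ring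
  have e2 : Real.exp (-(y - h) ^ 2 / 2) -
      Real.exp (-y ^ 2 / 2) * (1 + h * y + h ^ 2 * (y ^ 2 - 1) / 2) =
      Real.exp (-y ^ 2 / 2) * ((Real.exp u - (1 + u + u ^ 2 / 2)) +
        (-(h ^ 3 * y / 2) + h ^ 4 / 8)) := by
    rw [e1, hu]; ring
  have hu1 : |u| ≤ |h| * (|y| + 1) := by
    calc |u| ≤ |h * y| + |h ^ 2 / 2| := abs_sub _ _
      _ = |h| * |y| + |h| ^ 2 / 2 := by rw [abs_mul, abs_div, abs_pow]; norm_num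
      _ ≤ _ := by nlinarith
  have hu2 : |u| ≤ |y| + 1 := hu1.trans (by nlinarith)
  have hcube : (|y| + 1) ^ 3 ≤ 6 * Real.exp (|y| + 1) := by
    have := Real.pow_div_factorial_le_exp (|y| + 1) (by positivity) 3
    norm_num [Nat.factorial] at this
    linarith
  have b1 : |Real.exp u - (1 + u + u ^ 2 / 2)| ≤ |h| ^ 3 * (6 * Real.exp (2 * (|y| + 1))) := by
    calc _ ≤ |u| ^ 3 * Real.exp |u| := abs_exp_sub_taylor_two_le u
      _ ≤ (|h| * (|y| + 1)) ^ 3 * Real.exp (|y| + 1) := by gcongr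
      _ = |h| ^ 3 * ((|y| + 1) ^ 3 * Real.exp (|y| + 1)) := by ring
      _ ≤ |h| ^ 3 * ((6 * Real.exp (|y| + 1)) * Real.exp (|y| + 1)) := by gcongr
      _ = _ := by rw [mul_assoc, ← Real.exp_add]; ring_nf
  have b2 : |-(h ^ 3 * y / 2) + h ^ 4 / 8| ≤ |h| ^ 3 * Real.exp (2 * (|y| + 1)) := by
    calc _ ≤ |-(h ^ 3 * y / 2)| + |h ^ 4 / 8| := abs_add_le _ _
      _ = |h| ^ 3 * (|y| / 2 + |h| / 8) := by
        rw [abs_neg, abs_div, abs_div, abs_mul, abs_pow, abs_pow]; norm_num; ring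
      _ ≤ |h| ^ 3 * Real.exp (2 * (|y| + 1)) := by
        have := Real.add_one_le_exp (2 * (|y| + 1))
        gcongr; linarith
  rw [e2, abs_mul, abs_of_pos (Real.exp_pos _)]
  have hexp : Real.exp (-y ^ 2 / 2) * Real.exp (2 * (|y| + 1)) ≤
      Real.exp 5 * Real.exp (-y ^ 2 / 8) := by
    rw [← Real.exp_add, ← Real.exp_add, Real.exp_le_exp]
    nlinarith [sq_nonneg (|y| - 8 / 3), sq_abs y]
  calc _ ≤ Real.exp (-y ^ 2 / 2) * (|h| ^ 3 * (6 * Real.exp (2 * (|y| + 1))) +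
        |h| ^ 3 * Real.exp (2 * (|y| + 1))) := by
        gcongr; exact (abs_add_le _ _).trans (add_le_add b1 b2)
    _ = 7 * |h| ^ 3 * (Real.exp (-y ^ 2 / 2) * Real.exp (2 * (|y| + 1))) := by ring
    _ ≤ 7 * |h| ^ 3 * (Real.exp 5 * Real.exp (-y ^ 2 / 8)) := by gcongr
    _ = _ := by ring

/-- First order expansion of the Gaussian kernel in its variance. -/
lemma exists_gaussian_variance_bound : ∃ C : ℝ, 0 < C ∧ ∀ a y : ℝ, 0 ≤ a → a ≤ 1 →
    |(√(1 + a))⁻¹ * Real.exp (-y ^ 2 / (2 * (1 + a))) -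
        Real.exp (-y ^ 2 / 2) * (1 + a * (y ^ 2 - 1) / 2)|
      ≤ C * a ^ 2 * Real.exp (-y ^ 2 / 8) := by
  refine ⟨256 * Real.exp 1, by positivity, fun a y ha0 ha1 => ?_⟩
  set u := y ^ 2 * a / (2 * (1 + a)) - Real.log (1 + a) / 2 with hu
  have h1a : 0 < 1 + a := by linarith
  have e1 : (√(1 + a))⁻¹ * Real.exp (-y ^ 2 / (2 * (1 + a))) =
      Real.exp (-y ^ 2 / 2) * Real.exp u := by
    have : (√(1 + a))⁻¹ = Real.exp (-(Real.log (1 + a) / 2)) := by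
      rw [Real.exp_neg, ← Real.log_sqrt h1a.le, Real.exp_log (Real.sqrt_pos.2 h1a)]
    rw [this, ← Real.exp_add, ← Real.exp_add]
    congr 1
    rw [hu]; field_simp; ring
  have e2 : (√(1 + a))⁻¹ * Real.exp (-y ^ 2 / (2 * (1 + a))) -
      Real.exp (-y ^ 2 / 2) * (1 + a * (y ^ 2 - 1) / 2) =
      Real.exp (-y ^ 2 / 2) * ((Real.exp u - (1 + u)) +
        ((a - Real.log (1 + a)) / 2 - y ^ 2 * a ^ 2 / (2 * (1 + a)))) := by
    rw [e1, hu]; field_simp; ring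
  have hl1 : Real.log (1 + a) ≤ a := by
    have := Real.log_le_sub_one_of_pos h1a; linarith
  have hl0 : 0 ≤ Real.log (1 + a) := Real.log_nonneg (by linarith)
  have hl2 : a - Real.log (1 + a) ≤ a ^ 2 := by
    have := Real.one_sub_inv_le_log_of_pos h1a
    have h2 : 1 - (1 + a)⁻¹ = a / (1 + a) := by field_simp; ring
    rw [h2] at this
    have : a - a / (1 + a) ≤ a ^ 2 := by
      rw [sub_le_iff_le_add, ← sub_le_iff_le_add', le_div_iff₀ h1a]; nlinarith [pow_nonneg ha0 3]
    linarith
  have hq0 : 0 ≤ y ^ 2 * a / (2 * (1 + a)) := by positivity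
  have hq1 : y ^ 2 * a / (2 * (1 + a)) ≤ a * y ^ 2 / 2 := by
    rw [div_le_div_iff₀ (by positivity) (by positivity)]
    nlinarith [mul_nonneg (mul_nonneg ha0 ha0) (sq_nonneg y)]
  have hq2 : y ^ 2 * a / (2 * (1 + a)) ≤ y ^ 2 / 4 := by
    rw [div_le_div_iff₀ (by positivity) (by positivity)]
    nlinarith [mul_nonneg (sub_nonneg.2 ha1) (sq_nonneg y)]
  have hu1 : |u| ≤ a * (1 + y ^ 2) / 2 := by
    rw [abs_le]; constructor <;> nlinarith [mul_nonneg ha0 (sq_nonneg y)]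
  have hu2 : |u| ≤ 1 / 2 + y ^ 2 / 4 := by
    rw [abs_le]; constructor <;> nlinarith [sq_nonneg y]
  have hr0 : 0 ≤ y ^ 2 * a ^ 2 / (2 * (1 + a)) := by positivity
  have hr1 : y ^ 2 * a ^ 2 / (2 * (1 + a)) ≤ y ^ 2 * a ^ 2 / 2 := by
    apply div_le_div_of_nonneg_left (by positivity) (by positivity); linarith
  have b2 : |(a - Real.log (1 + a)) / 2 - y ^ 2 * a ^ 2 / (2 * (1 + a))| ≤
      a ^ 2 * (1 + y ^ 2) ^ 2 / 2 := by
    have : a ^ 2 * (1 + y ^ 2) ^ 2 / 2 = a ^ 2 / 2 + a ^ 2 * y ^ 2 + a ^ 2 * y ^ 4 / 2 := by ring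
    rw [this, abs_le]
    have h1 : 0 ≤ a ^ 2 * y ^ 4 := by positivity
    have h2 : 0 ≤ a ^ 2 * y ^ 2 := by positivity
    constructor <;> nlinarith [sq_nonneg a]
  have b1 : |Real.exp u - (1 + u)| ≤ a ^ 2 * (1 + y ^ 2) ^ 2 / 2 * Real.exp (1 / 2 + y ^ 2 / 4) := by
    calc _ ≤ u ^ 2 * Real.exp |u| := abs_exp_sub_taylor_one_le u
      _ = |u| ^ 2 * Real.exp |u| := by rw [sq_abs]
      _ ≤ (a * (1 + y ^ 2) / 2) ^ 2 * Real.exp (1 / 2 + y ^ 2 / 4) := by gcongr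
      _ ≤ _ := by
        gcongr
        have : 0 ≤ a ^ 2 * (1 + y ^ 2) ^ 2 := by positivity
        nlinarith
  have b3 : a ^ 2 * (1 + y ^ 2) ^ 2 / 2 ≤
      a ^ 2 * (1 + y ^ 2) ^ 2 / 2 * Real.exp (1 / 2 + y ^ 2 / 4) := by
    have : 1 ≤ Real.exp (1 / 2 + y ^ 2 / 4) := Real.one_le_exp (by positivity)
    nlinarith [show 0 ≤ a ^ 2 * (1 + y ^ 2) ^ 2 / 2 by positivity]
  have hsq : (1 + y ^ 2) ^ 2 ≤ 256 * Real.exp ((1 + y ^ 2) / 8) := by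
    have h := Real.add_one_le_exp ((1 + y ^ 2) / 16)
    have h2 : (1 + y ^ 2) / 16 ≤ Real.exp ((1 + y ^ 2) / 16) := by linarith
    have h3 : ((1 + y ^ 2) / 16) ^ 2 ≤ Real.exp ((1 + y ^ 2) / 16) ^ 2 := by gcongr
    rw [← Real.exp_nat_mul] at h3
    have : ((2 : ℕ) : ℝ) * ((1 + y ^ 2) / 16) = (1 + y ^ 2) / 8 := by push_cast; ring
    rw [this] at h3
    linarith
  rw [e2, abs_mul, abs_of_pos (Real.exp_pos _)]
  have hexp : Real.exp (-y ^ 2 / 2) * (Real.exp ((1 + y ^ 2) / 8) *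
      Real.exp (1 / 2 + y ^ 2 / 4)) ≤ Real.exp 1 * Real.exp (-y ^ 2 / 8) := by
    rw [← Real.exp_add, ← Real.exp_add, ← Real.exp_add, Real.exp_le_exp]
    nlinarith [sq_nonneg y]
  calc _ ≤ Real.exp (-y ^ 2 / 2) * (a ^ 2 * (1 + y ^ 2) ^ 2 / 2 * Real.exp (1 / 2 + y ^ 2 / 4) +
        a ^ 2 * (1 + y ^ 2) ^ 2 / 2 * Real.exp (1 / 2 + y ^ 2 / 4)) := by
        gcongr; exact (abs_add_le _ _).trans (add_le_add b1 (b2.trans b3))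
    _ = a ^ 2 * (1 + y ^ 2) ^ 2 * (Real.exp (-y ^ 2 / 2) * Real.exp (1 / 2 + y ^ 2 / 4)) := by ring
    _ ≤ a ^ 2 * (256 * Real.exp ((1 + y ^ 2) / 8)) *
        (Real.exp (-y ^ 2 / 2) * Real.exp (1 / 2 + y ^ 2 / 4)) := by gcongr
    _ = 256 * a ^ 2 * (Real.exp (-y ^ 2 / 2) * (Real.exp ((1 + y ^ 2) / 8) *
      Real.exp (1 / 2 + y ^ 2 / 4))) := by ring
    _ ≤ 256 * a ^ 2 * (Real.exp 1 * Real.exp (-y ^ 2 / 8)) := by gcongr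
    _ = _ := by ring

end

section

open scoped NNReal
open ProbabilityTheory

/-- A finitely supported standardized law: weights `p`, values `ζ` bounded by `B`. -/
structure IsStdLaw {α : Type*} [Fintype α] (p ζ : α → ℝ) (B : ℝ) : Prop where
  nonneg : ∀ a, 0 ≤ p a
  sum_one : ∑ a, p a = 1
  mean : ∑ a, p a * ζ a = 0
  var : ∑ a, p a * ζ a ^ 2 = 1
  bound : ∀ a, |ζ a| ≤ B

/-- Difference between the density of `ζ + √s N` and that of `√(s + 1) N`. -/
def kernelDiff {α : Type*} [Fintype α] (p ζ : α → ℝ) (s : ℝ≥0) (v : ℝ) : ℝ :=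
  ∑ a, p a * gaussianPDFReal 0 s (v - ζ a) - gaussianPDFReal 0 (s + 1) v

lemma integrable_kernelDiff {α : Type*} [Fintype α] (p ζ : α → ℝ) (s : ℝ≥0) :
    Integrable (kernelDiff p ζ s) := by
  refine Integrable.sub (integrable_finsetSum _ fun a _ => ?_) (integrable_gaussianPDFReal _ _)
  exact ((integrable_gaussianPDFReal 0 s).comp_sub_right (ζ a)).const_mul _

lemma exists_kernelDiff_bound {α : Type*} [Fintype α] {B : ℝ} (hB : 1 ≤ B) :
    ∃ C : ℝ, 0 < C ∧ ∀ p ζ : α → ℝ, IsStdLaw p ζ B → ∀ s : ℝ≥0, B ^ 2 ≤ s → ∀ v : ℝ,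
      |kernelDiff p ζ s v| ≤
        C / (s * √(s : ℝ)) * ((√(s : ℝ))⁻¹ * Real.exp (-(8 * (s : ℝ))⁻¹ * v ^ 2)) := by
  obtain ⟨C₁, hC₁, h₁⟩ := exists_gaussian_shift_bound
  obtain ⟨C₂, hC₂, h₂⟩ := exists_gaussian_variance_bound
  refine ⟨(C₁ + C₂) * B ^ 3, by positivity, fun p ζ hL s hs v => ?_⟩
  have hs1 : (1 : ℝ) ≤ s := by nlinarith
  have hs0 : (0 : ℝ) < s := by linarith
  set r := √(s : ℝ) with hr
  have hr0 : 0 < r := Real.sqrt_pos.2 hs0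
  have hrs : r ^ 2 = s := Real.sq_sqrt hs0.le
  have hrB : B ≤ r := Real.le_sqrt_of_sq_le hs
  set y := v / r with hy
  have hpi : √(2 * Real.pi * s) = √(2 * Real.pi) * r := Real.sqrt_mul (by positivity) _
  set c := (√(2 * Real.pi * s))⁻¹ with hc
  have hc0 : 0 ≤ c := by positivity
  have e1 : ∀ a, gaussianPDFReal 0 s (v - ζ a) = c * Real.exp (-(y - ζ a / r) ^ 2 / 2) := by
    intro a
    rw [gaussianPDFReal, hc]
    congr 2
    rw [← hrs, hy]; field_simp; ring
  have e2 : gaussianPDFReal 0 (s + 1) v =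
      c * ((√(1 + (s : ℝ)⁻¹))⁻¹ * Real.exp (-y ^ 2 / (2 * (1 + (s : ℝ)⁻¹)))) := by
    have e3 : 2 * Real.pi * ((s + 1 : ℝ≥0) : ℝ) = 2 * Real.pi * s * (1 + (s : ℝ)⁻¹) := by
      push_cast; field_simp
    rw [gaussianPDFReal, hc, ← mul_assoc, ← mul_inv, ← Real.sqrt_mul (by positivity), e3]
    congr 2
    · rw [hy]; push_cast; rw [div_pow, hrs]; field_simp; ring
  set E := Real.exp (-y ^ 2 / 2)
  set G := Real.exp (-y ^ 2 / 8) with hG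
  have hmain : ∑ a, p a * (E * (1 + (ζ a / r) * y + (ζ a / r) ^ 2 * (y ^ 2 - 1) / 2)) =
      E * (1 + (s : ℝ)⁻¹ * (y ^ 2 - 1) / 2) := by
    have : ∀ a, p a * (E * (1 + (ζ a / r) * y + (ζ a / r) ^ 2 * (y ^ 2 - 1) / 2)) =
        E * p a + (E * y / r) * (p a * ζ a) + (E * (y ^ 2 - 1) / 2 / r ^ 2) * (p a * ζ a ^ 2) := by
      intro a; field_simp
    simp only [this, Finset.sum_add_distrib, ← Finset.mul_sum, hL.sum_one, hL.mean, hL.var, hrs]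
    field_simp; ring
  have hdiff : kernelDiff p ζ s v =
      c * (∑ a, p a * (Real.exp (-(y - ζ a / r) ^ 2 / 2) -
        E * (1 + (ζ a / r) * y + (ζ a / r) ^ 2 * (y ^ 2 - 1) / 2)) -
        ((√(1 + (s : ℝ)⁻¹))⁻¹ * Real.exp (-y ^ 2 / (2 * (1 + (s : ℝ)⁻¹))) -
          E * (1 + (s : ℝ)⁻¹ * (y ^ 2 - 1) / 2))) := by
    simp only [mul_sub, Finset.sum_sub_distrib]
    simp only [mul_sub] at hmain
    rw [← hmain, kernelDiff, e2, Finset.mul_sum, Finset.mul_sum]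
    simp only [e1]
    have : ∀ a, p a * (c * Real.exp (-(y - ζ a / r) ^ 2 / 2)) =
      c * (p a * Real.exp (-(y - ζ a / r) ^ 2 / 2)) := fun a => by ring
    simp only [this]
    ring
  have hB3 : (B / r) ^ 3 = B ^ 3 / (s * r) := by rw [div_pow, ← hrs]; ring
  have b1 : |∑ a, p a * (Real.exp (-(y - ζ a / r) ^ 2 / 2) -
        E * (1 + (ζ a / r) * y + (ζ a / r) ^ 2 * (y ^ 2 - 1) / 2))| ≤ C₁ * (B / r) ^ 3 * G := by
    calc _ ≤ ∑ a, |p a * (Real.exp (-(y - ζ a / r) ^ 2 / 2) -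
        E * (1 + (ζ a / r) * y + (ζ a / r) ^ 2 * (y ^ 2 - 1) / 2))| := abs_sum_le_sum_abs _ _
      _ ≤ ∑ a, p a * (C₁ * (B / r) ^ 3 * G) := by
        refine Finset.sum_le_sum fun a _ => ?_
        rw [abs_mul, abs_of_nonneg (hL.nonneg a)]
        refine mul_le_mul_of_nonneg_left ?_ (hL.nonneg a)
        have hz : |ζ a / r| ≤ B / r := by
          rw [abs_div, abs_of_pos hr0]
          have := hL.bound a
          gcongr
        refine (h₁ (ζ a / r) y (hz.trans ((div_le_one hr0).2 hrB))).trans ?_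
        gcongr
      _ = _ := by rw [← Finset.sum_mul, hL.sum_one, one_mul]
  have b2 := h₂ ((s : ℝ)⁻¹) y (by positivity) (inv_le_one_of_one_le₀ hs1)
  have hs2 : ((s : ℝ)⁻¹) ^ 2 ≤ B ^ 3 / (s * r) := by
    rw [inv_pow, inv_eq_one_div, div_le_div_iff₀ (by positivity) (by positivity)]
    have : r ≤ s := by nlinarith
    have h3 : 1 ≤ B ^ 3 := one_le_pow₀ hB
    calc 1 * (s * r) ≤ B ^ 3 * (s * s) := by gcongr
      _ = _ := by ring
  have hcr : c ≤ r⁻¹ := by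
    rw [hc]
    apply inv_anti₀ hr0
    rw [hpi]
    have : 1 ≤ √(2 * Real.pi) := Real.one_le_sqrt.2 (by nlinarith [Real.pi_gt_three])
    nlinarith
  have hGe : Real.exp (-(8 * (s : ℝ))⁻¹ * v ^ 2) = G := by
    rw [hG, hy, div_pow, hrs]; congr 1; field_simp
  rw [hdiff, abs_mul, abs_of_nonneg hc0, hGe]
  calc _ ≤ r⁻¹ * (C₁ * (B / r) ^ 3 * G + C₂ * ((s : ℝ)⁻¹) ^ 2 * G) := by
        gcongr; exact (abs_sub _ _).trans (add_le_add b1 b2)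
    _ ≤ r⁻¹ * (C₁ * (B ^ 3 / (s * r)) * G + C₂ * (B ^ 3 / (s * r)) * G) := by
        rw [hB3]; gcongr
    _ = _ := by ring

lemma exists_integral_kernelDiff_bound {α : Type*} [Fintype α] {B : ℝ} (hB : 1 ≤ B) :
    ∃ C : ℝ, 0 < C ∧ ∀ p ζ : α → ℝ, IsStdLaw p ζ B → ∀ s : ℝ≥0, B ^ 2 ≤ s →
      ∫ v, |kernelDiff p ζ s v| ≤ C / (s * √(s : ℝ)) := by
  obtain ⟨C, hC, h⟩ := exists_kernelDiff_bound (α := α) hB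
  refine ⟨C * √(8 * Real.pi), by positivity, fun p ζ hL s hs => ?_⟩
  have hs0 : (0 : ℝ) < s := by nlinarith
  have hi : Integrable fun v : ℝ => C / (s * √(s : ℝ)) *
      ((√(s : ℝ))⁻¹ * Real.exp (-(8 * (s : ℝ))⁻¹ * v ^ 2)) :=
    ((integrable_exp_neg_mul_sq (by positivity)).const_mul _).const_mul _
  refine (integral_mono (integrable_kernelDiff p ζ s).abs hi (h p ζ hL s hs)).trans_eq ?_
  rw [integral_const_mul, integral_const_mul, integral_gaussian]
  have : Real.pi / (8 * (s : ℝ))⁻¹ = 8 * Real.pi * s := by field_simp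
  rw [this, Real.sqrt_mul (by positivity)]
  field_simp

end

section

open scoped NNReal
open ProbabilityTheory

lemma integrable_bounded_mul {f g : ℝ → ℝ} {c : ℝ} (hf : Measurable f) (hb : ∀ x, |f x| ≤ c)
    (hg : Integrable g) : Integrable fun v => f v * g v :=
  hg.bdd_mul hf.aestronglyMeasurable (ae_of_all _ fun x => by simpa using hb x)

lemma sub_le_of_smoothed {F G : ℝ → ℝ} (hF : Monotone F) {L : ℝ} (hL : 0 ≤ L)
    (hG : ∀ x y, |G x - G y| ≤ L * |x - y|) (hGm : Measurable G) {s : ℝ≥0} (hs : s ≠ 0) {κ δ : ℝ}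
    (hδ : ∀ x, |F x - G x| ≤ δ)
    (hκ : ∀ x, |∫ v, (F (x - v) - G (x - v)) * gaussianPDFReal 0 s v| ≤ κ) (x₀ : ℝ) :
    F x₀ - G x₀ ≤ δ / 3 + 4 / 3 * κ + 4 * L * √(s : ℝ) := by
  have hs0 : (0 : ℝ) < s := by positivity
  set r := √(s : ℝ) with hr
  have hr0 : 0 < r := Real.sqrt_pos.2 hs0
  have hrs : r ^ 2 = s := Real.sq_sqrt hs0.le
  set d := F x₀ - G x₀ with hd
  have hdδ : 0 ≤ d + δ := by linarith [neg_le_of_abs_le (hδ x₀)]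
  have hpt : ∀ v, (d - 5 / 2 * L * r) - ((d + δ) / (4 * r ^ 2) + L / (2 * r)) * v ^ 2 ≤
      F (x₀ + 2 * r - v) - G (x₀ + 2 * r - v) := by
    intro v
    have hv : |v| ≤ r / 2 + v ^ 2 / (2 * r) := by
      have : r / 2 + v ^ 2 / (2 * r) - |v| = (r - |v|) ^ 2 / (2 * r) := by
        rw [← sq_abs v]; field_simp; ring
      have : 0 ≤ (r - |v|) ^ 2 / (2 * r) := by positivity
      linarith
    have hLv : L * |v| ≤ L * (r / 2 + v ^ 2 / (2 * r)) := by gcongr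
    have eL : L / (2 * r) * v ^ 2 = L * (v ^ 2 / (2 * r)) := by ring
    have ed : (d + δ) / (4 * r ^ 2) * v ^ 2 = (d + δ) * (v ^ 2 / (4 * r ^ 2)) := by ring
    rw [add_mul, eL, ed]
    have hq : 0 ≤ v ^ 2 / (4 * r ^ 2) := by positivity
    have hq2 : 0 ≤ v ^ 2 / (2 * r) := by positivity
    rcases le_or_gt v (2 * r) with h | h
    · have h1 : F x₀ ≤ F (x₀ + 2 * r - v) := hF (by linarith)
      have h2 := (abs_le.1 (hG (x₀ + 2 * r - v) x₀)).2
      have h3 : |x₀ + 2 * r - v - x₀| ≤ 2 * r + |v| := by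
        rw [show x₀ + 2 * r - v - x₀ = 2 * r - v by ring]
        refine (abs_sub _ _).trans_eq ?_
        rw [abs_of_pos (by positivity : 0 < 2 * r)]
      have h4 : L * |x₀ + 2 * r - v - x₀| ≤ L * (2 * r + |v|) := by gcongr
      nlinarith [mul_nonneg hdδ hq]
    · have h1 := neg_le_of_abs_le (hδ (x₀ + 2 * r - v))
      have h2 : 1 ≤ v ^ 2 / (4 * r ^ 2) := by
        rw [le_div_iff₀ (by positivity)]; nlinarith
      nlinarith [mul_nonneg hL hr0.le, mul_nonneg hL hq2]
  have hpdf := integrable_gaussianPDFReal 0 s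
  have hsq := integrable_sq_mul_gaussianPDFReal s
  have hi : Integrable fun v =>
      (F (x₀ + 2 * r - v) - G (x₀ + 2 * r - v)) * gaussianPDFReal 0 s v := by
    refine integrable_bounded_mul (c := δ) ?_ (fun v => hδ _) hpdf
    exact (hF.measurable.comp (measurable_const.sub measurable_id)).sub
      (hGm.comp (measurable_const.sub measurable_id))
  have hint : ∫ v, ((d - 5 / 2 * L * r) * gaussianPDFReal 0 s v -
      ((d + δ) / (4 * r ^ 2) + L / (2 * r)) * (v ^ 2 * gaussianPDFReal 0 s v)) ≤
      ∫ v, (F (x₀ + 2 * r - v) - G (x₀ + 2 * r - v)) * gaussianPDFReal 0 s v := by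
    refine integral_mono ((hpdf.const_mul _).sub (hsq.const_mul _)) hi fun v => ?_
    have := mul_le_mul_of_nonneg_right (hpt v) (gaussianPDFReal_nonneg 0 s v)
    dsimp only
    linarith
  rw [integral_sub (hpdf.const_mul _) (hsq.const_mul _), integral_const_mul, integral_const_mul,
    integral_gaussianPDFReal_eq_one _ hs, integral_sq_mul_gaussianPDFReal hs, ← hrs] at hint
  have h1 := (abs_le.1 (hκ (x₀ + 2 * r))).2
  have h2 : ((d + δ) / (4 * r ^ 2) + L / (2 * r)) * r ^ 2 = (d + δ) / 4 + L * r / 2 := by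
    field_simp
  rw [h2] at hint
  linarith

lemma abs_sub_le_of_smoothed {F G : ℝ → ℝ} (hF : Monotone F) {L : ℝ} (hL : 0 ≤ L)
    (hG : ∀ x y, |G x - G y| ≤ L * |x - y|) (hGm : Measurable G) {s : ℝ≥0} (hs : s ≠ 0) {κ δ : ℝ}
    (hδ : ∀ x, |F x - G x| ≤ δ)
    (hκ : ∀ x, |∫ v, (F (x - v) - G (x - v)) * gaussianPDFReal 0 s v| ≤ κ) (x₀ : ℝ) :
    |F x₀ - G x₀| ≤ δ / 3 + 4 / 3 * κ + 4 * L * √(s : ℝ) := by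
  refine abs_le.2 ⟨?_, sub_le_of_smoothed hF hL hG hGm hs hδ hκ x₀⟩
  have := sub_le_of_smoothed (F := fun x => -F (-x)) (G := fun x => -G (-x)) (L := L) (s := s)
    (κ := κ) (δ := δ) (fun a b h => neg_le_neg (hF (neg_le_neg h))) hL ?_
    (hGm.comp measurable_neg).neg hs ?_ ?_ (-x₀)
  · simp only [neg_neg] at this; linarith
  · intro x y
    have := hG (-x) (-y)
    rw [show -x - -y = -(x - y) by ring, abs_neg] at this
    rw [show -G (-x) - -G (-y) = -(G (-x) - G (-y)) by ring, abs_neg]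
    exact this
  · intro x
    rw [show -F (-x) - -G (-x) = -(F (-x) - G (-x)) by ring, abs_neg]
    exact hδ _
  · intro x
    rw [← integral_neg_eq_self, ← abs_neg, ← integral_neg]
    convert hκ (-x) using 4 with v
    have : gaussianPDFReal 0 s (-v) = gaussianPDFReal 0 s v := by simp [gaussianPDFReal]
    rw [this]
    simp only [sub_neg_eq_add]
    rw [show -(x + v) = -x - v by ring]
    ring

section

variable {α : Type*} [Fintype α] {p ζ : α → ℝ}

/-- Distribution function of the sum of `n` independent samples. -/
def iidCdf (p ζ : α → ℝ) (n : ℕ) (x : ℝ) : ℝ := iidExp p ζ n fun s => if s ≤ x then 1 else 0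

lemma iidCdf_mono (hp : ∀ a, 0 ≤ p a) (n : ℕ) : Monotone (iidCdf p ζ n) := fun x y h =>
  iidExp_mono hp fun s => by
    split_ifs with h1 h2
    · exact le_rfl
    · exact absurd (h1.trans h) h2
    · exact zero_le_one
    · exact le_rfl

lemma iidCdf_nonneg (hp : ∀ a, 0 ≤ p a) (n : ℕ) (x : ℝ) : 0 ≤ iidCdf p ζ n x :=
  iidExp_nonneg hp fun s => by split_ifs <;> norm_num

lemma iidCdf_le_one (hp : ∀ a, 0 ≤ p a) (hp1 : ∑ a, p a = 1) (n : ℕ) (x : ℝ) :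
    iidCdf p ζ n x ≤ 1 := by
  rw [← iidExp_const (ζ := ζ) (n := n) hp1 1]
  exact iidExp_mono hp fun s => by split_ifs <;> norm_num

lemma iidExp_integral_Iic {w : ℝ → ℝ} (hw : Integrable w) (n : ℕ) (x : ℝ) :
    iidExp p ζ n (fun y => ∫ v in Set.Iic (x - y), w v) = ∫ v, iidCdf p ζ n (x - v) * w v := by
  have h : ∀ y, ∫ v in Set.Iic (x - y), w v = ∫ v, (if y ≤ x - v then 1 else 0) * w v := by
    intro y
    rw [← integral_indicator measurableSet_Iic]
    congr 1; ext v
    by_cases hv : v ≤ x - y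
    · simp [Set.indicator, hv, le_sub_comm.1 hv]
    · have : ¬ y ≤ x - v := fun h => hv (le_sub_comm.1 h)
      simp [Set.indicator, hv, this]
  simp only [h]
  rw [iidExp_integral]
  · refine integral_congr_ae (ae_of_all _ fun v => ?_)
    simp only [iidCdf]
    rw [mul_comm, ← iidExp_const_mul]
    exact iidExp_congr fun s => mul_comm _ _
  · intro y
    refine integrable_bounded_mul (c := 1) ?_ ?_ hw
    · refine Measurable.ite ?_ measurable_const measurable_const
      exact measurableSet_le measurable_const (measurable_const.sub measurable_id)
    · intro v; split_ifs <;> norm_num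

lemma integral_Iic_kernelDiff {s : ℝ≥0} (hs : s ≠ 0) (x : ℝ) :
    ∫ v in Set.Iic x, kernelDiff p ζ s v = ∑ a, p a * gcdf s (x - ζ a) - gcdf (s + 1) x := by
  have hi := integrable_gaussianPDFReal 0 s
  have h1 : ∀ a, Integrable fun v => p a * gaussianPDFReal 0 s (v - ζ a) := fun a =>
    (hi.comp_sub_right (ζ a)).const_mul _
  simp only [kernelDiff]
  rw [integral_sub (integrable_finsetSum _ fun a _ => (h1 a).integrableOn)
    (integrable_gaussianPDFReal _ _).integrableOn,
    integral_finsetSum _ fun a _ => (h1 a).integrableOn, gcdf_eq_integral (by positivity)]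
  congr 1
  refine Finset.sum_congr rfl fun a _ => ?_
  rw [integral_const_mul, gcdf_eq_integral hs]
  congr 1
  rw [← integral_indicator measurableSet_Iic, ← integral_indicator measurableSet_Iic,
    ← integral_sub_right_eq_self (fun v => (Set.Iic (x - ζ a)).indicator _ v) (ζ a)]
  congr 1; ext v
  simp [Set.indicator]

/-- One step of the Lindeberg replacement. -/
lemma abs_replacement_le {B C : ℝ} (hB : 1 ≤ B) (hL : IsStdLaw p ζ B) (hC : ∀ s : ℝ≥0, B ^ 2 ≤ s →
      ∫ v, |kernelDiff p ζ s v| ≤ C / (s * √(s : ℝ))) {s : ℝ≥0} (hs : B ^ 2 ≤ s) (k : ℕ) {δ : ℝ}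
    (hδ : ∀ x, |iidCdf p ζ k x - gcdf k x| ≤ δ) (x : ℝ) :
    |iidExp p ζ (k + 1) (fun y => gcdf s (x - y)) - iidExp p ζ k (fun y => gcdf (s + 1) (x - y))| ≤
      C / ((k + s) * √(k + s : ℝ)) + δ * (C / (s * √(s : ℝ))) := by
  have hs0 : s ≠ 0 := by rintro rfl; simp only [NNReal.coe_zero] at hs; nlinarith
  have hkd := integrable_kernelDiff p ζ s
  have hδ0 : 0 ≤ δ := (abs_nonneg _).trans (hδ 0)
  have e1 : iidExp p ζ (k + 1) (fun y => gcdf s (x - y)) -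
      iidExp p ζ k (fun y => gcdf (s + 1) (x - y)) =
      iidExp p ζ k (fun y => ∫ v in Set.Iic (x - y), kernelDiff p ζ s v) := by
    rw [iidExp_succ, ← iidExp_sub]
    refine iidExp_congr fun y => ?_
    rw [integral_Iic_kernelDiff hs0]
    simp only [sub_sub]
  have hmF : Measurable fun v => iidCdf p ζ k (x - v) :=
    (iidCdf_mono hL.nonneg k).measurable.comp (measurable_const.sub measurable_id)
  have hmG : Measurable fun v => gcdf k (x - v) :=
    (gcdf_mono k).measurable.comp (measurable_const.sub measurable_id)
  have hiG : ∀ {w : ℝ → ℝ}, Integrable w → Integrable fun v => gcdf k (x - v) * w v := fun hw =>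
    integrable_bounded_mul (c := 1) hmG
      (fun v => by rw [abs_of_nonneg (gcdf_nonneg _ _)]; exact gcdf_le_one _ _) hw
  have e2 : ∫ v, gcdf k (x - v) * kernelDiff p ζ s v =
      ∫ v in Set.Iic x, kernelDiff p ζ (k + s) v := by
    rw [integral_Iic_kernelDiff (by positivity)]
    have hsh : ∀ a, Integrable fun v => gaussianPDFReal 0 s (v - ζ a) := fun a =>
      (integrable_gaussianPDFReal 0 s).comp_sub_right (ζ a)
    have : ∀ v, gcdf k (x - v) * kernelDiff p ζ s v =
        ∑ a, p a * (gcdf k (x - v) * gaussianPDFReal 0 s (v - ζ a)) -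
          gcdf k (x - v) * gaussianPDFReal 0 (s + 1) v := by
      intro v
      rw [kernelDiff, mul_sub, Finset.mul_sum]
      congr 1
      exact Finset.sum_congr rfl fun a _ => by ring
    simp only [this]
    rw [integral_sub (integrable_finsetSum _ fun a _ => (hiG (hsh a)).const_mul _)
      (hiG (integrable_gaussianPDFReal _ _)),
      integral_finsetSum _ fun a _ => (hiG (hsh a)).const_mul _, gcdf_conv _ (by positivity),
      add_assoc]
    congr 1
    refine Finset.sum_congr rfl fun a _ => ?_
    rw [integral_const_mul, ← gcdf_conv _ hs0]
    congr 1
    rw [← integral_add_right_eq_self _ (ζ a)]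
    congr 1; ext v
    rw [add_sub_cancel_right, sub_sub, add_comm v]
  rw [e1, iidExp_integral_Iic hkd]
  have e3 : ∫ v, iidCdf p ζ k (x - v) * kernelDiff p ζ s v =
      (∫ v in Set.Iic x, kernelDiff p ζ (k + s) v) +
      ∫ v, (iidCdf p ζ k (x - v) - gcdf k (x - v)) * kernelDiff p ζ s v := by
    have hFG : Integrable fun v =>
        (iidCdf p ζ k (x - v) - gcdf k (x - v)) * kernelDiff p ζ s v :=
      integrable_bounded_mul (c := δ) (hmF.sub hmG) (fun v => hδ _) hkd
    rw [← e2, ← integral_add (hiG hkd) hFG]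
    congr 1; ext v; ring
  rw [e3]
  refine (abs_add_le _ _).trans (add_le_add ?_ ?_)
  · have h := hC (k + s) (hs.trans (by push_cast; linarith [(Nat.cast_nonneg k : (0 : ℝ) ≤ k)]))
    push_cast at h
    refine le_trans ?_ h
    refine (abs_integral_le_integral_abs).trans ?_
    exact setIntegral_le_integral (integrable_kernelDiff p ζ (k + s)).abs
      (ae_of_all _ fun _ => abs_nonneg _)
  · refine (abs_integral_le_integral_abs).trans ?_
    calc _ ≤ ∫ v, δ * |kernelDiff p ζ s v| := by
          refine integral_mono_of_nonneg (ae_of_all _ fun _ => abs_nonneg _) (hkd.abs.const_mul _)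
            (ae_of_all _ fun v => ?_)
          dsimp only
          rw [abs_mul]
          exact mul_le_mul_of_nonneg_right (hδ _) (abs_nonneg _)
      _ ≤ _ := by
        rw [integral_const_mul]
        exact mul_le_mul_of_nonneg_left (hC s hs) hδ0

end

end

section

open scoped NNReal
open ProbabilityTheory

lemma inv_mul_sqrt_le_telescope {z : ℝ} (hz : 1 ≤ z) :
    1 / (z * √z) ≤ 6 * (1 / √z - 1 / √(z + 1)) := by
  set r := √z with hr
  set q := √(z + 1) with hq
  have hr1 : 1 ≤ r := Real.one_le_sqrt.2 hz
  have hrz : r ^ 2 = z := Real.sq_sqrt (by linarith)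
  have hqz : q ^ 2 = z + 1 := Real.sq_sqrt (by linarith)
  have hq0 : 0 < q := Real.sqrt_pos.2 (by linarith)
  have hqr : q ≤ 3 / 2 * r := by
    apply Real.sqrt_le_iff.2; constructor <;> nlinarith
  have hr0 : 0 < r := by linarith
  have e : 1 / r - 1 / q = 1 / (r * q * (r + q)) := by
    field_simp; nlinarith
  rw [e, ← hrz, mul_one_div, div_le_div_iff₀ (by positivity) (by positivity)]
  have h1 : q * (r + q) ≤ (3 / 2 * r) * (r + 3 / 2 * r) := by gcongr
  nlinarith [mul_le_mul_of_nonneg_left h1 hr0.le, pow_pos hr0 3]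

lemma sum_inv_mul_sqrt_le {η : ℝ} (hη : 1 ≤ η) (n : ℕ) :
    ∑ i ∈ Finset.range n, 1 / ((η + i) * √(η + i)) ≤ 6 / √η := by
  have h : ∑ i ∈ Finset.range n, 1 / ((η + i) * √(η + i)) ≤ 6 * (1 / √η - 1 / √(η + n)) := by
    induction n with
    | zero => simp
    | succ n ih =>
      rw [Finset.sum_range_succ]
      have := inv_mul_sqrt_le_telescope (z := η + n)
        (by linarith [(Nat.cast_nonneg n : (0 : ℝ) ≤ n)])
      push_cast
      rw [← add_assoc]
      linarith
  have : 0 ≤ 1 / √(η + n) := by positivity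
  calc _ ≤ _ := h
    _ ≤ 6 * (1 / √η) := by linarith
    _ = _ := by ring

lemma min_one_mul_le {D η : ℝ} (hD : 0 ≤ D) (hη : 1 ≤ η) {j n : ℕ} (hj : j < n) :
    min 1 (D / √(j + 1)) * (1 / ((η + (n - 1 - j : ℕ)) * √(η + (n - 1 - j : ℕ)))) ≤
      3 * (1 / (n * √(n : ℝ))) +
      3 / 2 * (D / √n) * (1 / ((η + (n - 1 - j : ℕ)) * √(η + (n - 1 - j : ℕ)))) := by
  have hn0 : (0 : ℝ) < n := by exact_mod_cast (by omega : 0 < n)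
  have hcast : ((n - 1 - j : ℕ) : ℝ) = n - 1 - j := by
    rw [Nat.cast_sub (by omega), Nat.cast_sub (by omega)]; simp
  set z : ℝ := η + (n - 1 - j : ℕ) with hz
  have hz1 : 1 ≤ z := by
    have := (Nat.cast_nonneg (n - 1 - j) : (0 : ℝ) ≤ ((n - 1 - j : ℕ) : ℝ)); linarith
  have hj0 : (0 : ℝ) ≤ j := Nat.cast_nonneg j
  rcases le_or_gt (2 * ((j : ℝ) + 1)) n with h | h
  · have hz2 : (n : ℝ) / 2 ≤ z := by rw [hz, hcast]; linarith
    have h1 : 1 / (z * √z) ≤ 3 * (1 / (n * √(n : ℝ))) := by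
      have h2 : √(n : ℝ) ≤ 3 / 2 * √z := by
        apply Real.sqrt_le_iff.2
        refine ⟨by positivity, ?_⟩
        rw [mul_pow, Real.sq_sqrt (by linarith)]; linarith
      rw [mul_one_div, div_le_div_iff₀ (by positivity) (by positivity)]
      calc 1 * (n * √(n : ℝ)) ≤ 1 * ((2 * z) * (3 / 2 * √z)) := by gcongr; linarith
        _ = _ := by ring
    have h3 : min 1 (D / √(j + 1)) * (1 / (z * √z)) ≤ 1 * (1 / (z * √z)) := by
      gcongr; exact min_le_left _ _
    have : 0 ≤ 3 / 2 * (D / √n) * (1 / (z * √z)) := by positivity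
    linarith
  · have h2 : D / √((j : ℝ) + 1) ≤ 3 / 2 * (D / √n) := by
      have h3 : √(n : ℝ) ≤ 3 / 2 * √((j : ℝ) + 1) := by
        apply Real.sqrt_le_iff.2
        refine ⟨by positivity, ?_⟩
        rw [mul_pow, Real.sq_sqrt (by positivity)]; linarith
      rw [← mul_div_assoc, div_le_div_iff₀ (by positivity) (by positivity)]
      calc D * √(n : ℝ) ≤ D * (3 / 2 * √((j : ℝ) + 1)) := by gcongr
        _ = _ := by ring
    have h3 : min 1 (D / √(j + 1)) * (1 / (z * √z)) ≤ 3 / 2 * (D / √n) * (1 / (z * √z)) := by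
      gcongr; exact (min_le_right _ _).trans h2
    have : 0 ≤ 3 * (1 / (n * √(n : ℝ))) := by positivity
    linarith

/-- Berry–Esseen bound, uniform over standardized laws with a common bound on the values. -/
theorem exists_berryEsseen {α : Type*} [Fintype α] {B : ℝ} (hB : 1 ≤ B) :
    ∃ D : ℝ, 0 < D ∧ ∀ p ζ : α → ℝ, IsStdLaw p ζ B → ∀ (n : ℕ) (x : ℝ),
      |iidCdf p ζ n x - gcdf n x| ≤ D / √(n + 1) := by
  obtain ⟨C, hC0, hC⟩ := exists_integral_kernelDiff_bound (α := α) hB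
  set R : ℝ := 81 * C + B with hR
  have hR1 : 1 ≤ R := by linarith
  set η : ℝ≥0 := ⟨R ^ 2, sq_nonneg R⟩ with hη
  have hηR : (η : ℝ) = R ^ 2 := rfl
  have hη1 : (1 : ℝ) ≤ η := by rw [hηR]; nlinarith
  have hη0 : η ≠ 0 := by intro h; rw [h] at hη1; norm_num at hη1
  have hηB : B ^ 2 ≤ η := by rw [hηR]; gcongr; linarith
  have hsη : √(η : ℝ) = R := by rw [hηR, Real.sqrt_sq (by linarith)]
  set D : ℝ := 24 * C + 18 * R + 1 with hD
  have hD0 : 0 < D := by positivity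
  refine ⟨D, hD0, fun p ζ hL n => ?_⟩
  have htriv : ∀ k x, |iidCdf p ζ k x - gcdf k x| ≤ 1 := by
    intro k x
    rw [abs_le]
    constructor <;> linarith [iidCdf_nonneg (ζ := ζ) hL.nonneg k x,
      iidCdf_le_one (ζ := ζ) hL.nonneg hL.sum_one k x, gcdf_nonneg k x, gcdf_le_one k x]
  induction n using Nat.strong_induction_on with
  | _ n ih =>
  intro x
  rcases Nat.eq_zero_or_pos n with rfl | hn
  · refine (htriv 0 x).trans ?_
    simp only [Nat.cast_zero, zero_add, Real.sqrt_one, div_one]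
    linarith
  have hn0 : (0 : ℝ) < n := by exact_mod_cast hn
  have hn1 : (1 : ℝ) ≤ n := by exact_mod_cast hn
  set rn := √(n : ℝ) with hrn
  have hrn0 : 0 < rn := Real.sqrt_pos.2 hn0
  have hrnn : rn ^ 2 = n := Real.sq_sqrt hn0.le
  have hmin : ∀ j < n, ∀ x, |iidCdf p ζ j x - gcdf j x| ≤ min 1 (D / √(j + 1)) :=
    fun j hj x => le_min (htriv j x) (ih j hj x)
  set bd : ℕ → ℝ := fun j => C * (1 / (n * rn)) + C * (min 1 (D / √(j + 1)) *
    (1 / ((η + (n - 1 - j : ℕ)) * √(η + (n - 1 - j : ℕ))))) with hbd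
  have hswap : ∀ x : ℝ, ∀ k m : ℕ, k + m = n →
      |iidExp p ζ k (fun y => gcdf (η + m) (x - y)) - gcdf (n + η) x| ≤
        ∑ j ∈ Finset.range k, bd j := by
    intro x k
    induction k with
    | zero =>
      intro m hm
      have : m = n := by omega
      subst this
      simp [iidExp_zero, add_comm]
    | succ k ihk =>
      intro m hm
      have hm' : m = n - 1 - k := by omega
      have h1 := ihk (m + 1) (by omega)
      have h2 := abs_replacement_le hB hL (hC p ζ hL) (s := η + m)
        (hηB.trans (by push_cast; linarith [(Nat.cast_nonneg m : (0 : ℝ) ≤ m)])) k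
        (hmin k (by omega)) x
      rw [Finset.sum_range_succ]
      push_cast at h1 h2
      rw [← add_assoc] at h1
      have h3 : C / ((k + (η + m)) * √(k + (η + m) : ℝ)) ≤ C * (1 / (n * rn)) := by
        have : (n : ℝ) ≤ k + (η + m) := by
          have : (n : ℝ) = k + 1 + m := by rw [← hm]; push_cast; ring
          linarith
        rw [mul_one_div]
        have hsq : rn ≤ √(k + (η + m) : ℝ) := Real.sqrt_le_sqrt this
        gcongr
      have h4 : min 1 (D / √(k + 1)) * (C / ((η + m) * √(η + m : ℝ))) =
          C * (min 1 (D / √(k + 1)) *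
    (1 / ((η + (n - 1 - k : ℕ)) * √(η + (n - 1 - k : ℕ))))) := by rw [← hm']; ring
      rw [h4] at h2
      have h5 : |iidExp p ζ (k + 1) (fun y => gcdf (η + m) (x - y)) -
          iidExp p ζ k (fun y => gcdf (η + m + 1) (x - y))| ≤ bd k := by
        rw [hbd]; linarith
      calc _ ≤ _ := abs_sub_le _ (iidExp p ζ k (fun y => gcdf (η + m + 1) (x - y))) _
        _ ≤ _ := by linarith
  set κ := (10 * C + 9 * C * (D / R)) / rn with hκ
  have hsum : ∑ j ∈ Finset.range n, bd j ≤ κ := by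
    have hle : ∀ j ∈ Finset.range n, bd j ≤ 4 * C * (1 / (n * rn)) + 3 / 2 * C * (D / rn) *
        (1 / ((η + (n - 1 - j : ℕ)) * √(η + (n - 1 - j : ℕ)))) := by
      intro j hj
      have := mul_le_mul_of_nonneg_left
        (min_one_mul_le hD0.le hη1 (Finset.mem_range.1 hj)) hC0.le
      simp only [hbd]
      linarith
    refine (Finset.sum_le_sum hle).trans ?_
    rw [Finset.sum_add_distrib, ← Finset.mul_sum (f := fun j => 1 / (((η : ℝ) +
      (n - 1 - j : ℕ)) * √((η : ℝ) + (n - 1 - j : ℕ)))),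
      Finset.sum_range_reflect (fun i => 1 / (((η : ℝ) + (i : ℕ)) * √((η : ℝ) + (i : ℕ)))) n,
      Finset.sum_const, Finset.card_range, nsmul_eq_mul]
    have h1 := sum_inv_mul_sqrt_le hη1 n
    rw [hsη] at h1
    have h2 : 3 / 2 * C * (D / rn) * ∑ i ∈ Finset.range n, 1 / (((η : ℝ) + i) * √((η : ℝ) + i)) ≤
      3 / 2 * C * (D / rn) * (6 / R) := by gcongr
    have h3 : (n : ℝ) * (4 * C * (1 / (n * rn))) = 4 * C / rn := by field_simp
    have h4 : 3 / 2 * C * (D / rn) * (6 / R) = 9 * C * (D / R) / rn := by ring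
    have h5 : 4 * C / rn ≤ 10 * C / rn := by gcongr; norm_num
    have h6 : κ = 10 * C / rn + 9 * C * (D / R) / rn := add_div _ _ _
    rw [h6]
    linarith
  have hsm : ∀ x, |∫ v, (iidCdf p ζ n (x - v) - gcdf n (x - v)) * gaussianPDFReal 0 η v| ≤ κ := by
    intro x
    have h := (hswap x n 0 (by omega)).trans hsum
    have hpdf := integrable_gaussianPDFReal 0 η
    simp only [Nat.cast_zero, add_zero] at h
    rw [← gcdf_conv _ hη0, funext fun y => gcdf_eq_integral hη0 (x - y),
      iidExp_integral_Iic hpdf, ← integral_sub] at h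
    · simp only [sub_mul]; exact h
    · refine integrable_bounded_mul (c := 1)
        ((iidCdf_mono hL.nonneg n).measurable.comp (measurable_const.sub measurable_id))
        (fun v => ?_) hpdf
      rw [abs_of_nonneg (iidCdf_nonneg hL.nonneg _ _)]
      exact iidCdf_le_one hL.nonneg hL.sum_one _ _
    · refine integrable_bounded_mul (c := 1)
        ((gcdf_mono n).measurable.comp (measurable_const.sub measurable_id)) (fun v => ?_) hpdf
      rw [abs_of_nonneg (gcdf_nonneg _ _)]
      exact gcdf_le_one _ _
  have hbdd : BddAbove (Set.range fun x => |iidCdf p ζ n x - gcdf n x|) :=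
    ⟨1, by rintro _ ⟨x, rfl⟩; exact htriv n x⟩
  set δ := ⨆ x, |iidCdf p ζ n x - gcdf n x| with hδ
  have hδle : ∀ x, |iidCdf p ζ n x - gcdf n x| ≤ δ := fun x => le_ciSup hbdd x
  have hnn : (n : ℝ≥0) ≠ 0 := by exact_mod_cast hn.ne'
  have hmain := abs_sub_le_of_smoothed (iidCdf_mono (ζ := ζ) hL.nonneg n)
    (L := 1 / rn) (by positivity) (fun x y => by simpa using gcdf_lipschitz hnn x y)
    (gcdf_mono n).measurable hη0 hδle hsm
  have hδ2 : δ ≤ δ / 3 + 4 / 3 * κ + 4 * (1 / rn) * √(η : ℝ) := ciSup_le hmain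
  rw [hsη] at hδ2
  have hfin : δ ≤ (20 * C + 6 * R + 18 * C * (D / R)) / rn := by
    have : (20 * C + 6 * R + 18 * C * (D / R)) / rn = 2 * κ + 6 * (1 / rn) * R := by
      rw [hκ]; field_simp; ring
    rw [this]; linarith
  refine (hδle x).trans (hfin.trans ?_)
  have hCD : C * (D / R) ≤ D / 81 := by
    rw [mul_div_assoc', div_le_div_iff₀ (by linarith) (by norm_num)]
    have : 81 * C ≤ R := by linarith
    nlinarith
  have h32 : √((n : ℝ) + 1) ≤ 3 / 2 * rn := by
    apply Real.sqrt_le_iff.2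
    refine ⟨by positivity, ?_⟩
    rw [mul_pow, hrnn]; linarith
  rw [div_le_div_iff₀ hrn0 (by positivity)]
  calc (20 * C + 6 * R + 18 * C * (D / R)) * √((n : ℝ) + 1)
      ≤ (20 * C + 6 * R + 18 * C * (D / R)) * (3 / 2 * rn) := by gcongr
    _ = ((20 * C + 6 * R + 18 * (C * (D / R))) * (3 / 2)) * rn := by ring
    _ ≤ D * rn := by
        gcongr
        nlinarith

end

section

open scoped NNReal
open ProbabilityTheory

/-- The standard Gaussian density. -/
def gphi (x : ℝ) : ℝ := (√(2 * Real.pi))⁻¹ * Real.exp (-x ^ 2 / 2)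

lemma gphi_eq_pdf : gphi = gaussianPDFReal 0 1 := by
  ext x; simp [gphi, gaussianPDFReal]

lemma gphi_pos (x : ℝ) : 0 < gphi x := by unfold gphi; positivity

lemma gphi_neg (x : ℝ) : gphi (-x) = gphi x := by simp [gphi]

lemma integrable_gphi : Integrable gphi := gphi_eq_pdf ▸ integrable_gaussianPDFReal 0 1

lemma continuous_gphi : Continuous gphi := by unfold gphi; fun_prop

lemma log_gphi (x : ℝ) : Real.log (gphi x) = -(1 / 2 * Real.log (2 * Real.pi)) - x ^ 2 / 2 := by
  have : 0 < 2 * Real.pi := by positivity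
  rw [gphi, Real.log_mul (by positivity) (by positivity), Real.log_inv, Real.log_exp,
    Real.log_sqrt this.le]
  ring

lemma gaussQ_eq_integral (x : ℝ) : gaussQ x = ∫ t in Set.Ioi x, gphi t := rfl

lemma gaussQ_eq_one_sub (x : ℝ) : gaussQ x = 1 - gcdf 1 x := by
  rw [gcdf, ← probReal_compl_eq_one_sub measurableSet_Iic, Set.compl_Iic, measureReal_def,
    gaussianReal_apply_eq_integral _ one_ne_zero, ENNReal.toReal_ofReal, gaussQ_eq_integral,
    gphi_eq_pdf]
  exact integral_nonneg fun _ => gaussianPDFReal_nonneg _ _ _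

lemma gaussQ_neg (x : ℝ) : gaussQ (-x) = 1 - gaussQ x := by
  rw [gaussQ_eq_one_sub, gaussQ_eq_one_sub, gcdf_neg one_ne_zero]

lemma hasDerivAt_gaussQ (x : ℝ) : HasDerivAt gaussQ (-gphi x) x := by
  have h : gaussQ = fun x => gaussQ 0 - ∫ t in (0 : ℝ)..x, gphi t := by
    ext y
    rw [gaussQ_eq_integral, gaussQ_eq_integral, ← intervalIntegral.integral_Ioi_sub_Ioi'
      integrable_gphi.integrableOn integrable_gphi.integrableOn]
    ring
  rw [h]
  simpa using (intervalIntegral.integral_hasDerivAt_right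
    (integrable_gphi.intervalIntegrable) (continuous_gphi.stronglyMeasurableAtFilter _ _)
    continuous_gphi.continuousAt).const_sub (gaussQ 0)

lemma gaussQ_pos (x : ℝ) : 0 < gaussQ x := by
  rw [gaussQ_eq_integral, setIntegral_pos_iff_support_of_nonneg_ae
    (ae_of_all _ fun t => (gphi_pos t).le) integrable_gphi.integrableOn]
  have : Function.support gphi = Set.univ := by
    ext t; simp [(gphi_pos t).ne']
  simp [this]

lemma hasDerivAt_gphi (x : ℝ) : HasDerivAt gphi (-x * gphi x) x := by
  have h : HasDerivAt (fun x : ℝ => -x ^ 2 / 2) (-x) x := by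
    have := ((hasDerivAt_pow 2 x).neg).div_const 2
    simpa using this.congr_deriv (by ring)
  exact (h.exp.const_mul (√(2 * Real.pi))⁻¹).congr_deriv (by unfold gphi; ring)

lemma tendsto_mul_gphi : Tendsto (fun x => x * gphi x) atTop (nhds 0) := by
  have h := (Real.tendsto_pow_mul_exp_neg_atTop_nhds_zero 1)
  refine squeeze_zero' (eventually_ge_atTop 0 |>.mono fun x hx => by
    have := gphi_pos x; positivity) (eventually_ge_atTop 2 |>.mono fun x hx => ?_) h
  rw [pow_one]
  gcongr
  unfold gphi
  have h1 : 1 ≤ √(2 * Real.pi) := Real.one_le_sqrt.2 (by linarith [Real.pi_gt_three])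
  calc _ ≤ 1 * Real.exp (-x ^ 2 / 2) := by gcongr; exact inv_le_one_of_one_le₀ h1
    _ ≤ _ := by rw [one_mul]; apply Real.exp_le_exp.2; nlinarith

lemma tendsto_gphi : Tendsto gphi atTop (nhds 0) := by
  refine squeeze_zero' (Eventually.of_forall fun x => (gphi_pos x).le)
    (eventually_ge_atTop 1 |>.mono fun x hx => ?_) tendsto_mul_gphi
  nlinarith [gphi_pos x]

lemma integrableOn_mul_gphi (x : ℝ) : IntegrableOn (fun t => t * gphi t) (Set.Ioi x) := by
  have h := (integrable_sq_mul_gaussianPDFReal 1).add integrable_gphi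
  rw [← gphi_eq_pdf] at h
  refine (h.mono' (continuous_id.mul continuous_gphi).aestronglyMeasurable
    (ae_of_all _ fun t => ?_)).integrableOn
  simp only [Pi.add_apply, Pi.mul_apply, id_eq]
  rw [Real.norm_eq_abs, abs_mul, abs_of_pos (gphi_pos t)]
  have := gphi_pos t
  nlinarith [sq_nonneg (|t| - 1), sq_abs t]

lemma mul_gaussQ_le (x : ℝ) : x * gaussQ x ≤ gphi x := by
  have h := integral_Ioi_of_hasDerivAt_of_tendsto' (a := x) (f := fun t => -gphi t)
    (f' := fun t => t * gphi t) (fun t _ => (hasDerivAt_gphi t).neg.congr_deriv (by ring))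
    (integrableOn_mul_gphi x) (by simpa using tendsto_gphi.neg)
  rw [zero_sub, neg_neg] at h
  rw [← h, gaussQ_eq_integral, ← integral_const_mul]
  refine setIntegral_mono_on (integrable_gphi.const_mul x).integrableOn (integrableOn_mul_gphi x)
    measurableSet_Ioi fun t ht => ?_
  have := gphi_pos t
  have : x < t := ht
  gcongr

lemma tendsto_gaussQ : Tendsto gaussQ atTop (nhds 0) := by
  refine squeeze_zero' (Eventually.of_forall fun x => (gaussQ_pos x).le)
    (eventually_ge_atTop 1 |>.mono fun x hx => ?_) tendsto_gphi
  nlinarith [gaussQ_pos x, mul_gaussQ_le x]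

lemma mul_gphi_le (x : ℝ) : x * gphi x ≤ (1 + x ^ 2) * gaussQ x := by
  have hd : ∀ y, HasDerivAt (fun y => (1 + y ^ 2) * gaussQ y - y * gphi y)
      (2 * (y * gaussQ y - gphi y)) y := fun y => by
    have h1 := ((hasDerivAt_pow 2 y).const_add 1).mul (hasDerivAt_gaussQ y)
    have h2 := (hasDerivAt_id y).mul (hasDerivAt_gphi y)
    refine (h1.sub h2).congr_deriv ?_
    simp
    ring
  have hanti : Antitone fun y => (1 + y ^ 2) * gaussQ y - y * gphi y :=
    antitone_of_hasDerivAt_nonpos hd fun y => by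
      have := mul_gaussQ_le y
      simp only [Pi.zero_apply]
      linarith
  have hlow : ∀ᶠ y in atTop, -(y * gphi y) ≤ (1 + y ^ 2) * gaussQ y - y * gphi y :=
    Eventually.of_forall fun y => by
      have := gaussQ_pos y
      have : 0 ≤ (1 + y ^ 2) * gaussQ y := by positivity
      linarith
  have hlim : Tendsto (fun y => -(y * gphi y)) atTop (nhds 0) := by
    simpa using tendsto_mul_gphi.neg
  have h0 : 0 ≤ (1 + x ^ 2) * gaussQ x - x * gphi x := by
    refine le_of_tendsto hlim ?_
    filter_upwards [hlow, eventually_ge_atTop x] with y hy hxy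
    exact hy.trans (hanti hxy)
  linarith

/-- The Gaussian hazard rate. -/
def ghaz (x : ℝ) : ℝ := gphi x / gaussQ x

lemma ghaz_pos (x : ℝ) : 0 < ghaz x := div_pos (gphi_pos x) (gaussQ_pos x)

lemma le_ghaz (x : ℝ) : x ≤ ghaz x := (le_div_iff₀ (gaussQ_pos x)).2 (mul_gaussQ_le x)

lemma gaussQ_mul_ghaz (x : ℝ) : gaussQ x * ghaz x = gphi x :=
  mul_div_cancel₀ _ (gaussQ_pos x).ne'

lemma hasDerivAt_ghaz (x : ℝ) : HasDerivAt ghaz (ghaz x * (ghaz x - x)) x := by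
  refine ((hasDerivAt_gphi x).div (hasDerivAt_gaussQ x) (gaussQ_pos x).ne').congr_deriv ?_
  have := (gaussQ_pos x).ne'
  unfold ghaz
  field_simp
  ring

lemma ghaz_mono : Monotone ghaz :=
  monotone_of_hasDerivAt_nonneg hasDerivAt_ghaz fun x =>
    mul_nonneg (ghaz_pos x).le (sub_nonneg.2 (le_ghaz x))

lemma gaussQ_add_le (x d : ℝ) : gaussQ (x + d) ≤ gaussQ x * Real.exp (-(ghaz x * d)) := by
  have hd : ∀ y, HasDerivAt (fun y => Real.log (gaussQ y)) (-ghaz y) y := fun y =>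
    ((hasDerivAt_gaussQ y).log (gaussQ_pos y).ne').congr_deriv (by rw [ghaz, neg_div])
  have key : Real.log (gaussQ (x + d)) ≤ Real.log (gaussQ x) - ghaz x * d := by
    have hg : ∀ y, HasDerivAt (fun y => Real.log (gaussQ y) + ghaz x * y) (-ghaz y + ghaz x) y :=
      fun y => ((hd y).add ((hasDerivAt_id y).const_mul (ghaz x))).congr_deriv (by simp)
    have hcont : ∀ s, ContinuousOn (fun y => Real.log (gaussQ y) + ghaz x * y) s :=
      fun s y _ => (hg y).continuousAt.continuousWithinAt
    rcases le_total 0 d with h | h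
    · have := antitoneOn_of_hasDerivWithinAt_nonpos (convex_Ici x) (hcont _)
        (fun y _ => (hg y).hasDerivWithinAt) (fun y hy => by
          have hy' : x < y := by simpa using hy
          linarith [ghaz_mono hy'.le])
      have := this (Set.self_mem_Ici) (show x + d ∈ Set.Ici x by simpa using h)
        (by linarith)
      dsimp only at this
      linarith
    · have := monotoneOn_of_hasDerivWithinAt_nonneg (convex_Iic x) (hcont _)
        (fun y _ => (hg y).hasDerivWithinAt) (fun y hy => by
          have hy' : y < x := by simpa using hy
          linarith [ghaz_mono hy'.le])
      have := this (show x + d ∈ Set.Iic x by simpa using h) (Set.self_mem_Iic)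
        (by linarith)
      dsimp only at this
      linarith
  rw [← Real.exp_log (gaussQ_pos (x + d)), ← Real.exp_log (gaussQ_pos x), ← Real.exp_add]
  exact Real.exp_le_exp.2 (by linarith)

lemma gaussQ_mul_exp_le (x d : ℝ) :
    gaussQ x * Real.exp (-(ghaz (x + d) * d)) ≤ gaussQ (x + d) := by
  have h := gaussQ_add_le (x + d) (-d)
  rw [add_neg_cancel_right] at h
  calc _ ≤ (gaussQ (x + d) * Real.exp (-(ghaz (x + d) * -d))) *
        Real.exp (-(ghaz (x + d) * d)) := by gcongr
    _ = gaussQ (x + d) := by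
      rw [mul_assoc, ← Real.exp_add]
      simp

lemma exists_ghaz_bounds : ∃ c C : ℝ, 0 < c ∧ 0 < C ∧ ∀ u, -(1 / 2) ≤ u →
    c * (1 + u) ≤ ghaz u ∧ ghaz u ≤ C * (1 + u) ∧ |ghaz u - u| ≤ C / (1 + u) := by
  have hg1 := gphi_pos 1
  have hh := ghaz_pos (-(1 / 2))
  have hh1 := ghaz_pos 1
  refine ⟨min (ghaz (-(1 / 2)) / 2) (1 / 2), 2 * (ghaz 1 + 2), by positivity, by positivity,
    fun u hu => ?_⟩
  rcases le_total u 1 with h1 | h1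
  · have e1 := ghaz_mono hu
    have e2 := ghaz_mono h1
    refine ⟨?_, by nlinarith, ?_⟩
    · calc _ ≤ ghaz (-(1 / 2)) / 2 * (1 + u) := by
            gcongr
            · linarith
            · exact min_le_left _ _
        _ ≤ ghaz u := by nlinarith
    · rw [le_div_iff₀ (by linarith), abs_of_nonneg (by linarith [le_ghaz u])]
      nlinarith [le_ghaz u]
  · have e3 : ghaz u - u ≤ 1 / u := by
      have h := mul_gphi_le u
      have h2 : u * ghaz u ≤ 1 + u ^ 2 := by
        rw [ghaz, ← mul_div_assoc, div_le_iff₀ (gaussQ_pos u)]; exact h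
      rw [le_div_iff₀ (by linarith)]; nlinarith
    have e4 : 1 / u ≤ 2 / (1 + u) := by
      rw [div_le_div_iff₀ (by linarith) (by linarith)]; linarith
    have e5 : 2 / (1 + u) ≤ 1 := by rw [div_le_one (by linarith)]; linarith
    refine ⟨?_, ?_, ?_⟩
    · calc _ ≤ 1 / 2 * (1 + u) := by
            gcongr
            exact min_le_right _ _
        _ ≤ u := by linarith
        _ ≤ _ := le_ghaz u
    · nlinarith
    · rw [abs_of_nonneg (by linarith [le_ghaz u])]
      refine e3.trans (e4.trans ?_)
      gcongr
      linarith

lemma gaussQ_gaussQinv {ε : ℝ} (h0 : 0 < ε) (h1 : ε < 1) : gaussQ (gaussQinv ε) = ε := by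
  apply Function.invFun_eq
  obtain ⟨b, hb⟩ := (tendsto_gaussQ.eventually_lt_const h0).exists
  obtain ⟨a, ha⟩ := (tendsto_gaussQ.eventually_lt_const (sub_pos.2 h1)).exists
  have hc : Continuous gaussQ :=
    continuous_iff_continuousAt.2 fun x => (hasDerivAt_gaussQ x).continuousAt
  have ha' : ε < gaussQ (-a) := by rw [gaussQ_neg]; linarith
  exact mem_range_of_exists_le_of_exists_ge hc ⟨b, hb.le⟩ ⟨-a, ha'.le⟩

end

section

open scoped NNReal
open ProbabilityTheory

/-- Exponentially damped upper-tail indicator. -/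
def dampedTail (θ z s : ℝ) : ℝ := if z < s then Real.exp (-(θ * (s - z))) else 0

lemma dampedTail_nonneg (θ z s : ℝ) : 0 ≤ dampedTail θ z s := by
  unfold dampedTail; split_ifs <;> positivity

lemma dampedTail_le_one {θ : ℝ} (hθ : 0 ≤ θ) (z s : ℝ) : dampedTail θ z s ≤ 1 := by
  unfold dampedTail
  split_ifs with h
  · exact Real.exp_le_one_iff.2 (by nlinarith)
  · exact zero_le_one

lemma measurable_dampedTail (θ z : ℝ) : Measurable (dampedTail θ z) :=
  Measurable.ite measurableSet_Ioi (by fun_prop) measurable_const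

lemma setOf_le_dampedTail {θ : ℝ} (hθ : 0 ≤ θ) (z : ℝ) {t : ℝ} (ht : 0 < t) (ht1 : t ≤ 1) :
    {s | t ≤ dampedTail θ z s} = Set.Ioi z ∨
      ∃ b, z ≤ b ∧ {s | t ≤ dampedTail θ z s} = Set.Iic b \ Set.Iic z := by
  rcases hθ.eq_or_lt with rfl | hθ
  · left
    ext s
    by_cases h : z < s <;> simp [dampedTail, h, ht1, ht]
  · right
    refine ⟨z + -Real.log t / θ, ?_, ?_⟩
    · have : Real.log t ≤ 0 := Real.log_nonpos ht.le ht1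
      have : 0 ≤ -Real.log t / θ := div_nonneg (by linarith) hθ.le
      linarith
    · ext s
      by_cases h : z < s
      · have : t ≤ Real.exp (-(θ * (s - z))) ↔ s ≤ z + -Real.log t / θ := by
          rw [← Real.log_le_iff_le_exp ht, ← sub_le_iff_le_add', le_div_iff₀ hθ]
          constructor <;> intro h <;> linarith
        simp [dampedTail, h, this]
      · simp [dampedTail, h, ht]

lemma abs_integral_dampedTail_sub_le {μ ν : Measure ℝ} [IsProbabilityMeasure μ]
    [IsProbabilityMeasure ν] {δ θ : ℝ} (hθ : 0 ≤ θ) (z : ℝ)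
    (h : ∀ x, |μ.real (Set.Iic x) - ν.real (Set.Iic x)| ≤ δ) :
    |∫ s, dampedTail θ z s ∂μ - ∫ s, dampedTail θ z s ∂ν| ≤ 2 * δ := by
  have hint : ∀ (ρ : Measure ℝ) [IsProbabilityMeasure ρ], Integrable (dampedTail θ z) ρ :=
    fun ρ _ => Integrable.of_bound (measurable_dampedTail θ z).aestronglyMeasurable 1
      (ae_of_all _ fun s => by
        rw [Real.norm_eq_abs, abs_of_nonneg (dampedTail_nonneg _ _ _)]
        exact dampedTail_le_one hθ z s)
  have hlc : ∀ (ρ : Measure ℝ) [IsProbabilityMeasure ρ], ∫ s, dampedTail θ z s ∂ρ =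
      ∫ t in Set.Ioc 0 1, ρ.real {s | t ≤ dampedTail θ z s} := fun ρ _ =>
    (hint ρ).integral_eq_integral_Ioc_meas_le (ae_of_all _ fun s => dampedTail_nonneg _ _ _)
      (ae_of_all _ fun s => dampedTail_le_one hθ z s)
  have hintc : ∀ (ρ : Measure ℝ) [IsProbabilityMeasure ρ],
      IntegrableOn (fun t => ρ.real {s | t ≤ dampedTail θ z s}) (Set.Ioc 0 1) := fun ρ _ => by
    have : Antitone fun t => ρ.real {s | t ≤ dampedTail θ z s} := fun a b hab =>
      measureReal_mono fun s hs => hab.trans hs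
    exact Integrable.of_bound this.measurable.aestronglyMeasurable 1 (ae_of_all _ fun t => by
      rw [Real.norm_eq_abs, abs_of_nonneg measureReal_nonneg]; exact measureReal_le_one)
  have hδ : 0 ≤ δ := (abs_nonneg _).trans (h 0)
  rw [hlc μ, hlc ν, ← integral_sub (hintc μ) (hintc ν), ← Real.norm_eq_abs]
  refine (norm_setIntegral_le_of_norm_le_const (C := 2 * δ) (by simp) fun t ht => ?_).trans
    (by simp)
  rw [Real.norm_eq_abs]
  rcases setOf_le_dampedTail hθ z ht.1 ht.2 with he | ⟨b, hb, he⟩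
  · rw [he, ← Set.compl_Iic, probReal_compl_eq_one_sub measurableSet_Iic,
      probReal_compl_eq_one_sub measurableSet_Iic]
    have := h z
    rw [abs_sub_comm] at this
    have e : ∀ a b : ℝ, 1 - a - (1 - b) = b - a := fun a b => by ring
    rw [e]; linarith
  · rw [he, measureReal_sdiff (Set.Iic_subset_Iic.2 hb) measurableSet_Iic,
      measureReal_sdiff (Set.Iic_subset_Iic.2 hb) measurableSet_Iic]
    have h1 := abs_le.1 (h z)
    have h2 := abs_le.1 (h b)
    rw [abs_le]
    constructor <;> linarith [h1.1, h1.2, h2.1, h2.2]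

lemma integral_dampedTail_gaussianReal (θ z m : ℝ) {s : ℝ} (hs : 0 < s) :
    ∫ x, dampedTail θ z x ∂(gaussianReal m (.mk (s ^ 2) (sq_nonneg s))) =
      Real.exp (θ * z - θ * m + θ ^ 2 * s ^ 2 / 2) * gaussQ ((z - m + θ * s ^ 2) / s) := by
  set v : ℝ≥0 := .mk (s ^ 2) (sq_nonneg s) with hv
  have hvs : (v : ℝ) = s ^ 2 := rfl
  have hv0 : v ≠ 0 := by
    intro h; rw [h] at hvs; exact (pow_pos hs 2).ne hvs
  rw [integral_gaussianReal_eq_integral_smul hv0]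
  have e : ∀ x, gaussianPDFReal m v x • dampedTail θ z x =
      (Set.Ioi z).indicator (fun x => Real.exp (θ * z - θ * m + θ ^ 2 * s ^ 2 / 2) *
        gaussianPDFReal (m - θ * s ^ 2) v x) x := fun x => by
    by_cases h : z < x
    · rw [Set.indicator_of_mem (by exact h), dampedTail, if_pos h, gaussianPDFReal, gaussianPDFReal,
        smul_eq_mul, mul_assoc, mul_left_comm (Real.exp (θ * z - _ + _)), ← Real.exp_add,
        ← Real.exp_add, hvs]
      congr 2
      field_simp
      ring
    · rw [Set.indicator_of_notMem (by exact h), dampedTail, if_neg h, smul_zero]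
  simp_rw [e]
  rw [integral_indicator measurableSet_Ioi, integral_const_mul]
  congr 1
  have h1 : ∫ x in Set.Ioi z, gaussianPDFReal (m - θ * s ^ 2) v x =
      (gaussianReal (m - θ * s ^ 2) v).real (Set.Ioi z) := by
    rw [measureReal_def, gaussianReal_apply_eq_integral _ hv0, ENNReal.toReal_ofReal]
    exact integral_nonneg fun _ => gaussianPDFReal_nonneg _ _ _
  have h2 : gaussianReal (m - θ * s ^ 2) v =
      (gaussianReal 0 1).map (fun x => s * x + (m - θ * s ^ 2)) := by
    have a1 := gaussianReal_map_const_mul (μ := 0) (v := 1) s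
    have a2 := gaussianReal_map_add_const (μ := s * 0) (v := .mk (s ^ 2) (sq_nonneg _) * 1)
      (m - θ * s ^ 2)
    rw [← a1, Measure.map_map (by fun_prop) (by fun_prop), mul_one, mul_zero, zero_add] at a2
    exact a2.symm
  rw [h1, h2, map_measureReal_apply (by fun_prop) measurableSet_Ioi, gaussQ_eq_one_sub, gcdf,
    ← probReal_compl_eq_one_sub measurableSet_Iic]
  congr 1
  ext x
  simp only [Set.mem_preimage, Set.mem_Ioi, Set.mem_compl_iff, Set.mem_Iic, not_le]
  rw [div_lt_iff₀ hs]
  constructor <;> intro h <;> linarith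

variable {α : Type*} [Fintype α]

/-- Law of the sum of `n` independent draws of `ζ` under the weights `p`. -/
def iidLaw (p ζ : α → ℝ) (n : ℕ) : Measure ℝ :=
  ∑ a : Fin n → α, ENNReal.ofReal (∏ i, p (a i)) • Measure.dirac (∑ i, ζ (a i))

lemma integral_iidLaw {p : α → ℝ} (hp : ∀ a, 0 ≤ p a) (ζ : α → ℝ) (n : ℕ) (f : ℝ → ℝ) :
    ∫ s, f s ∂(iidLaw p ζ n) = iidExp p ζ n f := by
  rw [iidLaw, integral_finsetSum_measure]
  · refine Finset.sum_congr rfl fun a _ => ?_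
    rw [integral_smul_measure, integral_dirac, smul_eq_mul,
      ENNReal.toReal_ofReal (Finset.prod_nonneg fun i _ => hp _)]
  · intro a _
    exact (integrable_dirac (by simp)).smul_measure ENNReal.ofReal_ne_top

lemma isProbabilityMeasure_iidLaw {p : α → ℝ} (hp : ∀ a, 0 ≤ p a) (hp1 : ∑ a, p a = 1)
    (ζ : α → ℝ) (n : ℕ) : IsProbabilityMeasure (iidLaw p ζ n) := by
  constructor
  rw [iidLaw, Measure.finsetSum_apply]
  simp only [Measure.smul_apply, measure_univ, smul_eq_mul, mul_one]
  rw [← ENNReal.ofReal_sum_of_nonneg fun a _ => Finset.prod_nonneg fun i _ => hp _]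
  have := iidExp_const (ζ := ζ) (n := n) hp1 1
  simp only [iidExp, mul_one] at this
  simp [this]

lemma iidLaw_real_Iic {p : α → ℝ} (hp : ∀ a, 0 ≤ p a) (ζ : α → ℝ) (n : ℕ) (x : ℝ) :
    (iidLaw p ζ n).real (Set.Iic x) = iidCdf p ζ n x := by
  rw [iidCdf, ← integral_iidLaw hp, ← integral_indicator_one measurableSet_Iic]
  congr 1

/-- Berry–Esseen bound, uniform over laws with bounded values and variance bounded below. -/
theorem exists_berryEsseen_of_variance (B : ℝ) {v₀ : ℝ} (hv₀ : 0 < v₀) :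
    ∃ D : ℝ, 0 < D ∧ ∀ (q ζ : α → ℝ) (μ s : ℝ), (∀ a, 0 ≤ q a) → ∑ a, q a = 1 →
      (∀ a, |ζ a| ≤ B) → |μ| ≤ B → ∑ a, q a * ζ a = μ → 0 < s → ∑ a, q a * (ζ a - μ) ^ 2 = s ^ 2 →
      v₀ ≤ s ^ 2 → ∀ n : ℕ, 0 < n → ∀ z : ℝ,
      |iidCdf q ζ n z - gcdf 1 ((z - n * μ) / (√n * s))| ≤ D / √n := by
  set B' : ℝ := max 1 (2 * B / √v₀) with hB'
  obtain ⟨D, hD, h⟩ := exists_berryEsseen (α := α) (B := B') (le_max_left _ _)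
  refine ⟨D, hD, fun q ζ μ s hq hq1 hζ hμB hμ hs hvar hsv n hn z => ?_⟩
  have hlaw : IsStdLaw q (fun a => s⁻¹ * ζ a + -(μ / s)) B' := by
    have he : ∀ a, s⁻¹ * ζ a + -(μ / s) = s⁻¹ * (ζ a - μ) := fun a => by ring
    simp only [he]
    refine ⟨hq, hq1, ?_, ?_, fun a => ?_⟩
    · have : ∑ a, q a * (s⁻¹ * (ζ a - μ)) = s⁻¹ * (∑ a, q a * ζ a - μ * ∑ a, q a) := by
        rw [Finset.mul_sum, ← Finset.sum_sub_distrib, Finset.mul_sum]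
        exact Finset.sum_congr rfl fun a _ => by ring
      rw [this, hμ, hq1]; ring
    · have : ∑ a, q a * (s⁻¹ * (ζ a - μ)) ^ 2 = s⁻¹ ^ 2 * ∑ a, q a * (ζ a - μ) ^ 2 := by
        rw [Finset.mul_sum]
        exact Finset.sum_congr rfl fun a _ => by ring
      rw [this, hvar]; field_simp
    · have h1 : |ζ a - μ| ≤ 2 * B := (abs_sub _ _).trans (by linarith [hζ a])
      have h2 : √v₀ ≤ s := Real.sqrt_le_iff.2 ⟨hs.le, hsv⟩
      have h3 : 0 < √v₀ := Real.sqrt_pos.2 hv₀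
      rw [abs_mul, abs_of_pos (inv_pos.2 hs), inv_mul_eq_div]
      refine le_trans ?_ (le_max_right _ _)
      gcongr
      exact (abs_nonneg _).trans h1
  have hn0 : (0 : ℝ) < n := by exact_mod_cast hn
  have hmain := h q _ hlaw n ((z - n * μ) / s)
  have e1 : iidCdf q (fun a => s⁻¹ * ζ a + -(μ / s)) n ((z - n * μ) / s) = iidCdf q ζ n z := by
    rw [iidCdf, iidExp_affine, iidCdf]
    refine iidExp_congr (fun x => ?_)
    have : s⁻¹ * x + n * -(μ / s) ≤ (z - n * μ) / s ↔ x ≤ z := by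
      rw [show s⁻¹ * x + n * -(μ / s) = (x - n * μ) / s by ring, div_le_div_iff_of_pos_right hs]
      constructor <;> intro h <;> linarith
    simp only [this]
  have e2 : gcdf n ((z - n * μ) / s) = gcdf 1 ((z - n * μ) / (√n * s)) := by
    have := gcdf_scale (c := √n) (Real.sqrt_pos.2 hn0) ((z - n * μ) / (√n * s))
    rw [← this]
    congr 1
    · ext; simp
    · field_simp
  rw [e1, e2] at hmain
  refine hmain.trans ?_
  gcongr
  linarith

lemma abs_iidExp_dampedTail_sub_le {q ζ : α → ℝ} {θ μ s D : ℝ} (hq : ∀ a, 0 ≤ q a)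
    (hq1 : ∑ a, q a = 1) (hθ : 0 ≤ θ) (hs : 0 < s) {n : ℕ} (hn : 0 < n)
    (hD : ∀ z, |iidCdf q ζ n z - gcdf 1 ((z - n * μ) / (√n * s))| ≤ D / √n) (z : ℝ) :
    |iidExp q ζ n (dampedTail θ z) - ∫ x, dampedTail θ z x ∂(gaussianReal (n * μ)
      (.mk ((√n * s) ^ 2) (sq_nonneg _)))| ≤ 2 * (D / √n) := by
  have hn0 : (0 : ℝ) < n := by exact_mod_cast hn
  have := isProbabilityMeasure_iidLaw hq hq1 ζ n
  have hσ : 0 < √(n : ℝ) * s := mul_pos (Real.sqrt_pos.2 hn0) hs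
  set v : ℝ≥0 := .mk ((√(n : ℝ) * s) ^ 2) (sq_nonneg _) with hv
  have hcdf : ∀ x, (gaussianReal (n * μ) v).real (Set.Iic x) =
      gcdf 1 ((x - n * μ) / (√n * s)) := fun x => by
    have h1 := gaussianReal_map_add_const (μ := 0) (v := v) (n * μ)
    rw [zero_add] at h1
    rw [← gcdf_scale hσ, mul_div_cancel₀ _ hσ.ne', gcdf, ← h1,
      map_measureReal_apply (by fun_prop) measurableSet_Iic]
    congr 1
    ext y
    simp [le_sub_iff_add_le]
  have hmain := abs_integral_dampedTail_sub_le (μ := iidLaw q ζ n) (ν := gaussianReal (n * μ) v)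
    hθ z (δ := D / √n) (fun x => by rw [iidLaw_real_Iic hq, hcdf]; exact hD x)
  rwa [integral_iidLaw hq] at hmain

/-- Exponential change of measure combined with the Berry–Esseen bound. -/
theorem abs_tail_sub_le {p ζ : α → ℝ} {m θ μ s D : ℝ} (hp : ∀ a, 0 ≤ p a) (hm : 0 < m)
    (hθ : 0 ≤ θ) (hmdef : ∑ a, p a * Real.exp (θ * ζ a) = m) (hs : 0 < s) {n : ℕ} (hn : 0 < n)
    (hD : ∀ z, |iidCdf (fun a => p a * Real.exp (θ * ζ a) / m) ζ n z -
      gcdf 1 ((z - n * μ) / (√n * s))| ≤ D / √n) (z : ℝ) :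
    |iidExp p ζ n (fun x => if z < x then 1 else 0) -
      Real.exp (n * Real.log m - n * (θ * μ) + n * (θ ^ 2 * s ^ 2 / 2)) *
        gaussQ ((z - n * μ + n * (θ * s ^ 2)) / (√n * s))| ≤
      2 * (D / √n) * Real.exp (n * Real.log m - θ * z) := by
  set q : α → ℝ := fun a => p a * Real.exp (θ * ζ a) / m with hq
  have hn0 : (0 : ℝ) < n := by exact_mod_cast hn
  have hrn : 0 < √(n : ℝ) := Real.sqrt_pos.2 hn0
  have hrn2 : √(n : ℝ) ^ 2 = n := Real.sq_sqrt hn0.le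
  have hq0 : ∀ a, 0 ≤ q a := fun a => by have := hp a; positivity
  have hq1 : ∑ a, q a = 1 := by rw [hq, ← Finset.sum_div, hmdef, div_self hm.ne']
  have hmain := abs_iidExp_dampedTail_sub_le hq0 hq1 hθ hs hn hD z
  rw [integral_dampedTail_gaussianReal _ _ _ (mul_pos hrn hs)] at hmain
  have e1 : iidExp p ζ n (fun x => if z < x then 1 else 0) =
      Real.exp (n * Real.log m - θ * z) *
      iidExp q ζ n (dampedTail θ z) := by
    have hexp : Real.exp (n * Real.log m - θ * z) = m ^ n * Real.exp (-(θ * z)) := by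
      rw [sub_eq_add_neg, Real.exp_add, Real.exp_nat_mul, Real.exp_log hm]
    have hc := iidExp_const_mul (p := q) (ζ := ζ) (n := n) (Real.exp (-(θ * z))) (dampedTail θ z)
    rw [iidExp_tilt hm.ne' (θ := θ), hexp, mul_assoc, ← hc]
    congr 1
    refine iidExp_congr (p := q) (ζ := ζ) (n := n) fun x => ?_
    unfold dampedTail
    split_ifs
    · rw [← Real.exp_add, mul_one]; congr 1; ring
    · simp
  have e2 : Real.exp (n * Real.log m - n * (θ * μ) + n * (θ ^ 2 * s ^ 2 / 2)) =
      Real.exp (n * Real.log m - θ * z) *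
      Real.exp (θ * z - θ * (n * μ) + θ ^ 2 * (√n * s) ^ 2 / 2) := by
    rw [← Real.exp_add, mul_pow, hrn2]; congr 1; ring
  have e3 : z - n * μ + n * (θ * s ^ 2) = z - n * μ + θ * (√n * s) ^ 2 := by
    rw [mul_pow, hrn2]; ring
  rw [e1, e2, e3, mul_assoc, ← mul_sub, abs_mul, abs_of_pos (Real.exp_pos _), mul_comm]
  gcongr

end

section

variable {α : Type*} [Fintype α]

/-- A finitely supported law with mean zero, variance `V`, third moment `κ` and values in
`[-B, B]`. -/
structure IsCenteredLaw (p ζ : α → ℝ) (V κ B : ℝ) : Prop where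
  nonneg : ∀ a, 0 ≤ p a
  sum_one : ∑ a, p a = 1
  mean : ∑ a, p a * ζ a = 0
  var : ∑ a, p a * ζ a ^ 2 = V
  third : ∑ a, p a * ζ a ^ 3 = κ
  bound : ∀ a, |ζ a| ≤ B

lemma abs_sum_mul_le {p f : α → ℝ} (hp : ∀ a, 0 ≤ p a) (hp1 : ∑ a, p a = 1) {c : ℝ}
    (hf : ∀ a, |f a| ≤ c) : |∑ a, p a * f a| ≤ c := by
  calc _ ≤ ∑ a, |p a * f a| := Finset.abs_sum_le_sum_abs _ _
    _ ≤ ∑ a, p a * c := Finset.sum_le_sum fun a _ => by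
        rw [abs_mul, abs_of_nonneg (hp a)]; exact mul_le_mul_of_nonneg_left (hf a) (hp a)
    _ = c := by rw [← Finset.sum_mul, hp1, one_mul]

lemma abs_exp_sub_cubic_le {u : ℝ} (hu : |u| ≤ 1) :
    |Real.exp u - (1 + u + u ^ 2 / 2 + u ^ 3 / 6)| ≤ |u| ^ 4 := by
  have h := Real.exp_bound hu (n := 4) (by norm_num)
  norm_num [Finset.sum_range_succ, Nat.factorial] at h
  refine h.trans ?_
  have : 0 ≤ |u| ^ 4 := by positivity
  have e : |u| ^ 4 = u ^ 4 := by rw [Even.pow_abs (by decide)]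
  linarith

lemma abs_exp_sub_quadratic_le {u : ℝ} (hu : |u| ≤ 1) :
    |Real.exp u - (1 + u + u ^ 2 / 2)| ≤ |u| ^ 3 := by
  have h := Real.exp_bound hu (n := 3) (by norm_num)
  norm_num [Finset.sum_range_succ, Nat.factorial] at h
  refine h.trans ?_
  have : 0 ≤ |u| ^ 3 := by positivity
  linarith

lemma abs_exp_sub_linear_le {u : ℝ} (hu : |u| ≤ 1) :
    |Real.exp u - (1 + u)| ≤ |u| ^ 2 := by
  have h := Real.exp_bound hu (n := 2) (by norm_num)
  norm_num [Finset.sum_range_succ, Nat.factorial] at h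
  refine h.trans ?_
  have : 0 ≤ |u| ^ 2 := by positivity
  have e : |u| ^ 2 = u ^ 2 := sq_abs u
  linarith

section tilting

variable {p ζ : α → ℝ} {V κ B θ : ℝ} (h : IsCenteredLaw p ζ V κ B) (hθ : |θ| * B ≤ 1)
include h hθ

lemma IsCenteredLaw.abs_mul_le_one (a : α) : |θ * ζ a| ≤ 1 := by
  rw [abs_mul]
  exact (mul_le_mul_of_nonneg_left (h.bound a) (abs_nonneg _)).trans hθ

lemma IsCenteredLaw.abs_mgf_sub_le :
    |∑ a, p a * Real.exp (θ * ζ a) - (1 + V * θ ^ 2 / 2 + κ * θ ^ 3 / 6)| ≤ B ^ 4 * |θ| ^ 4 := by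
  have e : ∑ a, p a * Real.exp (θ * ζ a) - (1 + V * θ ^ 2 / 2 + κ * θ ^ 3 / 6) =
      ∑ a, p a * (Real.exp (θ * ζ a) -
        (1 + θ * ζ a + (θ * ζ a) ^ 2 / 2 + (θ * ζ a) ^ 3 / 6)) := by
    have : (1 : ℝ) + V * θ ^ 2 / 2 + κ * θ ^ 3 / 6 = ∑ a, p a + θ * ∑ a, p a * ζ a +
        θ ^ 2 / 2 * ∑ a, p a * ζ a ^ 2 + θ ^ 3 / 6 * ∑ a, p a * ζ a ^ 3 := by
      rw [h.sum_one, h.mean, h.var, h.third]; ring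
    rw [this, Finset.mul_sum, Finset.mul_sum, Finset.mul_sum, ← Finset.sum_add_distrib,
      ← Finset.sum_add_distrib, ← Finset.sum_add_distrib, ← Finset.sum_sub_distrib]
    exact Finset.sum_congr rfl fun a _ => by ring
  rw [e]
  refine abs_sum_mul_le h.nonneg h.sum_one fun a => ?_
  refine (abs_exp_sub_cubic_le (h.abs_mul_le_one hθ a)).trans ?_
  rw [abs_mul, mul_pow, mul_comm]
  gcongr
  exact h.bound a

lemma IsCenteredLaw.abs_mgf_deriv_sub_le :
    |∑ a, p a * (ζ a * Real.exp (θ * ζ a)) - (V * θ + κ * θ ^ 2 / 2)| ≤ B ^ 4 * |θ| ^ 3 := by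
  have e : ∑ a, p a * (ζ a * Real.exp (θ * ζ a)) - (V * θ + κ * θ ^ 2 / 2) =
      ∑ a, p a * (ζ a * (Real.exp (θ * ζ a) - (1 + θ * ζ a + (θ * ζ a) ^ 2 / 2))) := by
    have : V * θ + κ * θ ^ 2 / 2 = ∑ a, p a * ζ a +
        θ * ∑ a, p a * ζ a ^ 2 + θ ^ 2 / 2 * ∑ a, p a * ζ a ^ 3 := by
      rw [h.mean, h.var, h.third]; ring
    rw [this, Finset.mul_sum, Finset.mul_sum, ← Finset.sum_add_distrib,
      ← Finset.sum_add_distrib, ← Finset.sum_sub_distrib]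
    exact Finset.sum_congr rfl fun a _ => by ring
  rw [e]
  refine abs_sum_mul_le h.nonneg h.sum_one fun a => ?_
  rw [abs_mul]
  calc _ ≤ |ζ a| * |θ * ζ a| ^ 3 :=
        mul_le_mul_of_nonneg_left (abs_exp_sub_quadratic_le (h.abs_mul_le_one hθ a))
          (abs_nonneg _)
    _ = |ζ a| ^ 4 * |θ| ^ 3 := by rw [abs_mul]; ring
    _ ≤ _ := by
        gcongr
        exact h.bound a

lemma IsCenteredLaw.abs_mgf_second_deriv_sub_le :
    |∑ a, p a * (ζ a ^ 2 * Real.exp (θ * ζ a)) - (V + κ * θ)| ≤ B ^ 4 * |θ| ^ 2 := by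
  have e : ∑ a, p a * (ζ a ^ 2 * Real.exp (θ * ζ a)) - (V + κ * θ) =
      ∑ a, p a * (ζ a ^ 2 * (Real.exp (θ * ζ a) - (1 + θ * ζ a))) := by
    rw [← h.var, ← h.third, mul_comm _ θ, Finset.mul_sum, ← Finset.sum_add_distrib,
      ← Finset.sum_sub_distrib]
    exact Finset.sum_congr rfl fun a _ => by ring
  rw [e]
  refine abs_sum_mul_le h.nonneg h.sum_one fun a => ?_
  rw [abs_mul, abs_pow]
  calc _ ≤ |ζ a| ^ 2 * |θ * ζ a| ^ 2 :=
        mul_le_mul_of_nonneg_left (abs_exp_sub_linear_le (h.abs_mul_le_one hθ a))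
          (by positivity)
    _ = |ζ a| ^ 4 * |θ| ^ 2 := by rw [abs_mul]; ring
    _ ≤ _ := by
        gcongr
        exact h.bound a

end tilting

lemma abs_log_one_add_sub_le {M : ℝ} (hM : |M| ≤ 1 / 2) : |Real.log (1 + M) - M| ≤ 2 * M ^ 2 := by
  have h1 := abs_le.1 hM
  have h2 := Real.log_le_sub_one_of_pos (show 0 < 1 + M by linarith)
  have h3 := Real.one_sub_inv_le_log_of_pos (show 0 < 1 + M by linarith)
  have h4 : M - 2 * M ^ 2 ≤ 1 - (1 + M)⁻¹ := by
    have : (1 : ℝ) - (1 + M)⁻¹ = M / (1 + M) := by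
      have : 1 + M ≠ 0 := by linarith
      field_simp; ring
    rw [this, le_div_iff₀ (by linarith)]
    nlinarith [sq_nonneg M]
  rw [abs_le]
  constructor <;> nlinarith [sq_nonneg M]

set_option maxHeartbeats 1000000 in
/-- Expansion of the exponentially tilted cumulants for small tilting parameter. -/
theorem IsCenteredLaw.exists_tilt_bounds {p ζ : α → ℝ} {V κ B : ℝ}
    (h : IsCenteredLaw p ζ V κ B) (hB : 1 ≤ B) (hV : 0 < V) :
    ∃ C θ₀ : ℝ, 0 < C ∧ 0 < θ₀ ∧ ∀ θ : ℝ, |θ| ≤ θ₀ → ∃ m μ s : ℝ, 0 < m ∧ 0 < s ∧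
      ∑ a, p a * Real.exp (θ * ζ a) = m ∧
      ∑ a, p a * Real.exp (θ * ζ a) / m * ζ a = μ ∧
      ∑ a, p a * Real.exp (θ * ζ a) / m * (ζ a - μ) ^ 2 = s ^ 2 ∧ |μ| ≤ B ∧
      V / 2 ≤ s ^ 2 ∧ s ^ 2 ≤ 2 * V ∧
      |Real.log m - (V * θ ^ 2 / 2 + κ * θ ^ 3 / 6)| ≤ C * |θ| ^ 4 ∧
      |μ - (V * θ + κ * θ ^ 2 / 2)| ≤ C * |θ| ^ 3 ∧
      |s ^ 2 - (V + κ * θ)| ≤ C * |θ| ^ 2 := by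
  set C₁ := V + |κ| + B ^ 4 with hC₁
  have hB4 : 1 ≤ B ^ 4 := one_le_pow₀ hB
  have hκ := abs_nonneg κ
  have hC1 : 1 ≤ C₁ := by linarith
  have hC11 : C₁ ≤ C₁ ^ 2 := by nlinarith
  set θ₀ := min (1 / (2 * B * C₁)) (V / (2 * (5 * C₁ ^ 2 + C₁))) with hθ₀
  refine ⟨10 * C₁ ^ 2, θ₀, by positivity, by positivity, fun θ hθ => ?_⟩
  have ht0 := abs_nonneg θ
  have hθ1 : |θ| * (2 * B * C₁) ≤ 1 := (le_div_iff₀ (by positivity)).1 (hθ.trans (min_le_left _ _))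
  have hθ2 : |θ| * (2 * (5 * C₁ ^ 2 + C₁)) ≤ V :=
    (le_div_iff₀ (by positivity)).1 (hθ.trans (min_le_right _ _))
  have hθC : |θ| * C₁ ≤ 1 / 2 := by
    have : |θ| * C₁ * 1 ≤ |θ| * C₁ * B := by gcongr
    linarith
  have hθB : |θ| * B ≤ 1 := by
    have : |θ| * B * 1 ≤ |θ| * B * C₁ := by gcongr
    linarith
  have hθ' : |θ| ≤ 1 / 2 := by
    have : |θ| * 1 ≤ |θ| * C₁ := by gcongr
    linarith
  have b0 := h.abs_mgf_sub_le hθB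
  have b1 := h.abs_mgf_deriv_sub_le hθB
  have b2 := h.abs_mgf_second_deriv_sub_le hθB
  set m := ∑ a, p a * Real.exp (θ * ζ a) with hm
  set m1 := ∑ a, p a * (ζ a * Real.exp (θ * ζ a)) with hm1
  set m2 := ∑ a, p a * (ζ a ^ 2 * Real.exp (θ * ζ a)) with hm2
  have hsq : θ ^ 2 = |θ| ^ 2 := (sq_abs θ).symm
  have hM : |m - 1| ≤ C₁ * |θ| ^ 2 := by
    have e : m - 1 = (m - (1 + V * θ ^ 2 / 2 + κ * θ ^ 3 / 6)) + (V * θ ^ 2 / 2 + κ * θ ^ 3 / 6) := by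
      ring
    rw [e]
    refine (abs_add_le _ _).trans ?_
    have e1 : |V * θ ^ 2 / 2 + κ * θ ^ 3 / 6| ≤ V * |θ| ^ 2 / 2 + |κ| * |θ| ^ 3 / 6 := by
      refine (abs_add_le _ _).trans (le_of_eq ?_)
      rw [abs_div, abs_div, abs_mul, abs_mul, abs_pow, abs_pow, abs_of_pos hV]; norm_num
    have e2 : |κ| * |θ| ^ 3 ≤ |κ| * |θ| ^ 2 :=
      mul_le_mul_of_nonneg_left (pow_le_pow_of_le_one ht0 (by linarith) (by norm_num)) hκ
    have e3 : B ^ 4 * |θ| ^ 4 ≤ B ^ 4 * |θ| ^ 2 :=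
      mul_le_mul_of_nonneg_left (pow_le_pow_of_le_one ht0 (by linarith) (by norm_num))
        (by positivity)
    have e4 : 0 ≤ |κ| * |θ| ^ 2 := by positivity
    have e5 : 0 ≤ V * |θ| ^ 2 := by positivity
    calc _ ≤ _ := add_le_add b0 e1
      _ ≤ _ := by rw [hC₁]; linarith
  have hM2 : |m - 1| ≤ 1 / 2 := by
    calc _ ≤ |θ| * C₁ * |θ| := hM.trans (le_of_eq (by ring))
      _ ≤ 1 / 2 * (1 / 2) := by gcongr
      _ ≤ _ := by norm_num
  have hm0 : 1 / 2 ≤ m := by linarith [(abs_le.1 hM2).1]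
  have hmpos : 0 < m := by linarith
  have hm1le : |m1| ≤ C₁ * |θ| := by
    have e : m1 = (m1 - (V * θ + κ * θ ^ 2 / 2)) + (V * θ + κ * θ ^ 2 / 2) := by ring
    rw [e]
    refine (abs_add_le _ _).trans ?_
    have e1 : |V * θ + κ * θ ^ 2 / 2| ≤ V * |θ| + |κ| * |θ| ^ 2 / 2 := by
      refine (abs_add_le _ _).trans (le_of_eq ?_)
      rw [abs_div, abs_mul, abs_mul, abs_pow, abs_of_pos hV]; norm_num
    have e2 : |κ| * |θ| ^ 2 ≤ |κ| * |θ| ^ 1 :=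
      mul_le_mul_of_nonneg_left (pow_le_pow_of_le_one ht0 (by linarith) (by norm_num)) hκ
    have e3 : B ^ 4 * |θ| ^ 3 ≤ B ^ 4 * |θ| ^ 1 :=
      mul_le_mul_of_nonneg_left (pow_le_pow_of_le_one ht0 (by linarith) (by norm_num))
        (by positivity)
    have e4 : 0 ≤ |κ| * |θ| ^ 1 := by positivity
    calc _ ≤ _ := add_le_add b1 e1
      _ ≤ _ := by rw [hC₁]; linarith
  have hm2le : |m2| ≤ C₁ := by
    have e : m2 = (m2 - (V + κ * θ)) + (V + κ * θ) := by ring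
    rw [e]
    refine (abs_add_le _ _).trans ?_
    have e1 : |V + κ * θ| ≤ V + |κ| * |θ| := by
      refine (abs_add_le _ _).trans (le_of_eq ?_)
      rw [abs_mul, abs_of_pos hV]
    have e2 : |κ| * |θ| ≤ |κ| * 1 := by gcongr; linarith
    have e3 : B ^ 4 * |θ| ^ 2 ≤ B ^ 4 * 1 := by
      gcongr; exact pow_le_one₀ ht0 (by linarith)
    calc _ ≤ _ := add_le_add b2 e1
      _ ≤ _ := by rw [hC₁]; linarith
  have hqnn : ∀ a, 0 ≤ p a * Real.exp (θ * ζ a) / m := fun a => by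
    have := h.nonneg a; positivity
  have hq1 : ∑ a, p a * Real.exp (θ * ζ a) / m = 1 := by
    rw [← Finset.sum_div, ← hm, div_self hmpos.ne']
  have hμ : ∑ a, p a * Real.exp (θ * ζ a) / m * ζ a = m1 / m := by
    rw [hm1, Finset.sum_div]; exact Finset.sum_congr rfl fun a _ => by ring
  have hvar : ∑ a, p a * Real.exp (θ * ζ a) / m * (ζ a - m1 / m) ^ 2 =
      m2 / m - (m1 / m) ^ 2 := by
    have e : ∀ a, p a * Real.exp (θ * ζ a) / m * (ζ a - m1 / m) ^ 2 =
        p a * (ζ a ^ 2 * Real.exp (θ * ζ a)) / m -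
        2 * (m1 / m) * (p a * Real.exp (θ * ζ a) / m * ζ a) +
        (m1 / m) ^ 2 * (p a * Real.exp (θ * ζ a) / m) := fun a => by ring
    simp only [e]
    rw [Finset.sum_add_distrib, Finset.sum_sub_distrib, ← Finset.mul_sum, ← Finset.mul_sum, hμ,
      hq1, ← Finset.sum_div]
    ring
  have hinv : m⁻¹ ≤ 2 := by
    rw [inv_le_comm₀ hmpos (by norm_num)]; linarith
  have hμle : |m1 / m| ≤ 2 * C₁ * |θ| := by
    rw [div_eq_mul_inv, abs_mul, abs_of_pos (inv_pos.2 hmpos)]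
    calc _ ≤ C₁ * |θ| * 2 := by gcongr
      _ = _ := by ring
  have hv3 : |m2 / m - (m1 / m) ^ 2 - (V + κ * θ)| ≤ (5 * C₁ ^ 2 + C₁ + C₁ ^ 2) * |θ| ^ 2 := by
    have e : m2 / m - (m1 / m) ^ 2 - (V + κ * θ) =
        (m2 - (V + κ * θ)) + -(m2 * (m - 1) * m⁻¹) + -((m1 / m) ^ 2) := by
      field_simp; ring
    rw [e]
    refine (abs_add_three _ _ _).trans ?_
    rw [abs_neg, abs_neg, abs_mul, abs_mul, abs_of_pos (inv_pos.2 hmpos), abs_pow]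
    have e1 : |m2| * |m - 1| * m⁻¹ ≤ C₁ * (C₁ * |θ| ^ 2) * 2 := by gcongr
    have e2 : |m1 / m| ^ 2 ≤ (2 * C₁ * |θ|) ^ 2 := by gcongr
    have e3 : B ^ 4 * |θ| ^ 2 ≤ C₁ * |θ| ^ 2 := by gcongr; linarith
    calc _ ≤ C₁ * |θ| ^ 2 + C₁ * (C₁ * |θ| ^ 2) * 2 + (2 * C₁ * |θ|) ^ 2 :=
          add_le_add (add_le_add (b2.trans e3) e1) e2
      _ = _ := by ring
  have hlow : V / 2 ≤ m2 / m - (m1 / m) ^ 2 ∧ m2 / m - (m1 / m) ^ 2 ≤ 2 * V := by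
    have a1 := abs_le.1 hv3
    have a2 : (5 * C₁ ^ 2 + C₁ + C₁ ^ 2) * |θ| ^ 2 ≤ (5 * C₁ ^ 2 + C₁) * |θ| - C₁ * |θ| := by
      have : (5 * C₁ ^ 2 + C₁ + C₁ ^ 2) * |θ| ≤ 5 * C₁ ^ 2 := by
        calc _ = 6 * C₁ * (|θ| * C₁) + |θ| * C₁ := by ring
          _ ≤ 6 * C₁ * (1 / 2) + 1 / 2 := by gcongr
          _ ≤ _ := by linarith
      calc (5 * C₁ ^ 2 + C₁ + C₁ ^ 2) * |θ| ^ 2 =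
          ((5 * C₁ ^ 2 + C₁ + C₁ ^ 2) * |θ|) * |θ| := by ring
        _ ≤ 5 * C₁ ^ 2 * |θ| := by gcongr
        _ = _ := by ring
    have a3 : |κ * θ| ≤ C₁ * |θ| := by
      rw [abs_mul]; gcongr; linarith
    have a4 := abs_le.1 a3
    constructor <;> linarith [a1.1, a1.2, a4.1, a4.2]
  refine ⟨m, m1 / m, √(m2 / m - (m1 / m) ^ 2), hmpos, Real.sqrt_pos.2 (by linarith [hlow.1]),
    rfl, hμ, ?_, ?_, ?_⟩
  · rw [hvar, Real.sq_sqrt (by linarith [hlow.1])]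
  · rw [← hμ]; exact abs_sum_mul_le hqnn hq1 h.bound
  rw [Real.sq_sqrt (by linarith [hlow.1])]
  refine ⟨hlow.1, hlow.2, ?_, ?_, ?_⟩
  · have e : Real.log m - (V * θ ^ 2 / 2 + κ * θ ^ 3 / 6) =
        (Real.log (1 + (m - 1)) - (m - 1)) + (m - (1 + V * θ ^ 2 / 2 + κ * θ ^ 3 / 6)) := by
      rw [add_sub_cancel]; ring
    rw [e]
    refine (abs_add_le _ _).trans ?_
    have e1 := abs_log_one_add_sub_le hM2
    have e2 : 2 * (m - 1) ^ 2 ≤ 2 * (C₁ * |θ| ^ 2) ^ 2 := by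
      rw [← sq_abs (m - 1)]; gcongr
    have e3 : B ^ 4 * |θ| ^ 4 ≤ C₁ ^ 2 * |θ| ^ 4 := by gcongr; linarith
    have e4 : 0 ≤ C₁ ^ 2 * |θ| ^ 4 := by positivity
    calc _ ≤ 2 * (C₁ * |θ| ^ 2) ^ 2 + C₁ ^ 2 * |θ| ^ 4 :=
          add_le_add (e1.trans e2) (b0.trans e3)
      _ = 3 * (C₁ ^ 2 * |θ| ^ 4) := by ring
      _ ≤ 10 * (C₁ ^ 2 * |θ| ^ 4) := by linarith
      _ = _ := by ring
  · have e : m1 / m - (V * θ + κ * θ ^ 2 / 2) =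
        (m1 - (V * θ + κ * θ ^ 2 / 2)) + -(m1 * (m - 1) * m⁻¹) := by
      field_simp; ring
    rw [e]
    refine (abs_add_le _ _).trans ?_
    rw [abs_neg, abs_mul, abs_mul, abs_of_pos (inv_pos.2 hmpos)]
    have e1 : |m1| * |m - 1| * m⁻¹ ≤ C₁ * |θ| * (C₁ * |θ| ^ 2) * 2 := by gcongr
    have e3 : B ^ 4 * |θ| ^ 3 ≤ C₁ ^ 2 * |θ| ^ 3 := by gcongr; linarith
    have e4 : 0 ≤ C₁ ^ 2 * |θ| ^ 3 := by positivity
    calc _ ≤ C₁ ^ 2 * |θ| ^ 3 + C₁ * |θ| * (C₁ * |θ| ^ 2) * 2 :=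
          add_le_add (b1.trans e3) e1
      _ = 3 * (C₁ ^ 2 * |θ| ^ 3) := by ring
      _ ≤ 10 * (C₁ ^ 2 * |θ| ^ 3) := by linarith
      _ = _ := by ring
  · refine hv3.trans ?_
    gcongr
    linarith

end

section

variable {α : Type*} [Fintype α]

lemma sq_le_mul_of_cube_le {t K r c : ℝ} (hc : 0 < c) (h : |t| ^ 3 ≤ K * r)
    (hr : K ^ 2 / c ^ 3 ≤ r) (hr0 : 0 < r) : t ^ 2 ≤ c * r := by
  refine le_of_pow_le_pow_left₀ (n := 3) (by norm_num) (by positivity) ?_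
  calc (t ^ 2) ^ 3 = (|t| ^ 3) ^ 2 := by rw [← sq_abs]; ring
    _ ≤ (K * r) ^ 2 := by gcongr
    _ = K ^ 2 * r ^ 2 := by ring
    _ ≤ (r * c ^ 3) * r ^ 2 := by gcongr; exact (div_le_iff₀ (by positivity)).1 hr
    _ = _ := by ring

lemma abs_le_mul_of_sq_le {t r c : ℝ} (h : t ^ 2 ≤ c * r) (hr : 1 ≤ c * r) : |t| ≤ c * r := by
  nlinarith [sq_nonneg (|t| - 1), sq_abs t]

lemma abs_tilt_exponent_le {r σ t θ κ K C Λ a : ℝ} (hr : 0 < r) (hσ : 0 < σ) (hC : 0 ≤ C)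
    (hθ : θ = t / (r * σ)) (hθ1 : |θ| ≤ 1) (ht : |t| ^ 3 ≤ K * r)
    (hΛ : |Λ - (σ ^ 2 * θ ^ 2 / 2 + κ * θ ^ 3 / 6)| ≤ C * |θ| ^ 4) :
    |r ^ 2 * Λ - θ * (r * σ * t + κ / (6 * σ ^ 2) * t ^ 2 + a) - (-t ^ 2 / 2 - θ * a)| ≤
      C * K / σ ^ 3 := by
  have e : r ^ 2 * Λ - θ * (r * σ * t + κ / (6 * σ ^ 2) * t ^ 2 + a) - (-t ^ 2 / 2 - θ * a) =
      r ^ 2 * (Λ - (σ ^ 2 * θ ^ 2 / 2 + κ * θ ^ 3 / 6)) := by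
    rw [hθ]; field_simp; ring
  have ha : |θ| = |t| / (r * σ) := by rw [hθ, abs_div, abs_of_pos (mul_pos hr hσ)]
  have hK : 0 ≤ K * r := le_trans (by positivity) ht
  rw [e, abs_mul, abs_of_pos (pow_pos hr 2)]
  calc _ ≤ r ^ 2 * (C * |θ| ^ 4) := by gcongr
    _ = C * (r ^ 2 * |θ| ^ 3) * |θ| := by ring
    _ ≤ C * (r ^ 2 * |θ| ^ 3) * 1 := by gcongr
    _ = C * |t| ^ 3 / (r * σ ^ 3) := by rw [ha]; field_simp
    _ ≤ C * (K * r) / (r * σ ^ 3) := by gcongr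
    _ = _ := by field_simp

lemma abs_tilt_drift_le {r σ t θ κ K C Λ μ s : ℝ} (hr : 0 < r) (hσ : 0 < σ) (hC : 0 ≤ C)
    (hθ : θ = t / (r * σ)) (ht : |t| ^ 3 ≤ K * r)
    (hΛ : |Λ - (σ ^ 2 * θ ^ 2 / 2 + κ * θ ^ 3 / 6)| ≤ C * |θ| ^ 4)
    (hμ : |μ - (σ ^ 2 * θ + κ * θ ^ 2 / 2)| ≤ C * |θ| ^ 3)
    (hs : |s ^ 2 - (σ ^ 2 + κ * θ)| ≤ C * |θ| ^ 2) :
    |r ^ 2 * Λ - r ^ 2 * (θ * μ) + r ^ 2 * (θ ^ 2 * s ^ 2 / 2) -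
      t * (κ / (6 * σ ^ 3) * t ^ 2) / r| ≤ 3 * C * K / σ ^ 4 * |t| / r := by
  set e₁ := Λ - (σ ^ 2 * θ ^ 2 / 2 + κ * θ ^ 3 / 6)
  set e₂ := μ - (σ ^ 2 * θ + κ * θ ^ 2 / 2)
  set e₃ := s ^ 2 - (σ ^ 2 + κ * θ)
  have e : r ^ 2 * Λ - r ^ 2 * (θ * μ) + r ^ 2 * (θ ^ 2 * s ^ 2 / 2) -
      t * (κ / (6 * σ ^ 3) * t ^ 2) / r = r ^ 2 * (e₁ + -(θ * e₂) + θ ^ 2 * e₃ / 2) := by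
    simp only [e₁, e₂, e₃]; rw [hθ]; field_simp; ring
  have ha : |θ| = |t| / (r * σ) := by rw [hθ, abs_div, abs_of_pos (mul_pos hr hσ)]
  have hK : 0 ≤ K * r := le_trans (by positivity) ht
  rw [e, abs_mul, abs_of_pos (pow_pos hr 2)]
  have hsum : |e₁ + -(θ * e₂) + θ ^ 2 * e₃ / 2| ≤ 3 * C * |θ| ^ 4 := by
    refine (abs_add_three _ _ _).trans ?_
    rw [abs_neg, abs_mul, abs_div, abs_mul, abs_pow, abs_two]
    calc _ ≤ C * |θ| ^ 4 + |θ| * (C * |θ| ^ 3) + |θ| ^ 2 * (C * |θ| ^ 2) / 2 := by gcongr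
      _ = 5 / 2 * (C * |θ| ^ 4) := by ring
      _ ≤ 3 * (C * |θ| ^ 4) := by gcongr; norm_num
      _ = _ := by ring
  calc _ ≤ r ^ 2 * (3 * C * |θ| ^ 4) := by gcongr
    _ = 3 * C * |t| ^ 3 * |t| / (r ^ 2 * σ ^ 4) := by rw [ha]; field_simp
    _ ≤ 3 * C * (K * r) * |t| / (r ^ 2 * σ ^ 4) := by gcongr
    _ = _ := by field_simp

lemma abs_tilt_shift_le {r σ t θ κ K C μ s a : ℝ} (hr : 0 < r) (hσ : 0 < σ) (hC : 0 ≤ C)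
    (hθ : θ = t / (r * σ)) (hθ1 : |θ| ≤ 1) (hθκ : |κ| * |θ| ≤ 2 * σ ^ 2) (ht : |t| ^ 3 ≤ K * r)
    (hμ : |μ - (σ ^ 2 * θ + κ * θ ^ 2 / 2)| ≤ C * |θ| ^ 3) (hsσ : σ / 2 ≤ s)
    (hs : |s ^ 2 - (σ ^ 2 + κ * θ)| ≤ C * |θ| ^ 2) :
    ∃ E : ℝ, |E| ≤ 2 * C * K / σ ^ 3 + 2 * (C + κ ^ 2 / (4 * σ ^ 2)) / σ * K / σ ^ 2 +
        (|κ| / (2 * σ) + 2 * (C + κ ^ 2 / (4 * σ ^ 2)) / σ) * |κ| / (6 * σ ^ 3) * K / σ ∧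
      (r * σ * t + κ / (6 * σ ^ 2) * t ^ 2 + a - r ^ 2 * μ + r ^ 2 * (θ * s ^ 2)) / (r * s) =
        t + (κ / (6 * σ ^ 3) * t ^ 2 + (a + E) / s) / r := by
  have hs0 : 0 < s := by linarith
  have ha : |θ| = |t| / (r * σ) := by rw [hθ, abs_div, abs_of_pos (mul_pos hr hσ)]
  have hK : 0 ≤ K := by
    have : 0 ≤ K * r := le_trans (by positivity) ht
    exact nonneg_of_mul_nonneg_left this hr
  set C₄ := 2 * (C + κ ^ 2 / (4 * σ ^ 2)) / σ with hC₄
  have hC₄0 : 0 ≤ C₄ := by positivity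
  set e₂ := μ - (σ ^ 2 * θ + κ * θ ^ 2 / 2) with he₂
  set e₃ := s ^ 2 - (σ ^ 2 + κ * θ) with he₃
  set w := σ + κ * θ / (2 * σ) with hw
  have hκθ : |κ * θ / (2 * σ)| ≤ |κ| / (2 * σ) * |θ| := by
    rw [abs_div, abs_mul, abs_of_pos (by positivity : 0 < 2 * σ)]
    exact le_of_eq (by ring)
  have hw0 : 0 ≤ w := by
    have h1 : |κ| / (2 * σ) * |θ| ≤ σ := by
      rw [div_mul_eq_mul_div, div_le_iff₀ (by positivity)]; linarith
    have := (abs_le.1 (hκθ.trans h1)).1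
    rw [hw]; linarith
  have he₄ : |s - w| ≤ C₄ * |θ| ^ 2 := by
    have h1 : (s - w) * (s + w) = e₃ - κ ^ 2 * θ ^ 2 / (4 * σ ^ 2) := by
      rw [he₃, hw]; field_simp; ring
    have h2 : |s - w| * (σ / 2) ≤ (C + κ ^ 2 / (4 * σ ^ 2)) * |θ| ^ 2 := by
      calc |s - w| * (σ / 2) ≤ |s - w| * |s + w| := by
            gcongr; rw [abs_of_nonneg (by linarith)]; linarith
        _ = |e₃ - κ ^ 2 * θ ^ 2 / (4 * σ ^ 2)| := by rw [← abs_mul, h1]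
        _ ≤ |e₃| + |κ ^ 2 * θ ^ 2 / (4 * σ ^ 2)| := abs_sub _ _
        _ ≤ C * |θ| ^ 2 + κ ^ 2 / (4 * σ ^ 2) * |θ| ^ 2 := by
            refine add_le_add hs (le_of_eq ?_)
            rw [abs_of_nonneg (by positivity), sq_abs]; ring
        _ = _ := by ring
    rw [hC₄]
    calc |s - w| = |s - w| * (σ / 2) * (2 / σ) := by field_simp
      _ ≤ (C + κ ^ 2 / (4 * σ ^ 2)) * |θ| ^ 2 * (2 / σ) := by gcongr
      _ = _ := by ring
  refine ⟨r ^ 2 * (θ * e₃ - e₂) + -((s - w) * (r * t)) + -((s - σ) * (κ / (6 * σ ^ 3) * t ^ 2)),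
    ?_, ?_⟩
  · have ht3 : |t| ^ 3 / r ≤ K := (div_le_iff₀ hr).2 ht
    have b1 : |r ^ 2 * (θ * e₃ - e₂)| ≤ 2 * C * K / σ ^ 3 := by
      rw [abs_mul, abs_of_pos (pow_pos hr 2)]
      calc _ ≤ r ^ 2 * (|θ| * (C * |θ| ^ 2) + C * |θ| ^ 3) := by
            gcongr
            refine (abs_sub _ _).trans (add_le_add ?_ hμ)
            rw [abs_mul]; gcongr
        _ = 2 * C * (|t| ^ 3 / r) / σ ^ 3 := by rw [ha]; field_simp; ring
        _ ≤ _ := by gcongr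
    have b2 : |(s - w) * (r * t)| ≤ C₄ * K / σ ^ 2 := by
      rw [abs_mul, abs_mul, abs_of_pos hr]
      calc _ ≤ C₄ * |θ| ^ 2 * (r * |t|) := by gcongr
        _ = C₄ * (|t| ^ 3 / r) / σ ^ 2 := by rw [ha]; field_simp
        _ ≤ _ := by gcongr
    have b3 : |(s - σ) * (κ / (6 * σ ^ 3) * t ^ 2)| ≤
        (|κ| / (2 * σ) + C₄) * |κ| / (6 * σ ^ 3) * K / σ := by
      have h1 : |s - σ| ≤ (|κ| / (2 * σ) + C₄) * |θ| := by
        have e : s - σ = (s - w) + κ * θ / (2 * σ) := by rw [hw]; ring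
        rw [e]
        have h2 : |θ| ^ 2 ≤ |θ| := by nlinarith [abs_nonneg θ]
        calc _ ≤ C₄ * |θ| ^ 2 + |κ| / (2 * σ) * |θ| := (abs_add_le _ _).trans (add_le_add he₄ hκθ)
          _ ≤ C₄ * |θ| + |κ| / (2 * σ) * |θ| := by gcongr
          _ = _ := by ring
      rw [abs_mul, abs_mul, abs_div, abs_of_pos (by positivity : 0 < 6 * σ ^ 3), abs_pow]
      calc _ ≤ (|κ| / (2 * σ) + C₄) * |θ| * (|κ| / (6 * σ ^ 3) * |t| ^ 2) := by gcongr
        _ = (|κ| / (2 * σ) + C₄) * |κ| / (6 * σ ^ 3) * (|t| ^ 3 / r) / σ := by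
            rw [ha]; field_simp
        _ ≤ _ := by gcongr
    refine (abs_add_three _ _ _).trans ?_
    rw [abs_neg, abs_neg]
    exact add_le_add (add_le_add b1 b2) b3
  · have hsne := hs0.ne'
    rw [div_eq_iff (by positivity)]
    have : (t + (κ / (6 * σ ^ 3) * t ^ 2 + (a + (r ^ 2 * (θ * e₃ - e₂) + -((s - w) * (r * t)) +
        -((s - σ) * (κ / (6 * σ ^ 3) * t ^ 2)))) / s) / r) * (r * s) = t * (r * s) +
        κ / (6 * σ ^ 3) * t ^ 2 * s + (a + (r ^ 2 * (θ * e₃ - e₂) + -((s - w) * (r * t)) +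
        -((s - σ) * (κ / (6 * σ ^ 3) * t ^ 2)))) := by
      field_simp
      ring
    rw [this, he₃, he₂, hw, hθ]
    field_simp
    ring

end

section

variable {α : Type*} [Fintype α]

theorem IsCenteredLaw.exists_tilt_regime {p ζ : α → ℝ} {σ κ B : ℝ}
    (h : IsCenteredLaw p ζ (σ ^ 2) κ B) (hB : 1 ≤ B) (hσ : 0 < σ) :
    ∃ C D : ℝ, 0 < C ∧ 0 < D ∧ ∀ K δ : ℝ, 0 < δ → ∃ N : ℕ, 0 < N ∧ ∀ n : ℕ, N ≤ n → ∀ t θ : ℝ,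
      |t| ^ 3 ≤ K * √n → θ = t / (√n * σ) → |θ| ≤ δ ∧ ∃ m μ s : ℝ, 0 < m ∧ σ / 2 ≤ s ∧
      s ≤ 2 * σ ∧ ∑ a, p a * Real.exp (θ * ζ a) = m ∧
      |Real.log m - (σ ^ 2 * θ ^ 2 / 2 + κ * θ ^ 3 / 6)| ≤ C * |θ| ^ 4 ∧
      |μ - (σ ^ 2 * θ + κ * θ ^ 2 / 2)| ≤ C * |θ| ^ 3 ∧
      |s ^ 2 - (σ ^ 2 + κ * θ)| ≤ C * |θ| ^ 2 ∧
      ∀ z, |iidCdf (fun a => p a * Real.exp (θ * ζ a) / m) ζ n z -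
        gcdf 1 ((z - n * μ) / (√n * s))| ≤ D / √n := by
  have hV : 0 < σ ^ 2 := pow_pos hσ 2
  obtain ⟨C, θ₀, hC, hθ₀, hT⟩ := h.exists_tilt_bounds hB hV
  obtain ⟨D, hD, hBE⟩ := exists_berryEsseen_of_variance (α := α) B (half_pos hV)
  refine ⟨C, D, hC, hD, fun K δ hδ => ?_⟩
  have hc : 0 < min δ θ₀ * σ := by positivity
  have hsq : Tendsto (fun n : ℕ => √(n : ℝ)) atTop atTop :=
    Real.tendsto_sqrt_atTop.comp tendsto_natCast_atTop_atTop
  obtain ⟨N, hN⟩ := eventually_atTop.1 ((eventually_ge_atTop 1).and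
    ((hsq.eventually_ge_atTop (K ^ 2 / (min δ θ₀ * σ) ^ 3)).and
    (hsq.eventually_ge_atTop (1 / (min δ θ₀ * σ)))))
  refine ⟨max N 1, by positivity, fun n hn t θ ht hθ => ?_⟩
  obtain ⟨hn1, hK, h1⟩ := hN n (le_of_max_le_left hn)
  have hn0 : 0 < n := hn1
  have hr : 0 < √(n : ℝ) := Real.sqrt_pos.2 (by positivity)
  have hle : |θ| ≤ min δ θ₀ := by
    rw [hθ, abs_div, abs_of_pos (mul_pos hr hσ), div_le_iff₀ (mul_pos hr hσ)]
    refine (abs_le_mul_of_sq_le (sq_le_mul_of_cube_le hc ht hK hr) ?_).trans (le_of_eq (by ring))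
    rwa [div_le_iff₀' hc] at h1
  obtain ⟨m, μ, s, hm, hs, hmd, hμd, hsd, hμB, hs1, hs2, b1, b2, b3⟩ := hT θ (le_min_iff.1 hle).2
  refine ⟨(le_min_iff.1 hle).1, m, μ, s, hm, ?_, ?_, hmd, b1, b2, b3, ?_⟩
  · nlinarith
  · nlinarith
  · refine hBE _ ζ μ s (fun a => ?_) ?_ h.bound hμB hμd hs hsd hs1 n hn0
    · exact div_nonneg (mul_nonneg (h.nonneg a) (Real.exp_pos _).le) hm.le
    · rw [← Finset.sum_div, hmd, div_self hm.ne']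

/-- Tails of sums of centered bounded letters, compared with the tilted Gaussian tail. -/
theorem IsCenteredLaw.exists_tail_comparison {p ζ : α → ℝ} {σ κ B : ℝ}
    (h : IsCenteredLaw p ζ (σ ^ 2) κ B) (hB : 1 ≤ B) (hσ : 0 < σ) {K : ℝ} (hK : 0 ≤ K) :
    ∃ C : ℝ, 0 < C ∧ ∀ A : ℝ, 0 ≤ A → ∃ N : ℕ, 0 < N ∧ ∀ n : ℕ, N ≤ n → ∀ t a : ℝ, 0 ≤ t →
      t ^ 3 ≤ K * √n → |a| ≤ A → ∃ L E s : ℝ, σ / 2 ≤ s ∧ s ≤ 2 * σ ∧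
      |L - t * (κ / (6 * σ ^ 3) * t ^ 2) / √n| ≤ C * t / √n ∧ |E| ≤ C ∧
      |iidExp p ζ n (fun x => if √n * σ * t + κ / (6 * σ ^ 2) * t ^ 2 + a < x then 1 else 0) -
        Real.exp L * gaussQ (t + (κ / (6 * σ ^ 3) * t ^ 2 + (a + E) / s) / √n)| ≤
        C * gphi t / √n := by
  obtain ⟨C, D, hC, hD, hreg⟩ := h.exists_tilt_regime hB hσ
  set CE := 2 * C * K / σ ^ 3 + 2 * (C + κ ^ 2 / (4 * σ ^ 2)) / σ * K / σ ^ 2 +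
        (|κ| / (2 * σ) + 2 * (C + κ ^ 2 / (4 * σ ^ 2)) / σ) * |κ| / (6 * σ ^ 3) * K / σ with hCE
  have hCE0 : 0 ≤ CE := by positivity
  set CL := 3 * C * K / σ ^ 4 with hCL
  have hCL0 : 0 ≤ CL := by positivity
  set CT := 2 * D * Real.exp (1 + C * K / σ ^ 3) * √(2 * Real.pi) with hCT
  have hCT0 : 0 < CT := by positivity
  refine ⟨CE + CL + CT, by positivity, fun A hA => ?_⟩
  set δ := min 1 (min (2 * σ ^ 2 / (|κ| + 1)) (1 / (A + 1))) with hδ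
  have hδ0 : 0 < δ := by positivity
  obtain ⟨N, hN0, hN⟩ := hreg K δ hδ0
  refine ⟨N, hN0, fun n hn t a ht ht3 ha => ?_⟩
  have hn0 : 0 < n := hN0.trans_le hn
  set r := √(n : ℝ) with hr
  have hr0 : 0 < r := Real.sqrt_pos.2 (by positivity)
  have hr2 : r ^ 2 = n := Real.sq_sqrt (by positivity)
  have ht3' : |t| ^ 3 ≤ K * r := by rwa [abs_of_nonneg ht]
  obtain ⟨hθ, m, μ, s, hm, hs1, hs2, hmd, b1, b2, b3, hBE⟩ := hN n hn t (t / (r * σ)) ht3' rfl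
  set θ := t / (r * σ) with hθd
  have hθ0 : 0 ≤ θ := by positivity
  have hs0 : 0 < s := by linarith
  have hθ1 : |θ| ≤ 1 := hθ.trans (min_le_left _ _)
  have hθκ : |κ| * |θ| ≤ 2 * σ ^ 2 := by
    have : |θ| ≤ 2 * σ ^ 2 / (|κ| + 1) := hθ.trans ((min_le_right _ _).trans (min_le_left _ _))
    rw [le_div_iff₀ (by positivity)] at this
    nlinarith [abs_nonneg θ]
  have hθa : -(θ * a) ≤ 1 := by
    have : |θ| ≤ 1 / (A + 1) := hθ.trans ((min_le_right _ _).trans (min_le_right _ _))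
    rw [le_div_iff₀ (by positivity), abs_of_nonneg hθ0] at this
    nlinarith [neg_abs_le a]
  have htail := abs_tail_sub_le h.nonneg hm hθ0 hmd hs0 hn0 hBE
    (r * σ * t + κ / (6 * σ ^ 2) * t ^ 2 + a)
  obtain ⟨E, hE, hEeq⟩ := abs_tilt_shift_le (a := a) hr0 hσ hC.le hθd hθ1 hθκ ht3' b2 hs1 b3
  have hL := abs_tilt_drift_le hr0 hσ hC.le hθd ht3' b1 b2 b3
  have hX := abs_tilt_exponent_le (a := a) hr0 hσ hC.le hθd hθ1 ht3' b1
  rw [hr2] at hEeq hL hX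
  rw [hEeq] at htail
  refine ⟨_, E, s, hs1, hs2, ?_, ?_, htail.trans ?_⟩
  · refine hL.trans ?_
    rw [abs_of_nonneg ht]
    gcongr
    linarith
  · linarith
  · have h1 : n * Real.log m - θ * (r * σ * t + κ / (6 * σ ^ 2) * t ^ 2 + a) ≤
        -t ^ 2 / 2 + (1 + C * K / σ ^ 3) := by
      have := (abs_le.1 hX).2
      linarith
    calc 2 * (D / r) * Real.exp (n * Real.log m - θ * (r * σ * t + κ / (6 * σ ^ 2) * t ^ 2 + a))
        ≤ 2 * (D / r) * Real.exp (-t ^ 2 / 2 + (1 + C * K / σ ^ 3)) := by gcongr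
      _ = CT * gphi t / r := by
          have : √(2 * Real.pi) ≠ 0 := by positivity
          rw [Real.exp_add, hCT, gphi]; field_simp
      _ ≤ _ := by
          have := (gphi_pos t).le
          gcongr
          linarith

end

section

lemma exists_cube_regime (K : ℝ) {c : ℝ} (hc : 0 < c) : ∃ N : ℕ, 0 < N ∧ ∀ n : ℕ, N ≤ n →
    1 ≤ c * √n ∧ ∀ t : ℝ, |t| ^ 3 ≤ K * √n → t ^ 2 ≤ c * √n ∧ |t| ≤ c * √n := by
  have hsq : Tendsto (fun n : ℕ => √(n : ℝ)) atTop atTop :=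
    Real.tendsto_sqrt_atTop.comp tendsto_natCast_atTop_atTop
  obtain ⟨N, hN⟩ := eventually_atTop.1 ((hsq.eventually_ge_atTop (K ^ 2 / c ^ 3)).and
    (hsq.eventually_ge_atTop (1 / c)))
  refine ⟨max N 1, by positivity, fun n hn => ?_⟩
  obtain ⟨hK, h1⟩ := hN n (le_of_max_le_left hn)
  have hn0 : 0 < n := (le_of_max_le_right hn : 1 ≤ n)
  have hr : 0 < √(n : ℝ) := Real.sqrt_pos.2 (by positivity)
  have h1' : 1 ≤ c * √n := by rwa [div_le_iff₀' hc] at h1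
  refine ⟨h1', fun t ht => ?_⟩
  have h2 := sq_le_mul_of_cube_le hc ht hK hr
  exact ⟨h2, abs_le_mul_of_sq_le h2 h1'⟩

lemma exp_neg_le_one_sub_half {x : ℝ} (h0 : 0 ≤ x) (h1 : x ≤ 1) : Real.exp (-x) ≤ 1 - x / 2 := by
  rw [Real.exp_neg]
  refine (inv_anti₀ (by positivity) (Real.add_one_le_exp x)).trans ?_
  rw [inv_le_iff_one_le_mul₀ (by positivity)]
  nlinarith

variable {α : Type*} [Fintype α]

set_option maxHeartbeats 1000000 in
theorem IsCenteredLaw.exists_tail_le {p ζ : α → ℝ} {σ κ B : ℝ}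
    (h : IsCenteredLaw p ζ (σ ^ 2) κ B) (hB : 1 ≤ B) (hσ : 0 < σ) {K H : ℝ} (hK : 0 ≤ K)
    (hH : 0 ≤ H) :
    ∃ A : ℝ, 0 ≤ A ∧ ∃ N : ℕ, 0 < N ∧ ∀ n : ℕ, N ≤ n → ∀ t : ℝ, 0 ≤ t → t ^ 3 ≤ K * √n →
      iidExp p ζ n (fun x => if √n * σ * t + κ / (6 * σ ^ 2) * t ^ 2 + A < x then 1 else 0) ≤
        gaussQ t - H * gphi t / √n := by
  obtain ⟨C, hC, hcomp⟩ := h.exists_tail_comparison hB hσ hK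
  obtain ⟨c, C₁, hc, hC₁, hgh⟩ := exists_ghaz_bounds
  obtain ⟨k, hk⟩ : ∃ v, v = |κ / (6 * σ ^ 3)| := ⟨_, rfl⟩
  have hk0 : 0 ≤ k := hk ▸ abs_nonneg _
  obtain ⟨C₅, hC₅⟩ : ∃ v, v = C₁ * k + C := ⟨_, rfl⟩
  obtain ⟨y, hy⟩ : ∃ v, v = 2 * (H + C) := ⟨_, rfl⟩
  have hC₅0 : 0 < C₅ := by rw [hC₅]; positivity
  have hy0 : 0 < y := by rw [hy]; positivity
  obtain ⟨A, hA⟩ : ∃ v, v = C + 2 * σ * (C₅ / c + y) := ⟨_, rfl⟩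
  have hA0 : 0 ≤ A := by rw [hA]; positivity
  obtain ⟨N₁, hN₁0, hN₁⟩ := hcomp A hA0
  obtain ⟨N₂, -, hN₂⟩ := exists_cube_regime K (c := 1 / (2 * C₁ * y)) (by positivity)
  refine ⟨A, hA0, max N₁ N₂, by positivity, fun n hn t ht ht3 => ?_⟩
  have hn1 := le_of_max_le_left hn
  obtain ⟨hr1, hreg⟩ := hN₂ n (le_of_max_le_right hn)
  obtain ⟨L, E, s, hs1, hs2, hL, hE, hT⟩ := hN₁ n hn1 t A ht ht3 (abs_of_nonneg hA0).le
  have hn0 : 0 < n := hN₁0.trans_le hn1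
  set r := √(n : ℝ) with hr
  have hr0 : 0 < r := Real.sqrt_pos.2 (by positivity)
  have ht1 : t ≤ 1 / (2 * C₁ * y) * r := by
    have := (hreg t (by rwa [abs_of_nonneg ht])).2
    rwa [abs_of_nonneg ht] at this
  have hs0 : 0 < s := by linarith
  obtain ⟨g1, g2, g3⟩ := hgh t (by linarith)
  obtain ⟨ρ, hρ⟩ : ∃ v, v = ghaz t := ⟨_, rfl⟩
  have hρ0 : 0 < ρ := hρ ▸ ghaz_pos t
  rw [← hρ] at g1 g2 g3
  obtain ⟨b, hb⟩ : ∃ v, v = κ / (6 * σ ^ 3) * t ^ 2 := ⟨_, rfl⟩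
  rw [← hb] at hL hT
  have hbk : |b| ≤ k * t ^ 2 := by rw [hb, hk, abs_mul, abs_of_nonneg (sq_nonneg t)]
  have hEh : C₅ / c + y ≤ (A + E) / s := by
    rw [le_div_iff₀ hs0]
    have h1 : 0 ≤ C₅ / c + y := by positivity
    nlinarith [(abs_le.1 hE).1]
  have hexp : L - ρ * ((b + (A + E) / s) / r) ≤ -(ρ * y / r) := by
    have e1 : L ≤ (t * b + C * t) / r := by
      have := (abs_le.1 hL).2
      rw [add_div]; linarith
    have e2 : (t - ρ) * b ≤ C₁ * k * (1 + t) := by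
      calc (t - ρ) * b ≤ |(t - ρ) * b| := le_abs_self _
        _ = |ρ - t| * |b| := by rw [abs_mul, abs_sub_comm]
        _ ≤ C₁ / (1 + t) * (k * t ^ 2) := by gcongr
        _ ≤ C₁ * k * (1 + t) := by
          rw [div_mul_eq_mul_div, div_le_iff₀ (by positivity)]
          have : t ^ 2 ≤ (1 + t) * (1 + t) := by nlinarith
          have := mul_le_mul_of_nonneg_left this (by positivity : 0 ≤ C₁ * k)
          linarith
    have e3 : C₁ * k * (1 + t) + C * (1 + t) ≤ ρ * (C₅ / c) := by
      have hC5 : 0 ≤ C₅ / c := by positivity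
      calc C₁ * k * (1 + t) + C * (1 + t) = C₅ * (1 + t) := by rw [hC₅]; ring
        _ = c * (1 + t) * (C₅ / c) := by field_simp
        _ ≤ _ := by gcongr
    have e4 := mul_le_mul_of_nonneg_left hEh hρ0.le
    calc L - ρ * ((b + (A + E) / s) / r) ≤
        (t * b + C * t) / r - ρ * ((b + (A + E) / s) / r) := by linarith
      _ = (t * b + C * t - ρ * b - ρ * ((A + E) / s)) / r := by ring
      _ ≤ (-(ρ * y)) / r := by
          gcongr
          linarith
      _ = _ := by ring
  have hx1 : ρ * y / r ≤ 1 := by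
    rw [div_le_one hr0]
    have hCy : 0 < 2 * C₁ * y := by positivity
    rw [div_mul_eq_mul_div, one_mul] at ht1 hr1
    rw [le_div_iff₀ hCy] at ht1 hr1
    have := mul_le_mul_of_nonneg_right g2 hy0.le
    linarith
  have hQ := gaussQ_pos t
  have hmain : Real.exp L * gaussQ (t + (b + (A + E) / s) / r) ≤
      gaussQ t - y / 2 * gphi t / r := by
    calc _ ≤ Real.exp L * (gaussQ t * Real.exp (-(ρ * ((b + (A + E) / s) / r)))) := by
          gcongr; rw [hρ]; exact gaussQ_add_le _ _
      _ = gaussQ t * Real.exp (L - ρ * ((b + (A + E) / s) / r)) := by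
          rw [sub_eq_add_neg, Real.exp_add]; ring
      _ ≤ gaussQ t * Real.exp (-(ρ * y / r)) := by gcongr
      _ ≤ gaussQ t * (1 - ρ * y / r / 2) := by
          gcongr; exact exp_neg_le_one_sub_half (by positivity) hx1
      _ = gaussQ t - y / 2 * (gaussQ t * ρ) / r := by ring
      _ = _ := by rw [hρ, gaussQ_mul_ghaz]
  have := (abs_le.1 hT).2
  have e : y / 2 * gphi t / r = H * gphi t / r + C * gphi t / r := by rw [hy]; ring
  linarith

set_option maxHeartbeats 1000000 in
theorem IsCenteredLaw.exists_le_tail {p ζ : α → ℝ} {σ κ B : ℝ}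
    (h : IsCenteredLaw p ζ (σ ^ 2) κ B) (hB : 1 ≤ B) (hσ : 0 < σ) {K H : ℝ} (hK : 0 ≤ K)
    (hH : 0 ≤ H) :
    ∃ A : ℝ, 0 ≤ A ∧ ∃ N : ℕ, 0 < N ∧ ∀ n : ℕ, N ≤ n → ∀ t : ℝ, 0 ≤ t → t ^ 3 ≤ K * √n →
      gaussQ t + H * gphi t / √n ≤
      iidExp p ζ n (fun x => if √n * σ * t + κ / (6 * σ ^ 2) * t ^ 2 - A < x then 1 else 0) := by
  obtain ⟨C, hC, hcomp⟩ := h.exists_tail_comparison hB hσ hK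
  obtain ⟨c, C₁, hc, hC₁, hgh⟩ := exists_ghaz_bounds
  obtain ⟨k, hk⟩ : ∃ v, v = |κ / (6 * σ ^ 3)| := ⟨_, rfl⟩
  have hk0 : 0 ≤ k := hk ▸ abs_nonneg _
  obtain ⟨C₅, hC₅⟩ : ∃ v, v = k * (k * K + 1 + 2 * C₁) + C := ⟨_, rfl⟩
  obtain ⟨y, hy⟩ : ∃ v, v = C₁ * (H + C) := ⟨_, rfl⟩
  have hC₅0 : 0 < C₅ := by rw [hC₅]; positivity
  have hy0 : 0 < y := by rw [hy]; positivity
  obtain ⟨A, hA⟩ : ∃ v, v = C + 2 * σ * (2 * (C₅ + y) / c) := ⟨_, rfl⟩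
  have hA0 : 0 ≤ A := by rw [hA]; positivity
  obtain ⟨h₁, hh₁⟩ : ∃ v, v = (A + C) / (σ / 2) := ⟨_, rfl⟩
  have hh₁0 : 0 < h₁ := by rw [hh₁]; positivity
  obtain ⟨N₁, hN₁0, hN₁⟩ := hcomp A hA0
  obtain ⟨N₂, -, hN₂⟩ := exists_cube_regime K (c := 1 / (4 * (k + h₁ + 1))) (by positivity)
  refine ⟨A, hA0, max N₁ N₂, by positivity, fun n hn t ht ht3 => ?_⟩
  have hn1 := le_of_max_le_left hn
  obtain ⟨hr1, hreg⟩ := hN₂ n (le_of_max_le_right hn)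
  obtain ⟨L, E, s, hs1, hs2, hL, hE, hT⟩ := hN₁ n hn1 t (-A) ht ht3
    (by rw [abs_neg, abs_of_nonneg hA0])
  have hn0 : 0 < n := hN₁0.trans_le hn1
  set r := √(n : ℝ) with hr
  have hr0 : 0 < r := Real.sqrt_pos.2 (by positivity)
  obtain ⟨ht2, ht1⟩ := hreg t (by rwa [abs_of_nonneg ht])
  rw [abs_of_nonneg ht] at ht1
  rw [div_mul_eq_mul_div, one_mul, le_div_iff₀ (by positivity)] at ht1 ht2 hr1
  have hs0 : 0 < s := by linarith
  obtain ⟨b, hb⟩ : ∃ v, v = κ / (6 * σ ^ 3) * t ^ 2 := ⟨_, rfl⟩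
  rw [← hb] at hL hT
  have hbk : |b| ≤ k * t ^ 2 := by rw [hb, hk, abs_mul, abs_of_nonneg (sq_nonneg t)]
  obtain ⟨hh, hhh⟩ : ∃ v, v = (-A + E) / s := ⟨_, rfl⟩
  rw [← hhh] at hT
  have hhle : hh ≤ -(2 * (C₅ + y) / c) := by
    rw [hhh, div_le_iff₀ hs0]
    have h1 : 0 ≤ 2 * (C₅ + y) / c := by positivity
    nlinarith [(abs_le.1 hE).2]
  have hhabs : |hh| ≤ h₁ := by
    rw [hhh, hh₁, abs_div, abs_of_pos hs0]
    refine div_le_div₀ (by positivity) ?_ (by positivity) hs1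
    refine (abs_add_le _ _).trans ?_
    rw [abs_neg, abs_of_nonneg hA0]
    linarith
  obtain ⟨d, hd⟩ : ∃ v, v = (b + hh) / r := ⟨_, rfl⟩
  rw [← hd] at hT
  have hdle : |d| ≤ (k * t ^ 2 + h₁) / r := by
    rw [hd, abs_div, abs_of_pos hr0]
    gcongr
    exact (abs_add_le _ _).trans (add_le_add hbk hhabs)
  have hd12 : |d| ≤ 1 / 2 := by
    refine hdle.trans ?_
    rw [div_le_iff₀ hr0]
    nlinarith [sq_nonneg t]
  have ht2d : t ^ 2 * |d| ≤ (k * K + 1) * t := by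
    have h1 : h₁ * t ≤ r := by nlinarith
    calc t ^ 2 * |d| ≤ t ^ 2 * ((k * t ^ 2 + h₁) / r) := by gcongr
      _ = t * (k * t ^ 3 + h₁ * t) / r := by ring
      _ ≤ t * (k * (K * r) + r) / r := by gcongr
      _ = _ := by field_simp
  have hq : t - 1 / 2 ≤ t + d := by linarith [(abs_le.1 hd12).1]
  obtain ⟨g1, g2, g3⟩ := hgh (t + d) (by linarith)
  obtain ⟨-, gt2, -⟩ := hgh t (by linarith)
  obtain ⟨ρ, hρ⟩ : ∃ v, v = ghaz (t + d) := ⟨_, rfl⟩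
  have hρ0 : 0 < ρ := hρ ▸ ghaz_pos _
  rw [← hρ] at g1 g2 g3
  have hexp : (1 + t) * y / r ≤ L - ρ * d := by
    have e1 : (t * b - C * t) / r ≤ L := by
      have := (abs_le.1 hL).1
      rw [sub_div]; linarith
    have e2 : -(k * (k * K + 1 + 2 * C₁) * (1 + t)) ≤ (t - ρ) * b := by
      have e : |(t - ρ) * b| ≤ k * (k * K + 1 + 2 * C₁) * (1 + t) := by
        have h1 : |t - ρ| ≤ |d| + 2 * C₁ / (1 + t) := by
          calc |t - ρ| = |(ρ - (t + d)) + d| := by rw [abs_sub_comm]; congr 1; ring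
            _ ≤ |ρ - (t + d)| + |d| := abs_add_le _ _
            _ ≤ 2 * C₁ / (1 + t) + |d| := by
                gcongr
                refine g3.trans ?_
                rw [div_le_div_iff₀ (by linarith) (by linarith)]
                nlinarith
            _ = _ := add_comm _ _
        calc |(t - ρ) * b| = |t - ρ| * |b| := abs_mul _ _
          _ ≤ (|d| + 2 * C₁ / (1 + t)) * (k * t ^ 2) := by gcongr
          _ = k * (t ^ 2 * |d| + 2 * C₁ * (t ^ 2 / (1 + t))) := by ring
          _ ≤ k * ((k * K + 1) * t + 2 * C₁ * (1 + t)) := by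
              gcongr
              rw [div_le_iff₀ (by positivity)]; nlinarith
          _ ≤ _ := by
              have : 0 ≤ k * (k * K + 1) := by positivity
              nlinarith
      exact (abs_le.1 e).1
    have e3 : k * (k * K + 1 + 2 * C₁) * (1 + t) + C * (1 + t) + (1 + t) * y ≤
        ρ * (2 * (C₅ + y) / c) := by
      have hC5 : 0 ≤ 2 * (C₅ + y) / c := by positivity
      calc k * (k * K + 1 + 2 * C₁) * (1 + t) + C * (1 + t) + (1 + t) * y =
            (C₅ + y) * (1 + t) := by rw [hC₅]; ring
        _ = c * ((1 + t) / 2) * (2 * (C₅ + y) / c) := by field_simp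
        _ ≤ c * (1 + (t + d)) * (2 * (C₅ + y) / c) := by gcongr; linarith
        _ ≤ _ := by gcongr
    have e4 := mul_le_mul_of_nonneg_left hhle hρ0.le
    calc (1 + t) * y / r ≤ (t * b - C * t - ρ * b - ρ * hh) / r := by
          gcongr
          linarith
      _ = (t * b - C * t) / r - ρ * d := by rw [hd]; ring
      _ ≤ _ := by linarith
  have hQ := gaussQ_pos t
  have hφ : gphi t ≤ gaussQ t * (C₁ * (1 + t)) := by
    rw [← gaussQ_mul_ghaz]; gcongr
  have hmain : gaussQ t + (H + C) * gphi t / r ≤ Real.exp L * gaussQ (t + d) := by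
    calc gaussQ t + (H + C) * gphi t / r
        ≤ gaussQ t + (H + C) * (gaussQ t * (C₁ * (1 + t))) / r := by gcongr
      _ = gaussQ t * ((1 + t) * y / r + 1) := by rw [hy]; ring
      _ ≤ gaussQ t * Real.exp (L - ρ * d) := by
          gcongr; exact (add_le_add_left hexp 1).trans (Real.add_one_le_exp _)
      _ = Real.exp L * (gaussQ t * Real.exp (-(ρ * d))) := by
          rw [sub_eq_add_neg, Real.exp_add]; ring
      _ ≤ _ := by
          gcongr; rw [hρ]; exact gaussQ_mul_exp_le _ _
  have := (abs_le.1 hT).1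
  rw [← sub_eq_add_neg] at this
  have e : (H + C) * gphi t / r = H * gphi t / r + C * gphi t / r := by ring
  linarith

end

section

variable {α : Type*} [Fintype α]

lemma IsCenteredLaw.neg {p ζ : α → ℝ} {V κ B : ℝ} (h : IsCenteredLaw p ζ V κ B) :
    IsCenteredLaw p (fun a => -ζ a) V (-κ) B where
  nonneg := h.nonneg
  sum_one := h.sum_one
  mean := by simp [h.mean]
  var := by simp [h.var]
  third := by
    rw [← h.third, ← Finset.sum_neg_distrib]
    exact Finset.sum_congr rfl fun a _ => by ring
  bound := fun a => by rw [abs_neg]; exact h.bound a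

lemma iidExp_neg (p ζ : α → ℝ) (n : ℕ) (f : ℝ → ℝ) :
    iidExp p (fun a => -ζ a) n f = iidExp p ζ n fun s => f (-s) := by
  simpa using iidExp_affine (p := p) (ζ := ζ) (n := n) (-1) 0 f

lemma iidExp_add_complement {p : α → ℝ} (hp1 : ∑ a, p a = 1) (ζ : α → ℝ) (n : ℕ) (f : ℝ → ℝ) :
    iidExp p ζ n (fun s => 1 - f s) = 1 - iidExp p ζ n f := by
  rw [iidExp_sub, iidExp_const hp1]

/-- Edgeworth-type location of the upper tail of a sum of centered bounded letters, at the scale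
`φ(t) / √n`, throughout the moderate range `|t| = O(n^{1/6})`. -/
theorem IsCenteredLaw.exists_tail_bounds {p ζ : α → ℝ} {σ κ B : ℝ}
    (h : IsCenteredLaw p ζ (σ ^ 2) κ B) (hB : 1 ≤ B) (hσ : 0 < σ) {K H : ℝ} (hK : 0 ≤ K)
    (hH : 0 ≤ H) :
    ∃ A : ℝ, 0 ≤ A ∧ ∃ N : ℕ, 0 < N ∧ ∀ n : ℕ, N ≤ n → ∀ t : ℝ, |t| ^ 3 ≤ K * √n →
      iidExp p ζ n (fun x => if √n * σ * t + κ / (6 * σ ^ 2) * t ^ 2 + A < x then 1 else 0) ≤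
        gaussQ t - H * gphi t / √n ∧
      gaussQ t + H * gphi t / √n ≤
      iidExp p ζ n (fun x => if √n * σ * t + κ / (6 * σ ^ 2) * t ^ 2 - A < x then 1 else 0) := by
  obtain ⟨A₁, hA₁, N₁, hN₁0, h₁⟩ := h.exists_tail_le hB hσ hK hH
  obtain ⟨A₂, hA₂, N₂, -, h₂⟩ := h.exists_le_tail hB hσ hK hH
  obtain ⟨A₃, hA₃, N₃, -, h₃⟩ := h.neg.exists_tail_le hB hσ hK hH
  obtain ⟨A₄, hA₄, N₄, -, h₄⟩ := h.neg.exists_le_tail hB hσ hK hH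
  refine ⟨A₁ + A₂ + A₃ + A₄ + 1, by positivity, N₁ + N₂ + N₃ + N₄, by positivity,
    fun n hn t ht => ?_⟩
  rcases le_total 0 t with h0 | h0
  · rw [abs_of_nonneg h0] at ht
    refine ⟨(iidExp_mono h.nonneg fun s => ?_).trans (h₁ n (by omega) t h0 ht),
      (h₂ n (by omega) t h0 ht).trans (iidExp_mono h.nonneg fun s => ?_)⟩ <;>
    · split_ifs <;> first | (exfalso; linarith) | norm_num
  · rw [abs_of_nonpos h0] at ht
    have h3 := h₃ n (by omega) (-t) (by linarith) ht
    have h4 := h₄ n (by omega) (-t) (by linarith) ht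
    rw [iidExp_neg, gaussQ_neg, gphi_neg] at h3 h4
    constructor
    · have : iidExp p ζ n (fun x => if √n * σ * t + κ / (6 * σ ^ 2) * t ^ 2 +
          (A₁ + A₂ + A₃ + A₄ + 1) < x then 1 else 0) ≤ _ :=
        (iidExp_mono h.nonneg fun s => ?_).trans
          (iidExp_add_complement h.sum_one ζ n fun s => if √n * σ * -t + -κ / (6 * σ ^ 2) *
            (-t) ^ 2 - A₄ < -s then 1 else 0).le
      · linarith
      · have e : -κ / (6 * σ ^ 2) * (-t) ^ 2 = -(κ / (6 * σ ^ 2) * t ^ 2) := by ring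
        rw [e]
        split_ifs <;> first | (exfalso; linarith) | norm_num
    · have : _ ≤ iidExp p ζ n (fun x => if √n * σ * t + κ / (6 * σ ^ 2) * t ^ 2 -
          (A₁ + A₂ + A₃ + A₄ + 1) < x then 1 else 0) :=
        (iidExp_add_complement h.sum_one ζ n fun s => if √n * σ * -t + -κ / (6 * σ ^ 2) *
            (-t) ^ 2 + A₃ < -s then 1 else 0).ge.trans (iidExp_mono h.nonneg fun s => ?_)
      · linarith
      · have e : -κ / (6 * σ ^ 2) * (-t) ^ 2 = -(κ / (6 * σ ^ 2) * t ^ 2) := by ring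
        rw [e]
        split_ifs <;> first | (exfalso; linarith) | norm_num

end

section

open scoped NNReal
open ProbabilityTheory

lemma integral_dampedTail_gaussianReal_le {θ : ℝ} (hθ : 0 < θ) (z m : ℝ) {s : ℝ} (hs : 0 < s) :
    ∫ x, dampedTail θ z x ∂(gaussianReal m (.mk (s ^ 2) (sq_nonneg s))) ≤ 1 / (s * θ) := by
  set v : ℝ≥0 := .mk (s ^ 2) (sq_nonneg s) with hv
  have hvs : (v : ℝ) = s ^ 2 := rfl
  have hv0 : v ≠ 0 := by
    intro h; rw [h] at hvs; exact (pow_pos hs 2).ne hvs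
  have hpdf : ∀ x, gaussianPDFReal m v x ≤ 1 / s := fun x => by
    have h := gaussianPDFReal_le hv0 (x - m)
    rw [hvs, Real.sqrt_sq hs.le] at h
    simpa [gaussianPDFReal] using h
  have hdamp : dampedTail θ z =
      (Set.Ioi z).indicator fun x => Real.exp (θ * z) * Real.exp (-θ * x) := by
    ext x
    by_cases h : z < x
    · rw [Set.indicator_of_mem (by exact h), dampedTail, if_pos h, ← Real.exp_add]
      congr 1; ring
    · rw [Set.indicator_of_notMem (by exact h), dampedTail, if_neg h]
  have hint : Integrable (dampedTail θ z) := by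
    have h : IntegrableOn (fun x => Real.exp (θ * z) * Real.exp (-θ * x)) (Set.Ioi z) :=
      (integrableOn_exp_mul_Ioi (neg_lt_zero.2 hθ) z).const_mul _
    rw [hdamp]
    exact h.integrable_indicator measurableSet_Ioi
  rw [integral_gaussianReal_eq_integral_smul hv0]
  calc ∫ x, gaussianPDFReal m v x • dampedTail θ z x ≤ ∫ x, 1 / s * dampedTail θ z x := by
        refine integral_mono_of_nonneg (ae_of_all _ fun x => ?_) (hint.const_mul _)
          (ae_of_all _ fun x => ?_)
        · exact mul_nonneg (gaussianPDFReal_nonneg _ _ _) (dampedTail_nonneg _ _ _)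
        · exact mul_le_mul_of_nonneg_right (hpdf x) (dampedTail_nonneg _ _ _)
    _ = 1 / (s * θ) := by
        rw [integral_const_mul, hdamp, integral_indicator measurableSet_Ioi, integral_const_mul,
          integral_exp_mul_Ioi (neg_lt_zero.2 hθ), neg_div_neg_eq, mul_div_assoc', ← Real.exp_add]
        have : θ * z + -θ * z = 0 := by ring
        rw [this, Real.exp_zero]
        field_simp

section

variable {α : Type*} [Fintype α]

lemma iidExp_exp_upper_le {q ζ : α → ℝ} {ρ μ s D : ℝ} (hq : ∀ a, 0 ≤ q a)
    (hq1 : ∑ a, q a = 1) (hρ : 0 < ρ) (hs : 0 < s) {n : ℕ} (hn : 0 < n)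
    (hD : ∀ z, |iidCdf q ζ n z - gcdf 1 ((z - n * μ) / (√n * s))| ≤ D / √n) (z : ℝ) :
    iidExp q ζ n (fun x => if z ≤ x then Real.exp (-(ρ * x)) else 0) ≤
      Real.exp ρ * (2 * D + 1 / (s * ρ)) / √n * Real.exp (-(ρ * z)) := by
  have hn0 : (0 : ℝ) < n := by exact_mod_cast hn
  have hr : 0 < √(n : ℝ) := Real.sqrt_pos.2 hn0
  have h1 := (abs_le.1 (abs_iidExp_dampedTail_sub_le hq hq1 hρ.le hs hn hD (z - 1))).2
  have h2 := integral_dampedTail_gaussianReal_le hρ (z - 1) (n * μ) (mul_pos hr hs)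
  have h3 : iidExp q ζ n (dampedTail ρ (z - 1)) ≤ (2 * D + 1 / (s * ρ)) / √n := by
    have e : (2 * D + 1 / (s * ρ)) / √n = 2 * (D / √n) + 1 / (√n * s * ρ) := by
      field_simp
    linarith
  calc _ ≤ iidExp q ζ n (fun x => Real.exp (ρ - ρ * z) * dampedTail ρ (z - 1) x) := by
        refine iidExp_mono hq fun x => ?_
        split_ifs with h
        · rw [dampedTail, if_pos (by linarith), ← Real.exp_add]
          exact le_of_eq (by congr 1; ring)
        · exact mul_nonneg (Real.exp_pos _).le (dampedTail_nonneg _ _ _)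
    _ = Real.exp (ρ - ρ * z) * iidExp q ζ n (dampedTail ρ (z - 1)) := iidExp_const_mul _ _
    _ ≤ Real.exp (ρ - ρ * z) * ((2 * D + 1 / (s * ρ)) / √n) := by gcongr
    _ = _ := by rw [sub_eq_add_neg, Real.exp_add]; ring

lemma iidExp_exp_upper_tilt {p ζ : α → ℝ} {m θ : ℝ} (hm : 0 < m) (n : ℕ) (c z : ℝ) :
    iidExp p ζ n (fun x => if z ≤ x then Real.exp (-(c * x)) else 0) =
      m ^ n * iidExp (fun a => p a * Real.exp (θ * ζ a) / m) ζ n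
        (fun x => if z ≤ x then Real.exp (-((c + θ) * x)) else 0) := by
  rw [iidExp_tilt hm.ne' (θ := θ)]
  congr 1
  refine iidExp_congr fun x => ?_
  split_ifs
  · rw [← Real.exp_add]; congr 1; ring
  · simp

/-- The average pairwise confusion of two independent draws, one sharply damped and the other
restricted to the bulk, has order `φ(t)² / n`. -/
theorem IsCenteredLaw.exists_double_tail_le {p ζ : α → ℝ} {σ κ B : ℝ}
    (h : IsCenteredLaw p ζ (σ ^ 2) κ B) (hB : 1 ≤ B) (hσ : 0 < σ) (K : ℝ) :
    ∃ C : ℝ, 0 < C ∧ ∀ A : ℝ, 0 ≤ A → ∃ N : ℕ, 0 < N ∧ ∀ n : ℕ, N ≤ n → ∀ t z : ℝ,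
      |t| ^ 3 ≤ K * √n → z = √n * σ * t + κ / (6 * σ ^ 2) * t ^ 2 - A →
      iidExp p ζ n (fun u => if z ≤ u then
        iidExp p ζ n (fun x => if u ≤ x then Real.exp (-x) else 0) else 0) ≤
        C * gphi t ^ 2 / n * Real.exp (-z) := by
  obtain ⟨C, D, hC, hD, hreg⟩ := h.exists_tilt_regime hB hσ
  obtain ⟨C₀, hC₀⟩ : ∃ v, v = Real.exp 2 * (2 * D + 4 / σ) := ⟨_, rfl⟩
  have hC₀0 : 0 < C₀ := by rw [hC₀]; positivity
  obtain ⟨C₁, hC₁⟩ : ∃ v, v = √(2 * Real.pi) * Real.exp (1 + C * K / σ ^ 3) := ⟨_, rfl⟩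
  have hC₁0 : 0 < C₁ := by rw [hC₁]; positivity
  refine ⟨C₀ ^ 2 * C₁ ^ 2, by positivity, fun A hA => ?_⟩
  obtain ⟨N, hN0, hN⟩ := hreg K (min (1 / 4) (1 / (A + 1))) (by positivity)
  refine ⟨N, hN0, fun n hn t z ht hz => ?_⟩
  have hn0 : 0 < n := hN0.trans_le hn
  have hn0' : (0 : ℝ) < n := by exact_mod_cast hn0
  have hr0 : 0 < √(n : ℝ) := Real.sqrt_pos.2 hn0'
  have hr2 : √(n : ℝ) ^ 2 = n := Real.sq_sqrt hn0'.le
  obtain ⟨θ, hθd⟩ : ∃ θ, θ = t / (√n * σ) := ⟨_, rfl⟩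
  obtain ⟨hθ, m, μ, s, hm, hs1, hs2, hmd, b1, b2, b3, hBE⟩ := hN n hn t θ ht hθd
  have hs0 : 0 < s := by linarith
  have hθ4 : |θ| ≤ 1 / 4 := hθ.trans (min_le_left _ _)
  have hθA : θ * A ≤ 1 := by
    have h1 : |θ| ≤ 1 / (A + 1) := hθ.trans (min_le_right _ _)
    rw [le_div_iff₀ (by positivity)] at h1
    nlinarith [le_abs_self θ, abs_nonneg θ]
  have hq0 : ∀ a, 0 ≤ p a * Real.exp (θ * ζ a) / m := fun a =>
    div_nonneg (mul_nonneg (h.nonneg a) (Real.exp_pos _).le) hm.le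
  have hq1 : ∑ a, p a * Real.exp (θ * ζ a) / m = 1 := by
    rw [← Finset.sum_div, hmd, div_self hm.ne']
  have hX := abs_tilt_exponent_le (a := -A) hr0 hσ hC.le hθd (hθ4.trans (by norm_num)) ht b1
  rw [hr2, ← sub_eq_add_neg, ← hz] at hX
  have hθlo := (abs_le.1 hθ4).1
  have hθhi := (abs_le.1 hθ4).2
  have hup : ∀ ρ u : ℝ, 1 / 2 ≤ ρ → ρ ≤ 2 →
      iidExp (fun a => p a * Real.exp (θ * ζ a) / m) ζ n
        (fun x => if u ≤ x then Real.exp (-(ρ * x)) else 0) ≤ C₀ / √n * Real.exp (-(ρ * u)) := by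
    intro ρ u hρ1 hρ2
    refine (iidExp_exp_upper_le hq0 hq1 (by linarith) hs0 hn0 hBE u).trans ?_
    have : 1 / (s * ρ) ≤ 4 / σ := by
      rw [div_le_div_iff₀ (by positivity) hσ]
      nlinarith
    rw [hC₀]
    gcongr
  have hmn : 0 < m ^ n := pow_pos hm n
  have hinner : ∀ u : ℝ, iidExp p ζ n (fun x => if u ≤ x then Real.exp (-x) else 0) ≤
      m ^ n * (C₀ / √n * Real.exp (-((1 + θ) * u))) := by
    intro u
    have e := iidExp_exp_upper_tilt (p := p) (ζ := ζ) (θ := θ) hm n 1 u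
    simp only [one_mul] at e
    rw [e]
    gcongr
    exact hup _ u (by linarith) (by linarith)
  have hmexp : m ^ n * Real.exp (-(θ * z)) ≤ C₁ * gphi t := by
    have e : m ^ n * Real.exp (-(θ * z)) = Real.exp (n * Real.log m - θ * z) := by
      rw [sub_eq_add_neg, Real.exp_add, Real.exp_nat_mul, Real.exp_log hm]
    have e2 : C₁ * gphi t = Real.exp (-t ^ 2 / 2 + (1 + C * K / σ ^ 3)) := by
      have : √(2 * Real.pi) ≠ 0 := by positivity
      rw [hC₁, gphi, Real.exp_add (-t ^ 2 / 2)]; field_simp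
    rw [e, e2, Real.exp_le_exp]
    linarith [(abs_le.1 hX).2]
  have hφ := gphi_pos t
  calc _ ≤ iidExp p ζ n (fun u => (m ^ n * (C₀ / √n)) *
          (if z ≤ u then Real.exp (-((1 + θ) * u)) else 0)) := by
        refine iidExp_mono h.nonneg fun u => ?_
        split_ifs
        · exact (hinner u).trans (by rw [mul_assoc])
        · simp
    _ = (m ^ n * (C₀ / √n)) * (m ^ n * iidExp (fun a => p a * Real.exp (θ * ζ a) / m) ζ n
          (fun u => if z ≤ u then Real.exp (-((1 + θ + θ) * u)) else 0)) := by
        rw [iidExp_const_mul, iidExp_exp_upper_tilt (θ := θ) hm]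
    _ ≤ (m ^ n * (C₀ / √n)) * (m ^ n * (C₀ / √n * Real.exp (-((1 + θ + θ) * z)))) := by
        gcongr
        exact hup _ z (by linarith) (by linarith)
    _ = C₀ ^ 2 / √n ^ 2 * (m ^ n * Real.exp (-(θ * z))) ^ 2 * Real.exp (-z) := by
        have e : Real.exp (-((1 + θ + θ) * z)) =
            Real.exp (-(θ * z)) ^ 2 * Real.exp (-z) := by
          rw [← Real.exp_nat_mul, ← Real.exp_add]; congr 1; push_cast; ring
        rw [e]; ring
    _ ≤ C₀ ^ 2 / √n ^ 2 * (C₁ * gphi t) ^ 2 * Real.exp (-z) := by gcongr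
    _ = _ := by rw [hr2]; ring

end

end

section

/-- The joint law of input and output under the uniform input distribution. -/
def jointLaw (W : 𝓧 → 𝓨 → ℝ) : 𝓧 × 𝓨 → ℝ := fun a => unifDist 𝓧 a.1 * W a.1 a.2

/-- The centered information density under the uniform input distribution. -/
def centeredDen (W : 𝓧 → 𝓨 → ℝ) : 𝓧 × 𝓨 → ℝ := fun a =>
  iDen W (unifDist 𝓧) a.1 a.2 - capacity W

variable {W : 𝓧 → 𝓨 → ℝ}

lemma isDist_unifDist [Nonempty 𝓧] : IsDist (unifDist 𝓧) :=
  ⟨fun _ => by unfold unifDist; positivity, by simp [unifDist]⟩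

lemma CoverThomasSymmetric.sum_col [Nonempty 𝓨] (hCT : CoverThomasSymmetric W) (hW : IsKernel W) (y : 𝓨) :
    ∑ x, W x y = (Fintype.card 𝓧 : ℝ) / Fintype.card 𝓨 := by
  have h : ∀ y', ∑ x, W x y' = ∑ x, W x y := fun y' => by
    obtain ⟨σ, hσ⟩ := hCT.2 y y'
    simp_rw [hσ]
    exact Equiv.sum_comp σ fun x => W x y
  have h2 : ∑ y', ∑ x, W x y' = Fintype.card 𝓧 := by
    rw [Finset.sum_comm]; simp [hW.2]
  rw [Finset.sum_congr rfl fun y' _ => h y'] at h2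
  rw [eq_div_iff (by positivity), ← h2]
  simp [mul_comm]

lemma CoverThomasSymmetric.outDist_unifDist [Nonempty 𝓧] [Nonempty 𝓨] (hCT : CoverThomasSymmetric W) (hW : IsKernel W)
    (y : 𝓨) : outDist W (unifDist 𝓧) y = (Fintype.card 𝓨 : ℝ)⁻¹ := by
  have : (Fintype.card 𝓧 : ℝ) ≠ 0 := by positivity
  simp only [outDist, unifDist]
  rw [← Finset.mul_sum, hCT.sum_col hW]
  field_simp

lemma CoverThomasSymmetric.iDen_unifDist [Nonempty 𝓧] [Nonempty 𝓨] (hCT : CoverThomasSymmetric W) (hW : IsKernel W)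
    (x : 𝓧) (y : 𝓨) : iDen W (unifDist 𝓧) x y = Real.log (W x y * Fintype.card 𝓨) := by
  rw [iDen, hCT.outDist_unifDist hW, div_inv_eq_mul]

omit [Fintype 𝓧] in
lemma CoverThomasSymmetric.sum_row_congr (hCT : CoverThomasSymmetric W) (F : ℝ → ℝ)
    (x x' : 𝓧) : ∑ y, F (W x y) = ∑ y, F (W x' y) := by
  obtain ⟨σ, hσ⟩ := hCT.1 x x'
  simp_rw [hσ]
  exact (Equiv.sum_comp σ fun y => F (W x y)).symm

lemma IsKernel.mutInfo_le [Nonempty 𝓨] (hW : IsKernel W) {p : 𝓧 → ℝ} (hp : IsDist p) :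
    mutInfo W p ≤ ∑ x, p x * ∑ y, W x y * Real.log (W x y * Fintype.card 𝓨) := by
  set b : ℝ := (Fintype.card 𝓨 : ℝ) with hb
  have hb0 : 0 < b := by rw [hb]; positivity
  have hq0 : ∀ y, 0 ≤ outDist W p y := fun y =>
    Finset.sum_nonneg fun x _ => mul_nonneg (hp.1 x) (hW.1 x y)
  have hterm : ∀ x y, p x * W x y * iDen W p x y ≤
      p x * (W x y * Real.log (W x y * b)) +
        (p x * W x y * (outDist W p y * b)⁻¹ - p x * W x y) := by
    intro x y
    rcases (mul_nonneg (hp.1 x) (hW.1 x y)).eq_or_lt with h0 | h0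
    · rw [← mul_assoc, ← h0]; simp
    · have hw : 0 < W x y := pos_of_mul_pos_right h0 (hp.1 x)
      have hq : 0 < outDist W p y := h0.trans_le
        (Finset.single_le_sum (f := fun x => p x * W x y)
          (fun x _ => mul_nonneg (hp.1 x) (hW.1 x y)) (Finset.mem_univ x))
      have h1 : iDen W p x y = Real.log (W x y * b) + Real.log (outDist W p y * b)⁻¹ := by
        rw [iDen, ← Real.log_mul (by positivity) (by positivity)]
        congr 1; field_simp
      have h2 := Real.log_le_sub_one_of_pos (x := (outDist W p y * b)⁻¹) (by positivity)
      rw [h1]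
      nlinarith
  have hcol : ∀ y, ∑ x, p x * W x y * (outDist W p y * b)⁻¹ ≤ b⁻¹ := fun y => by
    rw [← Finset.sum_mul]
    change outDist W p y * _ ≤ _
    rcases (hq0 y).eq_or_lt with h | h
    · rw [← h]; simp; exact hb0.le
    · apply le_of_eq; field_simp
  have hone : ∑ x, ∑ y, p x * W x y = 1 := by
    simp_rw [← Finset.mul_sum, hW.2, mul_one, hp.2]
  calc mutInfo W p ≤ ∑ x, ∑ y, (p x * (W x y * Real.log (W x y * b)) +
        (p x * W x y * (outDist W p y * b)⁻¹ - p x * W x y)) :=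
        Finset.sum_le_sum fun x _ => Finset.sum_le_sum fun y _ => hterm x y
    _ = (∑ x, p x * ∑ y, W x y * Real.log (W x y * b)) +
        ((∑ y, ∑ x, p x * W x y * (outDist W p y * b)⁻¹) - 1) := by
        rw [Finset.sum_comm (γ := 𝓨) (f := fun y x => p x * W x y * (outDist W p y * b)⁻¹), ← hone]
        simp only [Finset.sum_add_distrib, Finset.sum_sub_distrib, Finset.mul_sum]
    _ ≤ (∑ x, p x * ∑ y, W x y * Real.log (W x y * b)) + ((∑ y : 𝓨, b⁻¹) - 1) := by
        gcongr with y; exact hcol y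
    _ = _ := by
        have : (∑ _y : 𝓨, b⁻¹) = 1 := by simp [hb]
        rw [this]; ring

lemma CoverThomasSymmetric.capacity_eq [Nonempty 𝓧] [Nonempty 𝓨] (hCT : CoverThomasSymmetric W) (hW : IsKernel W) :
    capacity W = mutInfo W (unifDist 𝓧) := by
  have x₀ := Classical.arbitrary 𝓧
  obtain ⟨D, hD⟩ : ∃ D, D = ∑ y, W x₀ y * Real.log (W x₀ y * Fintype.card 𝓨) := ⟨_, rfl⟩
  have hrow : ∀ x, ∑ y, W x y * Real.log (W x y * Fintype.card 𝓨) = D := fun x => by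
    rw [hD]; exact hCT.sum_row_congr (fun w => w * Real.log (w * Fintype.card 𝓨)) x x₀
  have hunif : mutInfo W (unifDist 𝓧) = D := by
    simp only [mutInfo, hCT.iDen_unifDist hW, mul_assoc]
    simp_rw [← Finset.mul_sum, hrow, ← Finset.sum_mul, isDist_unifDist.2, one_mul]
  refine IsGreatest.csSup_eq ⟨⟨_, isDist_unifDist, rfl⟩, ?_⟩
  rintro _ ⟨p, hp, rfl⟩
  refine (hW.mutInfo_le hp).trans (le_of_eq ?_)
  simp_rw [hrow, ← Finset.sum_mul, hp.2, one_mul, hunif]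

lemma CoverThomasSymmetric.exists_isCenteredLaw [Nonempty 𝓧] [Nonempty 𝓨] (hCT : CoverThomasSymmetric W)
    (hW : IsKernel W) : ∃ B : ℝ, 1 ≤ B ∧
      IsCenteredLaw (jointLaw W) (centeredDen W) (ctV W) (ctMoment W 3) B := by
  have hone : ∑ a, jointLaw W a = 1 := by
    rw [Fintype.sum_prod_type]
    simp only [jointLaw, ← Finset.mul_sum, hW.2, mul_one]
    exact isDist_unifDist.2
  refine ⟨1 + ∑ a, |centeredDen W a|, ?_, ?_, hone, ?_, ?_, ?_, ?_⟩
  · have : 0 ≤ ∑ a, |centeredDen W a| := Finset.sum_nonneg fun _ _ => abs_nonneg _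
    linarith
  · exact fun a => mul_nonneg (isDist_unifDist.1 _) (hW.1 _ _)
  · have : ∑ a, jointLaw W a * iDen W (unifDist 𝓧) a.1 a.2 = capacity W := by
      rw [hCT.capacity_eq hW, Fintype.sum_prod_type]; rfl
    unfold centeredDen
    simp only [mul_sub, Finset.sum_sub_distrib]
    rw [this, ← Finset.sum_mul, hone, one_mul, sub_self]
  · rw [Fintype.sum_prod_type]; rfl
  · rw [Fintype.sum_prod_type]; rfl
  · intro a
    have := Finset.single_le_sum (f := fun a => |centeredDen W a|)
      (fun _ _ => abs_nonneg _) (Finset.mem_univ a)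
    linarith

section blocks

variable (hCT : CoverThomasSymmetric W) (hW : IsKernel W)
include hCT hW

omit hW [Fintype 𝓧] in
lemma CoverThomasSymmetric.sum_block_row_congr {n : ℕ} (F : (Fin n → ℝ) → ℝ)
    (x x' : Fin n → 𝓧) :
    ∑ y : Fin n → 𝓨, F (fun i => W (x i) (y i)) = ∑ y : Fin n → 𝓨, F fun i => W (x' i) (y i) := by
  choose σ hσ using hCT.1
  refine (Fintype.sum_equiv (Equiv.piCongrRight fun i => σ (x i) (x' i)) _ _ fun y => ?_).symm
  exact congrArg F (funext fun i => hσ (x i) (x' i) (y i))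

omit hW [Fintype 𝓨] in
lemma CoverThomasSymmetric.sum_block_col_congr {n : ℕ} (F : (Fin n → ℝ) → ℝ)
    (y y' : Fin n → 𝓨) :
    ∑ x : Fin n → 𝓧, F (fun i => W (x i) (y i)) = ∑ x : Fin n → 𝓧, F fun i => W (x i) (y' i) := by
  choose σ hσ using hCT.2
  refine (Fintype.sum_equiv (Equiv.piCongrRight fun i => σ (y i) (y' i)) _ _ fun x => ?_).symm
  exact congrArg F (funext fun i => hσ (y i) (y' i) (x i))

omit hCT hW in
lemma iidExp_jointLaw (n : ℕ) (f : ℝ → ℝ) :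
    iidExp (jointLaw W) (centeredDen W) n f =
      (Fintype.card 𝓧 : ℝ)⁻¹ ^ n * ∑ x : Fin n → 𝓧, ∑ y : Fin n → 𝓨,
        (∏ i, W (x i) (y i)) * f (∑ i, centeredDen W (x i, y i)) := by
  rw [iidExp, ← Fintype.sum_prod_type', Finset.mul_sum]
  refine Fintype.sum_equiv (Equiv.arrowProdEquivProdArrow (Fin n) (fun _ => 𝓧) (fun _ => 𝓨)) _ _ fun a => ?_
  simp [jointLaw, unifDist, Finset.prod_mul_distrib, mul_assoc]

lemma CoverThomasSymmetric.sum_block_row [Nonempty 𝓧] [Nonempty 𝓨] {n : ℕ} (f : ℝ → ℝ) (x : Fin n → 𝓧) :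
    ∑ y : Fin n → 𝓨, (∏ i, W (x i) (y i)) * f (∑ i, centeredDen W (x i, y i)) =
      iidExp (jointLaw W) (centeredDen W) n f := by
  have key : ∀ x' : Fin n → 𝓧,
      ∑ y : Fin n → 𝓨, (∏ i, W (x' i) (y i)) * f (∑ i, centeredDen W (x' i, y i)) =
      ∑ y : Fin n → 𝓨, (∏ i, W (x i) (y i)) * f (∑ i, centeredDen W (x i, y i)) := fun x' => by
    simp only [centeredDen, hCT.iDen_unifDist hW]
    exact hCT.sum_block_row_congr (fun w => (∏ i, w i) *
      f (∑ i, (Real.log (w i * Fintype.card 𝓨) - capacity W))) x' x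
  rw [iidExp_jointLaw, Finset.sum_congr rfl fun x' _ => key x']
  have : (Fintype.card 𝓧 : ℝ) ≠ 0 := by positivity
  simp only [sum_const, card_univ, Fintype.card_fun, Fintype.card_fin, nsmul_eq_mul, Nat.cast_pow]
  rw [← mul_assoc, ← mul_pow, inv_mul_cancel₀ this, one_pow, one_mul]

lemma CoverThomasSymmetric.sum_block_col [Nonempty 𝓧] [Nonempty 𝓨] {n : ℕ} (f : ℝ → ℝ) (y : Fin n → 𝓨) :
    ∑ x : Fin n → 𝓧, (∏ i, W (x i) (y i)) * f (∑ i, centeredDen W (x i, y i)) =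
      (Fintype.card 𝓧 : ℝ) ^ n / Fintype.card 𝓨 ^ n *
        iidExp (jointLaw W) (centeredDen W) n f := by
  have key : ∀ y' : Fin n → 𝓨,
      ∑ x : Fin n → 𝓧, (∏ i, W (x i) (y' i)) * f (∑ i, centeredDen W (x i, y' i)) =
      ∑ x : Fin n → 𝓧, (∏ i, W (x i) (y i)) * f (∑ i, centeredDen W (x i, y i)) := fun y' => by
    simp only [centeredDen, hCT.iDen_unifDist hW]
    exact hCT.sum_block_col_congr (fun w => (∏ i, w i) *
      f (∑ i, (Real.log (w i * Fintype.card 𝓨) - capacity W))) y' y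
  rw [iidExp_jointLaw, Finset.sum_comm, Finset.sum_congr rfl fun y' _ => key y']
  have : (Fintype.card 𝓧 : ℝ) ≠ 0 := by positivity
  have : (Fintype.card 𝓨 : ℝ) ≠ 0 := by positivity
  simp only [sum_const, card_univ, Fintype.card_fun, Fintype.card_fin, nsmul_eq_mul, Nat.cast_pow]
  rw [inv_pow]
  field_simp

lemma CoverThomasSymmetric.prod_block_eq [Nonempty 𝓧] [Nonempty 𝓨] {n : ℕ} {x : Fin n → 𝓧} {y : Fin n → 𝓨}
    (h : 0 < ∏ i, W (x i) (y i)) :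
    ∏ i, W (x i) (y i) = Real.exp (n * capacity W + ∑ i, centeredDen W (x i, y i)) /
      (Fintype.card 𝓨 : ℝ) ^ n := by
  have hpos : ∀ i, 0 < W (x i) (y i) := fun i => (hW.1 _ _).lt_of_ne' fun h0 =>
    h.ne' (Finset.prod_eq_zero (Finset.mem_univ i) h0)
  have e : (n : ℝ) * capacity W + ∑ i, centeredDen W (x i, y i) =
      ∑ i, Real.log (W (x i) (y i) * Fintype.card 𝓨) := by
    simp [centeredDen, hCT.iDen_unifDist hW]
  rw [e, Real.exp_sum, eq_div_iff (by positivity)]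
  rw [Finset.prod_congr rfl fun i _ => Real.exp_log (mul_pos (hpos i) (by positivity)),
    Finset.prod_mul_distrib]
  simp

lemma CoverThomasSymmetric.prod_block_le [Nonempty 𝓧] [Nonempty 𝓨] {n : ℕ} {x : Fin n → 𝓧} {y : Fin n → 𝓨} {w : ℝ}
    (h : ∑ i, centeredDen W (x i, y i) ≤ w) :
    ∏ i, W (x i) (y i) ≤ Real.exp (n * capacity W + w) / (Fintype.card 𝓨 : ℝ) ^ n := by
  rcases (Finset.prod_nonneg fun i _ => hW.1 (x i) (y i)).eq_or_lt with h0 | h0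
  · rw [← h0]; positivity
  · rw [hCT.prod_block_eq hW h0]; gcongr

end blocks

end

section

open scoped BigOperators

section

variable [Nonempty 𝓧] [Nonempty 𝓨] {W : 𝓧 → 𝓨 → ℝ}

/-- Meta-converse: few codewords can be told apart when the information density is small. -/
theorem CoverThomasSymmetric.size_mul_le (hCT : CoverThomasSymmetric W) (hW : IsKernel W)
    {n M : ℕ} {e : ℝ} (hcode : ExistsCode W n M e) (w : ℝ) :
    (M : ℝ) * (1 - e - iidExp (jointLaw W) (centeredDen W) n (fun x => if w < x then 1 else 0)) ≤
      Real.exp (n * capacity W + w) := by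
  obtain ⟨f, g, hfg⟩ := hcode
  rcases Nat.eq_zero_or_pos M with rfl | hM
  · simp; positivity
  have hM0 : (0 : ℝ) < M := by exact_mod_cast hM
  obtain ⟨P, hP⟩ : ∃ P, P = iidExp (jointLaw W) (centeredDen W) n
    (fun x => if w < x then 1 else 0) := ⟨_, rfl⟩
  obtain ⟨E, hE⟩ : ∃ E, E = Real.exp (n * capacity W + w) := ⟨_, rfl⟩
  have hE0 : 0 < E := hE ▸ Real.exp_pos _
  obtain ⟨b, hb⟩ : ∃ b : ℝ, b = (Fintype.card 𝓨 : ℝ) ^ n := ⟨_, rfl⟩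
  have hb0 : 0 < b := by rw [hb]; positivity
  have hpt : ∀ (m : Fin M) (y : Fin n → 𝓨), (if g y = m then ∏ i, W (f m i) (y i) else 0) ≤
      (∏ i, W (f m i) (y i)) *
        (if w < ∑ i, centeredDen W (f m i, y i) then 1 else 0) +
      (if g y = m then E / b else 0) := by
    intro m y
    have h0 : 0 ≤ ∏ i, W (f m i) (y i) := Finset.prod_nonneg fun i _ => hW.1 _ _
    have hEb : 0 ≤ E / b := by positivity
    by_cases hg : g y = m
    · simp only [hg, if_true]
      split_ifs with h
      · linarith
      · have := hCT.prod_block_le hW (not_lt.1 h)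
        rw [← hE, ← hb] at this
        linarith
    · simp only [hg, if_false, add_zero]
      split_ifs <;> simp [h0]
  have hsum : ∑ m : Fin M, ∑ y : Fin n → 𝓨, (if g y = m then ∏ i, W (f m i) (y i) else 0) ≤
      M * P + E := by
    calc _ ≤ ∑ m : Fin M, ∑ y : Fin n → 𝓨, ((∏ i, W (f m i) (y i)) *
        (if w < ∑ i, centeredDen W (f m i, y i) then 1 else 0) +
        (if g y = m then E / b else 0)) :=
          Finset.sum_le_sum fun m _ => Finset.sum_le_sum fun y _ => hpt m y
      _ = M * P + E := by
          have e1 : ∀ m : Fin M, ∑ y : Fin n → 𝓨, (∏ i, W (f m i) (y i)) *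
              (if w < ∑ i, centeredDen W (f m i, y i) then 1 else 0) = P := fun m => by
            rw [hP]
            exact hCT.sum_block_row hW (fun x => if w < x then 1 else 0) (f m)
          have e2 : ∑ m : Fin M, ∑ y : Fin n → 𝓨, (if g y = m then E / b else 0) = E := by
            rw [Finset.sum_comm]
            simp only [Finset.sum_ite_eq, Finset.mem_univ, if_true, sum_const, card_univ,
              Fintype.card_fun, Fintype.card_fin, nsmul_eq_mul, Nat.cast_pow]
            rw [← hb]; field_simp
          simp only [Finset.sum_add_distrib, e1, e2]
          simp
  rw [avgErr] at hfg
  rw [← hP, ← hE]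
  have h1 : 1 - e ≤ (M : ℝ)⁻¹ * (M * P + E) := by
    have := mul_le_mul_of_nonneg_left hsum (inv_nonneg.2 hM0.le)
    linarith
  have h2 := mul_le_mul_of_nonneg_left h1 hM0.le
  rw [← mul_assoc, mul_inv_cancel₀ hM0.ne'] at h2
  linarith

lemma Fintype.expect_apply_eq {ι X : Type*} [Fintype ι] [DecidableEq ι] [Fintype X] [Nonempty X] (i : ι)
    (G : X → ℝ) : 𝔼 f : ι → X, G (f i) = 𝔼 x, G x := by
  rw [Fintype.expect_equiv (Equiv.funSplitAt i X) (fun f => G (f i)) (fun a => G a.1)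
    fun f => rfl, ← Finset.univ_product_univ, Finset.expect_product]
  simp

lemma Fintype.expect_apply_apply_eq {ι X : Type*} [Fintype ι] [DecidableEq ι] [Fintype X] [Nonempty X]
    {i j : ι} (hij : j ≠ i) (F : X → X → ℝ) :
    𝔼 f : ι → X, F (f i) (f j) = 𝔼 x, 𝔼 x', F x x' := by
  rw [Fintype.expect_equiv (Equiv.funSplitAt i X) (fun f => F (f i) (f j))
    (fun a => F a.1 (a.2 ⟨j, hij⟩)) fun f => rfl, ← Finset.univ_product_univ, Finset.expect_product]
  exact Finset.expect_congr rfl fun x _ =>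
    Fintype.expect_apply_eq (⟨j, hij⟩ : {k // k ≠ i}) (F x)

/-- Random coding union bound with a threshold on the information density. -/
theorem CoverThomasSymmetric.exists_code_of_le (hCT : CoverThomasSymmetric W) (hW : IsKernel W)
    {n M : ℕ} (hM : 0 < M) {e w : ℝ}
    (he : iidExp (jointLaw W) (centeredDen W) n (fun x => if x < w then 1 else 0) +
      M * (Real.exp (-(n * capacity W)) * iidExp (jointLaw W) (centeredDen W) n
        (fun u => if w ≤ u then iidExp (jointLaw W) (centeredDen W) n
          (fun x => if u ≤ x then Real.exp (-x) else 0) else 0)) ≤ e) :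
    ExistsCode W n M e := by
  have : Nonempty (Fin M) := ⟨⟨0, hM⟩⟩
  have hM0 : (0 : ℝ) < M := by exact_mod_cast hM
  obtain ⟨P, hP⟩ : ∃ P : (Fin n → 𝓧) → (Fin n → 𝓨) → ℝ,
    P = fun x y => ∏ i, W (x i) (y i) := ⟨_, rfl⟩
  obtain ⟨S, hS⟩ : ∃ S : (Fin n → 𝓧) → (Fin n → 𝓨) → ℝ,
    S = fun x y => ∑ i, centeredDen W (x i, y i) := ⟨_, rfl⟩
  obtain ⟨Q, hQ⟩ : ∃ Q : ℝ → ℝ, Q = fun u => iidExp (jointLaw W) (centeredDen W) n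
    (fun x => if u ≤ x then Real.exp (-x) else 0) := ⟨_, rfl⟩
  obtain ⟨E, hE⟩ : ∃ E, E = Real.exp (-(n * capacity W)) := ⟨_, rfl⟩
  have hE0 : 0 < E := hE ▸ Real.exp_pos _
  have hP0 : ∀ x y, 0 ≤ P x y := fun x y => by
    rw [hP]; exact Finset.prod_nonneg fun i _ => hW.1 _ _
  have hrow : ∀ (F : ℝ → ℝ) x, ∑ y, P x y * F (S x y) =
      iidExp (jointLaw W) (centeredDen W) n F := fun F x => by
    rw [hP, hS]; exact hCT.sum_block_row hW F x
  have hlaw1 : ∑ a, jointLaw W a = 1 := by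
    obtain ⟨B, -, h⟩ := hCT.exists_isCenteredLaw hW
    exact h.sum_one
  have hP1 : ∀ x, ∑ y, P x y = 1 := fun x => by
    have := hrow (fun _ => 1) x
    rw [iidExp_const hlaw1] at this
    simpa using this
  choose g hg using fun (f : Fin M → Fin n → 𝓧) (y : Fin n → 𝓨) =>
    Finite.exists_max fun m => P (f m) y
  have hpair : ∀ x y, P x y * 𝔼 x', (if P x y ≤ P x' y then (1 : ℝ) else 0) ≤
      P x y * (E * Q (S x y)) := by
    intro x y
    rcases (hP0 x y).eq_or_lt with h0 | h0
    · rw [← h0]; simp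
    refine mul_le_mul_of_nonneg_left ?_ h0.le
    have hden : ∀ x', 0 < P x' y → P x' y = Real.exp (n * capacity W + S x' y) /
        (Fintype.card 𝓨 : ℝ) ^ n := fun x' h => by
      rw [hP] at h ⊢; rw [hS]; exact hCT.prod_block_eq hW h
    calc 𝔼 x', (if P x y ≤ P x' y then (1 : ℝ) else 0)
        ≤ 𝔼 x', (E * (Fintype.card 𝓨 : ℝ) ^ n) * (P x' y *
          (if S x y ≤ S x' y then Real.exp (-S x' y) else 0)) := by
          refine Finset.expect_le_expect fun x' _ => ?_
          split_ifs with h1 h2 h2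
          · rw [hden x' (h0.trans_le h1), hE]
            apply le_of_eq
            rw [Real.exp_add, Real.exp_neg, Real.exp_neg]
            have : (Fintype.card 𝓨 : ℝ) ≠ 0 := by positivity
            field_simp
          · exfalso
            apply h2
            have h3 := h1
            rw [hden x h0, hden x' (h0.trans_le h1),
              div_le_div_iff_of_pos_right (by positivity), Real.exp_le_exp] at h3
            linarith
          · have := hP0 x' y
            positivity
          · simp
      _ = E * Q (S x y) := by
          rw [← Finset.mul_expect, Fintype.expect_eq_sum_div_card, hQ]
          have := hCT.sum_block_col hW (fun v => if S x y ≤ v then Real.exp (-v) else 0) y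
          simp only [hP, hS] at this ⊢
          rw [this]
          have : (Fintype.card 𝓨 : ℝ) ≠ 0 := by positivity
          have : (Fintype.card 𝓧 : ℝ) ≠ 0 := by positivity
          simp only [Fintype.card_fun, Fintype.card_fin, Nat.cast_pow]
          field_simp
  obtain ⟨err, herr⟩ : ∃ err : (Fin M → Fin n → 𝓧) → ℝ, err = fun f => ∑ m : Fin M,
      ∑ y : Fin n → 𝓨, (P (f m) y * (if S (f m) y < w then 1 else 0) +
        ∑ m' ∈ univ.erase m, P (f m) y * (if w ≤ S (f m) y then
          (if P (f m) y ≤ P (f m') y then 1 else 0) else 0)) := ⟨_, rfl⟩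
  have hle : ∀ f, avgErr W n M f (g f) ≤ (M : ℝ)⁻¹ * err f := by
    intro f
    have h1 : (1 : ℝ) = (M : ℝ)⁻¹ * ∑ m : Fin M, ∑ y, P (f m) y := by
      simp [hP1, hM0.ne']
    rw [avgErr]
    conv_lhs => enter [1]; rw [h1]
    rw [← mul_sub, ← Finset.sum_sub_distrib, herr]
    refine mul_le_mul_of_nonneg_left (Finset.sum_le_sum fun m _ => ?_) (by positivity)
    rw [← Finset.sum_sub_distrib]
    refine Finset.sum_le_sum fun y _ => ?_
    have hPy : ∏ i, W (f m i) (y i) = P (f m) y := by rw [hP]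
    rw [hPy]
    have hp := hP0 (f m) y
    have hterm : ∀ m', 0 ≤ P (f m) y * (if w ≤ S (f m) y then
          (if P (f m) y ≤ P (f m') y then (1 : ℝ) else 0) else 0) := fun m' => by
      split_ifs <;> simp [hp]
    by_cases hgm : g f y = m
    · rw [if_pos hgm, sub_self]
      refine add_nonneg ?_ (Finset.sum_nonneg fun m' _ => hterm m')
      split_ifs <;> simp [hp]
    · rw [if_neg hgm, sub_zero]
      by_cases hw : S (f m) y < w
      · rw [if_pos hw, mul_one]
        exact le_add_of_nonneg_right (Finset.sum_nonneg fun m' _ => hterm m')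
      · have hmem : g f y ∈ univ.erase m := by simp [hgm]
        have h3 := Finset.single_le_sum (fun m' _ => hterm m') hmem
        rw [if_pos (not_lt.1 hw), if_pos (hg f y m), mul_one] at h3
        rw [if_neg hw, mul_zero, zero_add]
        exact h3
  have hexp : 𝔼 f, err f ≤ M * e := by
    have e1 : ∀ m : Fin M, 𝔼 f : Fin M → Fin n → 𝓧, ∑ y : Fin n → 𝓨,
        P (f m) y * (if S (f m) y < w then (1 : ℝ) else 0) =
        iidExp (jointLaw W) (centeredDen W) n (fun x => if x < w then 1 else 0) := fun m => by
      simp only [hrow fun x => if x < w then 1 else 0]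
      exact Fintype.expect_const _
    obtain ⟨T, hT⟩ : ∃ T, T = E * iidExp (jointLaw W) (centeredDen W) n
      (fun u => if w ≤ u then Q u else 0) := ⟨_, rfl⟩
    have e2 : ∀ m m' : Fin M, m' ≠ m → 𝔼 f : Fin M → Fin n → 𝓧, ∑ y : Fin n → 𝓨,
        P (f m) y * (if w ≤ S (f m) y then
          (if P (f m) y ≤ P (f m') y then (1 : ℝ) else 0) else 0) ≤ T := by
      intro m m' hm
      rw [Fintype.expect_apply_apply_eq hm (fun x x' => ∑ y : Fin n → 𝓨,
        P x y * (if w ≤ S x y then (if P x y ≤ P x' y then (1 : ℝ) else 0) else 0))]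
      refine Finset.expect_le univ_nonempty fun x _ => ?_
      rw [Finset.expect_sum_comm, hT, ← hrow _ x, Finset.mul_sum]
      refine Finset.sum_le_sum fun y _ => ?_
      split_ifs with hw
      · rw [← Finset.mul_expect]
        exact (hpair x y).trans (le_of_eq (by ring))
      · simp
    have hT0 : 0 ≤ T := by
      rw [hT]
      have hq : ∀ a, 0 ≤ jointLaw W a := fun a => mul_nonneg (isDist_unifDist.1 _) (hW.1 _ _)
      refine mul_nonneg hE0.le (iidExp_nonneg hq fun u => ?_)
      split_ifs
      · rw [hQ]
        refine iidExp_nonneg hq fun v => ?_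
        split_ifs
        · positivity
        · rfl
      · rfl
    have he' : iidExp (jointLaw W) (centeredDen W) n (fun x => if x < w then 1 else 0) +
        M * T ≤ e := by rw [hT, hQ, hE]; exact he
    rw [herr, Finset.expect_sum_comm]
    calc _ ≤ ∑ m : Fin M, e := by
          refine Finset.sum_le_sum fun m _ => ?_
          simp only [Finset.sum_add_distrib, Finset.expect_add_distrib]
          rw [e1]
          refine le_trans ?_ he'
          gcongr
          simp only [Finset.sum_comm (s := (univ : Finset (Fin n → 𝓨)))]
          rw [Finset.expect_sum_comm]
          calc _ ≤ ∑ m' ∈ univ.erase m, T :=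
                Finset.sum_le_sum fun m' hm' => e2 m m' (Finset.ne_of_mem_erase hm')
            _ ≤ ∑ m' : Fin M, T :=
                Finset.sum_le_sum_of_subset_of_nonneg (Finset.subset_univ _) fun _ _ _ => hT0
            _ = M * T := by simp
      _ = M * e := by simp
  obtain ⟨f, hf⟩ := Finite.exists_min err
  refine ⟨f, g f, (hle f).trans ?_⟩
  have := (Finset.le_expect univ_nonempty fun f' _ => hf f').trans hexp
  rw [inv_mul_le_iff₀ hM0]
  exact this

end

end

section

variable [Nonempty 𝓧] [Nonempty 𝓨] {W : 𝓧 → 𝓨 → ℝ}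

lemma CoverThomasSymmetric.existsCode_one (hCT : CoverThomasSymmetric W) (hW : IsKernel W)
    (n : ℕ) {e : ℝ} (he : 0 ≤ e) : ExistsCode W n 1 e := by
  refine ⟨fun _ _ => Classical.arbitrary 𝓧, fun _ => 0, ?_⟩
  obtain ⟨B, -, h⟩ := hCT.exists_isCenteredLaw hW
  have := hCT.sum_block_row hW (fun _ => 1) (fun _ : Fin n => Classical.arbitrary 𝓧)
  rw [iidExp_const h.sum_one] at this
  simp only [mul_one] at this
  simp [avgErr, this, he]

theorem CoverThomasSymmetric.exists_log_Mstar_bounds (hCT : CoverThomasSymmetric W)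
    (hW : IsKernel W) {σ : ℝ} (hσ : 0 < σ) (hV : ctV W = σ ^ 2) {K : ℝ} (hK : 0 ≤ K) :
    ∃ (L : ℝ) (N : ℕ), 0 < N ∧ ∀ n : ℕ, N ≤ n → ∀ e q : ℝ, 0 < e → e < 1 → gaussQ q = e →
      |q| ^ 3 ≤ K * √n →
      |Real.log (Mstar W n e) - (n * capacity W - √n * σ * q +
        (ctMoment W 3 / (6 * σ ^ 2) + 1 / 2) * q ^ 2 + 1 / 2 * Real.log n)| ≤ L := by
  obtain ⟨B, hB, hlaw⟩ := hCT.exists_isCenteredLaw hW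
  rw [hV] at hlaw
  obtain ⟨A, hA, N₁, hN₁, htail⟩ := hlaw.exists_tail_bounds hB hσ hK zero_le_one
  obtain ⟨D, hD, hdouble⟩ := hlaw.exists_double_tail_le hB hσ K
  obtain ⟨N₂, hN₂, hdouble⟩ := hdouble A hA
  refine ⟨A + |1 / 2 * Real.log (2 * Real.pi)| + |Real.log D| + Real.log 2, max N₁ N₂,
    lt_max_of_lt_left hN₁, fun n hn e q he0 he1 hq hqK => ?_⟩
  have hn0 : (0 : ℝ) < n := by exact_mod_cast (lt_max_of_lt_left hN₁).trans_le hn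
  have hr0 : 0 < √(n : ℝ) := Real.sqrt_pos.2 hn0
  have hr2 : √(n : ℝ) ^ 2 = n := Real.sq_sqrt hn0.le
  have hlogr : Real.log √(n : ℝ) = 1 / 2 * Real.log n := by
    rw [Real.log_sqrt hn0.le]; ring
  have htK : |-q| ^ 3 ≤ K * √n := by rwa [abs_neg]
  obtain ⟨htail1, htail2⟩ := htail n ((le_max_left _ _).trans hn) (-q) htK
  obtain ⟨z, hz⟩ : ∃ z, z = √n * σ * -q + ctMoment W 3 / (6 * σ ^ 2) * (-q) ^ 2 := ⟨_, rfl⟩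
  have hdbl := hdouble n ((le_max_right _ _).trans hn) (-q) (z - A) htK (by rw [hz])
  rw [← hz, gaussQ_neg, hq, one_mul] at htail1 htail2
  obtain ⟨φ, hφ⟩ : ∃ φ, φ = gphi (-q) := ⟨_, rfl⟩
  have hφ0 : 0 < φ := hφ ▸ gphi_pos _
  have hlogφ : Real.log φ = -(1 / 2 * Real.log (2 * Real.pi)) - q ^ 2 / 2 := by
    rw [hφ, log_gphi, neg_sq]
  rw [← hφ] at htail1 htail2 hdbl
  have hlog2 : 0 ≤ Real.log 2 := Real.log_nonneg one_le_two
  have hpi := abs_le.1 (le_refl |1 / 2 * Real.log (2 * Real.pi)|)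
  have hDabs := abs_le.1 (le_refl |Real.log D|)
  have hup : ∀ M : ℕ, ExistsCode W n M e →
      (M : ℝ) ≤ Real.exp (n * capacity W + (z + A)) * √n / φ := fun M hM => by
    have h1 := hCT.size_mul_le hW hM (z + A)
    rw [le_div_iff₀ hφ0]
    have h2 : (M : ℝ) * (φ / √n) ≤ Real.exp (n * capacity W + (z + A)) :=
      (mul_le_mul_of_nonneg_left (by linarith) (Nat.cast_nonneg M)).trans h1
    rw [← mul_div_assoc, div_le_iff₀ hr0] at h2
    exact h2
  have hbdd : BddAbove {M | ExistsCode W n M e} :=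
    ⟨⌊Real.exp (n * capacity W + (z + A)) * √n / φ⌋₊, fun M hM => Nat.le_floor (hup M hM)⟩
  have hone := hCT.existsCode_one hW n he0.le
  have hmem : ExistsCode W n (Mstar W n e) e := Nat.sSup_mem ⟨1, hone⟩ hbdd
  have hM1 : 1 ≤ Mstar W n e := le_csSup hbdd hone
  have hM0 : (0 : ℝ) < Mstar W n e := by exact_mod_cast hM1
  rw [abs_le]
  constructor
  · obtain ⟨X, hX⟩ : ∃ X, X = Real.exp (n * capacity W + (z - A)) * √n / (D * φ) := ⟨_, rfl⟩
    have hX0 : 0 < X := by rw [hX]; positivity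
    have hlogX : Real.log X = n * capacity W + (z - A) + 1 / 2 * Real.log n -
        (Real.log D + Real.log φ) := by
      rw [hX, Real.log_div (by positivity) (by positivity), Real.log_mul (by positivity)
        (by positivity), Real.log_mul (by positivity) (by positivity), Real.log_exp, hlogr]
    have hlow : Real.log X - Real.log 2 ≤ Real.log (Mstar W n e) := by
      rcases lt_or_ge X 1 with h | h
      · have h1 := Real.log_nonpos hX0.le h.le
        have h2 : 0 ≤ Real.log (Mstar W n e) := Real.log_nonneg (by exact_mod_cast hM1)
        linarith
      · have hfl : 0 < ⌊X⌋₊ := Nat.floor_pos.2 h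
        have hcode : ExistsCode W n ⌊X⌋₊ e := by
          refine hCT.exists_code_of_le hW hfl (w := z - A) ?_
          have h1 : iidExp (jointLaw W) (centeredDen W) n (fun x => if x < z - A then 1 else 0) ≤
              e - φ / √n := by
            have h2 : iidExp (jointLaw W) (centeredDen W) n
                (fun x => if x < z - A then 1 else 0) ≤
                iidExp (jointLaw W) (centeredDen W) n
                  (fun x => 1 - if z - A < x then 1 else 0) := by
              refine iidExp_mono hlaw.nonneg fun x => ?_
              split_ifs <;> linarith
            rw [iidExp_sub, iidExp_const hlaw.sum_one] at h2
            linarith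
          have h3 : ⌊X⌋₊ * (Real.exp (-(n * capacity W)) *
              iidExp (jointLaw W) (centeredDen W) n (fun u => if z - A ≤ u then
                iidExp (jointLaw W) (centeredDen W) n
                  (fun x => if u ≤ x then Real.exp (-x) else 0) else 0)) ≤ φ / √n := by
            calc _ ≤ ⌊X⌋₊ * (Real.exp (-(n * capacity W)) *
                  (D * φ ^ 2 / n * Real.exp (-(z - A)))) := by gcongr
              _ ≤ X * (Real.exp (-(n * capacity W)) *
                  (D * φ ^ 2 / n * Real.exp (-(z - A)))) := by
                  gcongr
                  exact Nat.floor_le hX0.le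
              _ = φ / √n := by
                  rw [hX, Real.exp_add, Real.exp_neg, Real.exp_neg]
                  field_simp
                  rw [hr2]
          linarith
        have hle : ⌊X⌋₊ ≤ Mstar W n e := le_csSup hbdd hcode
        have hle' : X / 2 ≤ Mstar W n e := by
          have h1 : (⌊X⌋₊ : ℝ) ≤ Mstar W n e := by exact_mod_cast hle
          have h2 : (1 : ℝ) ≤ ⌊X⌋₊ := by exact_mod_cast hfl
          have h3 := Nat.lt_floor_add_one X
          linarith
        rw [← Real.log_div hX0.ne' two_ne_zero]
        exact Real.log_le_log (by positivity) hle'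
    rw [hlogX, hlogφ, hz] at hlow
    linarith
  · have h1 := Real.log_le_log hM0 (hup _ hmem)
    rw [Real.log_div (by positivity) (by positivity), Real.log_mul (by positivity)
      (by positivity), Real.log_exp, hlogr, hlogφ, hz] at h1
    linarith

end

/-- channel skewness of Cover–Thomas symmetric channels in the SMD regime:
for a Cover–Thomas symmetric channel with dispersion `V > 0` under the uniform input
distribution, and an SMD sequence `ε_n` with `Q⁻¹(ε_n) = O(n^{1/6})`,
`ζ(n,ε_n) = (1/2)·log n + S·Q⁻¹(ε_n)² + O(1)`, where `S = Sk_u(P*)·√V/6 + 1/2`. -/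
theorem coverThomas_skewness_SMD
    {𝓧 𝓨 : Type*} [Fintype 𝓧] [Fintype 𝓨] [Nonempty 𝓧] [Nonempty 𝓨]
    (W : 𝓧 → 𝓨 → ℝ) (hW : IsKernel W)
    (hCT : CoverThomasSymmetric W)
    (hV : 0 < ctV W)
    (ε : ℕ → ℝ) (hε : IsSMD ε)
    (hgrowth : (fun n : ℕ => gaussQinv (ε n)) =O[atTop] fun n : ℕ => (n : ℝ) ^ ((1 : ℝ) / 6)) :
    ∃ C : ℝ, ∀ᶠ n : ℕ in atTop,
      |ctZeta W n (ε n) - ((1 / 2) * Real.log n + ctS W * gaussQinv (ε n) ^ 2)| ≤ C := by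
  obtain ⟨K, hK, hbound⟩ := hgrowth.exists_pos
  have hσ : 0 < √(ctV W) := Real.sqrt_pos.2 hV
  have hσ2 : ctV W = √(ctV W) ^ 2 := (Real.sq_sqrt hV.le).symm
  obtain ⟨L, N, hN, hL⟩ := hCT.exists_log_Mstar_bounds hW hσ hσ2 (pow_pos hK 3).le
  have hS : ctS W = ctMoment W 3 / (6 * √(ctV W) ^ 2) + 1 / 2 := by
    have h1 : ctV W ^ ((3 : ℝ) / 2) = √(ctV W) ^ 3 := by
      rw [Real.sqrt_eq_rpow, ← Real.rpow_natCast, ← Real.rpow_mul hV.le]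
      norm_num
    rw [ctS, h1]
    field_simp
  refine ⟨L, ?_⟩
  filter_upwards [hbound.bound, eventually_ge_atTop N] with n hn hnN
  have hq : |gaussQinv (ε n)| ^ 3 ≤ K ^ 3 * √n := by
    have hn0 : (0 : ℝ) ≤ n := Nat.cast_nonneg n
    rw [Real.norm_eq_abs, Real.norm_of_nonneg (by positivity)] at hn
    calc |gaussQinv (ε n)| ^ 3 ≤ (K * (n : ℝ) ^ ((1 : ℝ) / 6)) ^ 3 := by gcongr
      _ = K ^ 3 * √n := by
        rw [mul_pow, ← Real.rpow_natCast ((n : ℝ) ^ _), ← Real.rpow_mul hn0, Real.sqrt_eq_rpow]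
        norm_num
  have h := hL n hnN (ε n) (gaussQinv (ε n)) (hε.1 n).1 (hε.1 n).2
    (gaussQ_gaussQinv (hε.1 n).1 (hε.1 n).2) hq
  rw [ctZeta, hS, Real.sqrt_mul (Nat.cast_nonneg n)]
  refine le_of_eq_of_le ?_ h
  congr 1
  ring
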